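/- arXiv:1208.5289 — 2 statements merged into one kernel-verified Lean document; each statement's English description precedes it below -/
import Mathlib

section
/- For all constants ε > 0 and d > 0 there exists a constant c > 0 such that the following holds. Let n and ℓ be integers with 3 ≤ ℓ ≤ (d·n)^((1−ε)/2), and let P be a set of n points in the plane ℝ² with at most ℓ collinear. Then P contains a subset of at least c·√(n·log n / log ℓ) points in general position. -/
/-- A finite point set has "at most ℓ collinear" if every collinear subset has ≤ ℓ points. -/
def AtMostCollinear (P : Finset (ℝ × ℝ)) (ℓ : ℕ) : Prop :=
  ∀ T ⊆ P, Collinear ℝ (T : Set (ℝ × ℝ)) → T.card ≤ ℓ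

/-- A finite point set is in general position if no three of its points are collinear. -/
def GeneralPosition (S : Finset (ℝ × ℝ)) : Prop :=
  ∀ T ⊆ S, Collinear ℝ (T : Set (ℝ × ℝ)) → T.card ≤ 2

section Drawings

/-- The slope of the line through two points of the plane with distinct abscissae. -/
noncomputable def slopeOf (a b : ℝ × ℝ) : ℝ := (b.2 - a.2) / (b.1 - a.1)

/-- The ordinate at `x` of the line through `a` and `b`. -/
noncomputable def lineAt (a b : ℝ × ℝ) (x : ℝ) : ℝ := a.2 + slopeOf a b * (x - a.1)

/-- The segments `ab` and `cd` cross at a point interior to both. -/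
def ProperlyCross (a b c d : ℝ × ℝ) : Prop :=
  (c.2 - lineAt a b c.1) * (d.2 - lineAt a b d.1) < 0 ∧
    (a.2 - lineAt c d a.1) * (b.2 - lineAt c d b.1) < 0

lemma lineAt_left (a b : ℝ × ℝ) : lineAt a b a.1 = a.2 := by simp [lineAt]

lemma lineAt_right_of_ne {a b : ℝ × ℝ} (h : a.1 ≠ b.1) : lineAt a b b.1 = b.2 := by
  have : b.1 - a.1 ≠ 0 := sub_ne_zero.2 h.symm
  simp only [lineAt, slopeOf]
  field_simp
  ring

lemma lineAt_right {a b : ℝ × ℝ} (h : a.1 < b.1) : lineAt a b b.1 = b.2 :=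
  lineAt_right_of_ne h.ne

lemma lineAt_sub (a b : ℝ × ℝ) (x y : ℝ) :
    lineAt a b x - lineAt a b y = slopeOf a b * (x - y) := by
  simp only [lineAt]; ring

lemma properlyCross_of_above {p q r s : ℝ × ℝ} {x : ℝ} (hpr : p.1 < r.1) (hrx : r.1 < x)
    (hxq : x ≤ q.1) (hxs : x ≤ s.1) (hr : lineAt p q r.1 < r.2)
    (hx : lineAt r s x < lineAt p q x) : ProperlyCross p q r s := by
  have hq := lineAt_right (show p.1 < q.1 by linarith)
  have hs := lineAt_right (show r.1 < s.1 by linarith)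
  have hp := lineAt_left p q
  have hr' := lineAt_left r s
  have key : ∀ y z, (lineAt p q y - lineAt r s y) - (lineAt p q z - lineAt r s z)
      = (slopeOf p q - slopeOf r s) * (y - z) := by
    intro y z
    linear_combination lineAt_sub p q y z - lineAt_sub r s y z
  have hB : 0 < slopeOf p q - slopeOf r s := by
    have := key x r.1
    by_contra hneg
    nlinarith
  have h1 := key s.1 x
  have h2 := key q.1 x
  have h3 := key p.1 r.1
  have e1 : 0 ≤ (slopeOf p q - slopeOf r s) * (s.1 - x) := mul_nonneg hB.le (by linarith)
  have e2 : 0 ≤ (slopeOf p q - slopeOf r s) * (q.1 - x) := mul_nonneg hB.le (by linarith)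
  have e3 : (slopeOf p q - slopeOf r s) * (p.1 - r.1) < 0 :=
    mul_neg_of_pos_of_neg hB (by linarith)
  exact ⟨mul_neg_of_pos_of_neg (by linarith) (by linarith),
    mul_neg_of_neg_of_pos (by linarith) (by linarith)⟩

lemma properlyCross_of_below {p q r s : ℝ × ℝ} {x : ℝ} (hpr : p.1 < r.1) (hrx : r.1 < x)
    (hxq : x ≤ q.1) (hxs : x ≤ s.1) (hr : r.2 < lineAt p q r.1)
    (hx : lineAt p q x < lineAt r s x) : ProperlyCross p q r s := by
  have hq := lineAt_right (show p.1 < q.1 by linarith)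
  have hs := lineAt_right (show r.1 < s.1 by linarith)
  have hp := lineAt_left p q
  have hr' := lineAt_left r s
  have key : ∀ y z, (lineAt p q y - lineAt r s y) - (lineAt p q z - lineAt r s z)
      = (slopeOf p q - slopeOf r s) * (y - z) := by
    intro y z
    linear_combination lineAt_sub p q y z - lineAt_sub r s y z
  have hB : slopeOf p q - slopeOf r s < 0 := by
    have := key x r.1
    by_contra hneg
    nlinarith
  have h1 := key s.1 x
  have h2 := key q.1 x
  have h3 := key p.1 r.1
  have e1 : (slopeOf p q - slopeOf r s) * (s.1 - x) ≤ 0 :=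
    mul_nonpos_of_nonpos_of_nonneg hB.le (by linarith)
  have e2 : (slopeOf p q - slopeOf r s) * (q.1 - x) ≤ 0 :=
    mul_nonpos_of_nonpos_of_nonneg hB.le (by linarith)
  have e3 : 0 < (slopeOf p q - slopeOf r s) * (p.1 - r.1) :=
    mul_pos_of_neg_of_neg hB (by linarith)
  exact ⟨mul_neg_of_neg_of_pos (by linarith) (by linarith),
    mul_neg_of_pos_of_neg (by linarith) (by linarith)⟩

/-- A straight-line drawing with vertex set `P` (distinct abscissae), edges directed from left to
right, in which no edge passes through a vertex. -/
structure IsDrawing (P : Finset (ℝ × ℝ)) (E : Finset ((ℝ × ℝ) × (ℝ × ℝ))) : Prop where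
  injOn : ∀ p ∈ P, ∀ q ∈ P, p.1 = q.1 → p = q
  left_mem : ∀ e ∈ E, e.1 ∈ P
  right_mem : ∀ e ∈ E, e.2 ∈ P
  lt : ∀ e ∈ E, e.1.1 < e.2.1
  avoids : ∀ e ∈ E, ∀ p ∈ P, e.1.1 < p.1 → p.1 < e.2.1 → p.2 ≠ lineAt e.1 e.2 p.1

/-- `ab` and `ac` are edges to the right of `a`, consecutive in slope, and `w` is the leftmost
vertex in the closed wedge between them. -/
structure IsWedge (P : Finset (ℝ × ℝ)) (E : Finset ((ℝ × ℝ) × (ℝ × ℝ))) (a b c w : ℝ × ℝ) :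
    Prop where
  bot_mem : (a, b) ∈ E
  top_mem : (a, c) ∈ E
  slope_lt : slopeOf a b < slopeOf a c
  slope_le : ∀ d, (a, d) ∈ E → slopeOf a b < slopeOf a d → slopeOf a c ≤ slopeOf a d
  mem : w ∈ P
  lt : a.1 < w.1
  le_bot : w.1 ≤ b.1
  le_top : w.1 ≤ c.1
  bot_le : lineAt a b w.1 ≤ w.2
  le_line_top : w.2 ≤ lineAt a c w.1
  leftmost : ∀ p ∈ P, a.1 < p.1 → p.1 < w.1 → lineAt a b p.1 ≤ p.2 → lineAt a c p.1 < p.2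

variable {P : Finset (ℝ × ℝ)} {E : Finset ((ℝ × ℝ) × (ℝ × ℝ))}

lemma IsDrawing.eq_of_slopeOf_eq (h : IsDrawing P E) {a b c : ℝ × ℝ} (hb : (a, b) ∈ E)
    (hc : (a, c) ∈ E) (hs : slopeOf a b = slopeOf a c) : b = c := by
  have hl : ∀ x, lineAt a b x = lineAt a c x := fun x => by simp [lineAt, hs]
  have h1 := lineAt_right (h.lt _ hb)
  have h2 := lineAt_right (h.lt _ hc)
  simp only at h1 h2
  rcases lt_trichotomy b.1 c.1 with hlt | heq | hgt
  · exact absurd (by rw [← hl, h1]) (h.avoids _ hc b (h.right_mem _ hb) (h.lt _ hb) hlt)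
  · exact h.injOn _ (h.right_mem _ hb) _ (h.right_mem _ hc) heq
  · exact absurd (by rw [hl, h2]) (h.avoids _ hb c (h.right_mem _ hc) (h.lt _ hc) hgt)

lemma IsWedge.not_left_lt (hD : IsDrawing P E)
    (hX : ∀ e ∈ E, ∀ f ∈ E, ¬ ProperlyCross e.1 e.2 f.1 f.2) {a b c a' b' c' w : ℝ × ℝ}
    (h : IsWedge P E a b c w) (h' : IsWedge P E a' b' c' w)
    (h1 : lineAt a b w.1 < lineAt a' c' w.1) (h2 : lineAt a' b' w.1 < lineAt a c w.1) :
    ¬ a.1 < a'.1 := by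
  intro hlt
  by_cases hb : lineAt a b a'.1 ≤ a'.2
  · have := h.leftmost a' (hD.left_mem _ h'.bot_mem) hlt h'.lt hb
    exact hX _ h.top_mem _ h'.bot_mem
      (properlyCross_of_above hlt h'.lt h.le_top h'.le_bot this h2)
  · exact hX _ h.bot_mem _ h'.top_mem
      (properlyCross_of_below hlt h'.lt h.le_bot h'.le_top (not_le.1 hb) h1)

lemma IsWedge.unique (hD : IsDrawing P E)
    (hX : ∀ e ∈ E, ∀ f ∈ E, ¬ ProperlyCross e.1 e.2 f.1 f.2) {a b c a' b' c' w : ℝ × ℝ}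
    (h : IsWedge P E a b c w) (h' : IsWedge P E a' b' c' w)
    (h1 : lineAt a b w.1 < lineAt a' c' w.1) (h2 : lineAt a' b' w.1 < lineAt a c w.1) :
    (a, b) = (a', b') := by
  have ha : a = a' := hD.injOn _ (hD.left_mem _ h.bot_mem) _ (hD.left_mem _ h'.bot_mem)
    (le_antisymm (not_lt.1 (h'.not_left_lt hD hX h h2 h1))
      (not_lt.1 (h.not_left_lt hD hX h' h1 h2)))
  subst ha
  have hw : 0 < w.1 - a.1 := sub_pos.2 h.lt
  have s1 : slopeOf a b < slopeOf a c' := by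
    simp only [lineAt] at h1; exact lt_of_mul_lt_mul_right (by linarith) hw.le
  have s2 : slopeOf a b' < slopeOf a c := by
    simp only [lineAt] at h2; exact lt_of_mul_lt_mul_right (by linarith) hw.le
  have : slopeOf a b = slopeOf a b' := by
    rcases lt_trichotomy (slopeOf a b) (slopeOf a b') with hlt | heq | hgt
    · exact absurd s2 (not_lt.2 (h.slope_le _ h'.bot_mem hlt))
    · exact heq
    · exact absurd s1 (not_lt.2 (h'.slope_le _ h.bot_mem hgt))
  rw [hD.eq_of_slopeOf_eq h.bot_mem h'.bot_mem this]

lemma IsDrawing.exists_wedge (hD : IsDrawing P E) {a b d : ℝ × ℝ} (hb : (a, b) ∈ E)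
    (hd : (a, d) ∈ E) (hs : slopeOf a b < slopeOf a d) : ∃ c w, IsWedge P E a b c w := by
  classical
  obtain ⟨e, he, hmin⟩ := Finset.exists_min_image
    (E.filter fun e => e.1 = a ∧ slopeOf a b < slopeOf a e.2) (fun e => slopeOf a e.2)
    ⟨(a, d), by simp [hd, hs]⟩
  obtain ⟨heE, rfl, hes⟩ : e ∈ E ∧ e.1 = a ∧ slopeOf a b < slopeOf a e.2 := by simpa using he
  obtain ⟨a, c⟩ := e
  simp only at *
  have hab := hD.lt _ hb
  have hac := hD.lt _ heE
  have hline : ∀ x, a.1 < x → lineAt a b x < lineAt a c x := by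
    intro x hx
    have := mul_lt_mul_of_pos_right hes (sub_pos.2 hx)
    simp only [lineAt]; linarith
  have hne : (P.filter fun p => a.1 < p.1 ∧ p.1 ≤ b.1 ∧ p.1 ≤ c.1 ∧ lineAt a b p.1 ≤ p.2 ∧
      p.2 ≤ lineAt a c p.1).Nonempty := by
    have h1 := lineAt_right hab
    have h2 := lineAt_right hac
    simp only at h1 h2 hab hac
    rcases le_total b.1 c.1 with h | h
    · exact ⟨b, by simp [hD.right_mem _ hb, hab, h, h1, (h1 ▸ hline _ hab).le]⟩
    · exact ⟨c, by simp [hD.right_mem _ heE, hac, h, h2, (h2 ▸ hline _ hac).le]⟩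
  obtain ⟨w, hw, hwmin⟩ := Finset.exists_min_image _ (fun p : ℝ × ℝ => p.1) hne
  simp only [Finset.mem_filter] at hw hwmin
  obtain ⟨hwP, hw1, hw2, hw3, hw4, hw5⟩ := hw
  refine ⟨c, w, hb, heE, hes, ?_, hwP, hw1, hw2, hw3, hw4, hw5, ?_⟩
  · intro f hf hbf
    exact hmin (a, f) (by simp [hf, hbf])
  · intro p hp h1 h2 h3
    by_contra h4
    exact absurd (hwmin p ⟨hp, h1, by linarith, by linarith, h3, not_lt.1 h4⟩) (not_le.2 h2)

/-- A straight-line drawing without crossings has at most three times as many edges as vertices. -/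
lemma IsDrawing.card_le_of_noncrossing (hD : IsDrawing P E)
    (hX : ∀ e ∈ E, ∀ f ∈ E, ¬ ProperlyCross e.1 e.2 f.1 f.2) : E.card ≤ 3 * P.card := by
  classical
  set R := E.filter fun e => ∃ f ∈ E, f.1 = e.1 ∧ slopeOf e.1 e.2 < slopeOf f.1 f.2
  set T := E.filter fun e => ¬ ∃ f ∈ E, f.1 = e.1 ∧ slopeOf e.1 e.2 < slopeOf f.1 f.2
  have hT : T.card ≤ P.card := by
    refine Finset.card_le_card_of_injOn Prod.fst
      (fun e he => hD.left_mem e (Finset.mem_filter.1 he).1) ?_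
    rintro ⟨a, b⟩ hb ⟨a', c⟩ hc (rfl : a = a')
    simp only [T, Finset.coe_filter, Set.mem_ofPred_eq, not_exists, not_and, not_lt] at hb hc
    rw [hD.eq_of_slopeOf_eq hb.1 hc.1 (le_antisymm (hc.2 _ hb.1 rfl) (hb.2 _ hc.1 rfl))]
  have hR : R.card ≤ (P ×ˢ (Finset.univ : Finset Bool)).card := by
    have hex : ∀ e ∈ R, ∃ q : (ℝ × ℝ) × (ℝ × ℝ), IsWedge P E e.1 e.2 q.1 q.2 := by
      rintro ⟨a, b⟩ he
      obtain ⟨heE, ⟨a', d⟩, hf, rfl, hs⟩ := Finset.mem_filter.1 he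
      obtain ⟨c, w, h⟩ := hD.exists_wedge heE hf hs
      exact ⟨(c, w), h⟩
    choose! q hq using hex
    refine Finset.card_le_card_of_injOn (fun e => ((q e).2, decide ((q e).2 = (q e).1))) ?_ ?_
    · intro e he
      simpa [em] using (hq e he).mem
    · intro e he f hf hef
      simp only [Prod.mk.injEq, decide_eq_decide] at hef
      obtain ⟨hw, hc⟩ := hef
      have h1 := hq e he
      have h2 := hq f hf
      rw [← hw] at h2 hc
      have hlt : ∀ {a b c w : ℝ × ℝ}, IsWedge P E a b c w → w ≠ c → w.2 < lineAt a c w.1 := by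
        intro a b c w h hne
        refine lt_of_le_of_ne h.le_line_top fun heq => ?_
        rcases h.le_top.lt_or_eq with hl | hl
        · exact hD.avoids _ h.top_mem w h.mem h.lt hl heq
        · exact hne (hD.injOn _ h.mem _ (hD.right_mem _ h.top_mem) hl)
      have hgt : ∀ {a b c w : ℝ × ℝ}, IsWedge P E a b c w → w = c → lineAt a b w.1 < w.2 := by
        rintro a b c w h rfl
        have h3 := lineAt_right (hD.lt _ h.top_mem)
        simp only at h3
        have := mul_lt_mul_of_pos_right h.slope_lt (sub_pos.2 h.lt)
        rw [← h3]; simp only [lineAt]; linarith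
      by_cases hcase : (q e).2 = (q e).1
      · exact h1.unique hD hX h2 ((hgt h1 hcase).trans_le h2.le_line_top)
          ((hgt h2 (hc.1 hcase)).trans_le h1.le_line_top)
      · exact h1.unique hD hX h2 (h1.bot_le.trans_lt (hlt h2 fun h => hcase (hc.2 h)))
          (h2.bot_le.trans_lt (hlt h1 hcase))
  have := Finset.card_filter_add_card_filter_not (s := E)
    (fun e => ∃ f ∈ E, f.1 = e.1 ∧ slopeOf e.1 e.2 < slopeOf f.1 f.2)
  simp only [Finset.card_product, Finset.card_univ, Fintype.card_bool] at hR
  change R.card + T.card = _ at this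
  omega

end Drawings

/-- The probability of `S` as a `p`-random subset of `U`. -/
def bernoulliWeight {α : Type*} (p : ℝ) (U S : Finset α) : ℝ :=
  p ^ S.card * (1 - p) ^ (U.card - S.card)

section Bernoulli

variable {α ι : Type*} {p : ℝ} {U A S : Finset α}

lemma bernoulliWeight_nonneg (h0 : 0 ≤ p) (h1 : p ≤ 1) : 0 ≤ bernoulliWeight p U S :=
  mul_nonneg (pow_nonneg h0 _) (pow_nonneg (by linarith) _)

lemma sum_bernoulliWeight (p : ℝ) (U : Finset α) :
    ∑ S ∈ U.powerset, bernoulliWeight p U S = 1 := by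
  simp [bernoulliWeight, Finset.sum_pow_mul_eq_add_pow]

variable [DecidableEq α]

lemma sum_bernoulliWeight_superset (p : ℝ) (hA : A ⊆ U) :
    ∑ S ∈ U.powerset with A ⊆ S, bernoulliWeight p U S = p ^ A.card := by
  have h := Finset.prod_add (fun _ => p) (fun i => if i ∈ A then 0 else 1 - p) U
  have h1 : ∏ i ∈ U, (p + if i ∈ A then 0 else 1 - p) = p ^ A.card := by
    rw [← Finset.prod_sdiff hA, Finset.prod_congr rfl (g := fun _ => (1 : ℝ)),
      Finset.prod_congr (s₁ := A) rfl (g := fun _ => p)]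
    · simp
    · intro i hi; simp [hi]
    · intro i hi; simp [(Finset.mem_sdiff.1 hi).2]
  rw [← h1, h, Finset.sum_filter]
  refine Finset.sum_congr rfl fun S hS => ?_
  rw [Finset.mem_powerset] at hS
  rw [Finset.prod_const, bernoulliWeight]
  split_ifs with hAS
  · rw [Finset.prod_congr (s₁ := U \ S) rfl (g := fun _ => 1 - p), Finset.prod_const,
      Finset.card_sdiff_of_subset hS]
    intro i hi
    have hiA : i ∉ A := fun h => (Finset.mem_sdiff.1 hi).2 (hAS h)
    simp [hiA]
  · obtain ⟨i, hi, hiS⟩ := Finset.not_subset.1 hAS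
    rw [Finset.prod_eq_zero (i := i) (by simp [hA hi, hiS]) (by simp [hi]), mul_zero]

lemma sum_bernoulliWeight_mul_card_filter (p : ℝ) (X : Finset ι) (c : ι → Finset α)
    (hc : ∀ x ∈ X, c x ⊆ U) :
    ∑ S ∈ U.powerset, bernoulliWeight p U S * (X.filter fun x => c x ⊆ S).card
      = ∑ x ∈ X, p ^ (c x).card := by
  simp_rw [Finset.card_filter, Nat.cast_sum, Finset.mul_sum]
  rw [Finset.sum_comm]
  refine Finset.sum_congr rfl fun x hx => ?_
  rw [← sum_bernoulliWeight_superset p (hc x hx), Finset.sum_filter]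
  refine Finset.sum_congr rfl fun S _ => ?_
  split_ifs <;> simp

end Bernoulli

section Crossings

variable {P : Finset (ℝ × ℝ)} {E : Finset ((ℝ × ℝ) × (ℝ × ℝ))}

open Classical in
/-- The ordered pairs of crossing edges. -/
noncomputable def crossings (E : Finset ((ℝ × ℝ) × (ℝ × ℝ))) :
    Finset (((ℝ × ℝ) × (ℝ × ℝ)) × ((ℝ × ℝ) × (ℝ × ℝ))) :=
  (E ×ˢ E).filter fun x => ProperlyCross x.1.1 x.1.2 x.2.1 x.2.2

lemma mem_crossings {x : ((ℝ × ℝ) × (ℝ × ℝ)) × ((ℝ × ℝ) × (ℝ × ℝ))} :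
    x ∈ crossings E ↔ x.1 ∈ E ∧ x.2 ∈ E ∧ ProperlyCross x.1.1 x.1.2 x.2.1 x.2.2 := by
  simp [crossings, and_assoc]

lemma IsDrawing.mono {P' : Finset (ℝ × ℝ)} {E' : Finset ((ℝ × ℝ) × (ℝ × ℝ))} (hD : IsDrawing P E)
    (hP : P' ⊆ P) (hE : E' ⊆ E) (hl : ∀ e ∈ E', e.1 ∈ P') (hr : ∀ e ∈ E', e.2 ∈ P') :
    IsDrawing P' E' where
  injOn p hp q hq := hD.injOn p (hP hp) q (hP hq)
  left_mem := hl
  right_mem := hr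
  lt e he := hD.lt e (hE he)
  avoids e he p hp := hD.avoids e (hE he) p (hP hp)

lemma IsDrawing.card_le_add_crossings (hD : IsDrawing P E) :
    E.card ≤ 3 * P.card + (crossings E).card := by
  classical
  set E' := E \ (crossings E).image Prod.fst
  have h1 : E'.card ≤ 3 * P.card := by
    refine (hD.mono subset_rfl Finset.sdiff_subset (fun e he => hD.left_mem e ?_)
      (fun e he => hD.right_mem e ?_)).card_le_of_noncrossing ?_
    · exact (Finset.mem_sdiff.1 he).1
    · exact (Finset.mem_sdiff.1 he).1
    · intro e he f hf hX
      have he' := Finset.mem_sdiff.1 he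
      exact he'.2 (Finset.mem_image.2 ⟨(e, f),
        mem_crossings.2 ⟨he'.1, (Finset.mem_sdiff.1 hf).1, hX⟩, rfl⟩)
  have h2 : E.card ≤ E'.card + ((crossings E).image Prod.fst).card := by
    have : E.card - ((crossings E).image Prod.fst).card ≤ E'.card := Finset.le_card_sdiff _ _
    omega
  have h3 : ((crossings E).image Prod.fst).card ≤ (crossings E).card := Finset.card_image_le
  omega

lemma ProperlyCross.endpoints_ne {a b c d : ℝ × ℝ} (hab : a.1 < b.1) (hcd : c.1 < d.1)
    (h : ProperlyCross a b c d) : a ≠ c ∧ a ≠ d ∧ b ≠ c ∧ b ≠ d := by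
  have h1 := lineAt_left a b
  have h2 := lineAt_right hab
  have h3 := lineAt_left c d
  have h4 := lineAt_right hcd
  refine ⟨?_, ?_, ?_, ?_⟩ <;> rintro rfl
  · simp [ProperlyCross, h1] at h
  · simp [ProperlyCross, h4] at h
  · simp [ProperlyCross, h2] at h
  · simp [ProperlyCross, h2] at h

/-- The crossing inequality, before optimizing over the sampling probability. -/
lemma IsDrawing.sq_mul_card_le (hD : IsDrawing P E) {p : ℝ} (h0 : 0 ≤ p) (h1 : p ≤ 1) :
    p ^ 2 * E.card ≤ 3 * (p * P.card) + p ^ 4 * (crossings E).card := by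
  classical
  have hV := sum_bernoulliWeight_mul_card_filter (U := P) p P (fun x => {x}) (by simp)
  have hE := sum_bernoulliWeight_mul_card_filter (U := P) p E (fun e => {e.1, e.2}) (by
    intro e he
    simp [Finset.insert_subset_iff, hD.left_mem e he, hD.right_mem e he])
  have hX := sum_bernoulliWeight_mul_card_filter (U := P) p (crossings E)
    (fun x => {x.1.1, x.1.2, x.2.1, x.2.2}) (by
    intro x hx
    obtain ⟨hx1, hx2, -⟩ := mem_crossings.1 hx
    simp [Finset.insert_subset_iff, hD.left_mem _ hx1, hD.right_mem _ hx1, hD.left_mem _ hx2,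
      hD.right_mem _ hx2])
  have eV : ∑ x ∈ P, p ^ ({x} : Finset (ℝ × ℝ)).card = p * P.card := by
    simp [mul_comm]
  have eE : ∑ e ∈ E, p ^ ({e.1, e.2} : Finset (ℝ × ℝ)).card = p ^ 2 * E.card := by
    rw [Finset.sum_congr rfl (g := fun _ => p ^ 2)]
    · simp [mul_comm]
    · intro e he
      rw [Finset.card_pair]
      intro h
      exact absurd (hD.lt e he) (by simp [h])
  have eX : ∑ x ∈ crossings E, p ^ ({x.1.1, x.1.2, x.2.1, x.2.2} : Finset (ℝ × ℝ)).card
      = p ^ 4 * (crossings E).card := by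
    rw [Finset.sum_congr rfl (g := fun _ => p ^ 4)]
    · simp [mul_comm]
    · intro x hx
      obtain ⟨hx1, hx2, hx3⟩ := mem_crossings.1 hx
      have l1 := hD.lt _ hx1
      have l2 := hD.lt _ hx2
      obtain ⟨n1, n2, n3, n4⟩ := hx3.endpoints_ne l1 l2
      have n5 : x.1.1 ≠ x.1.2 := fun h => absurd l1 (by simp [h])
      have n6 : x.2.1 ≠ x.2.2 := fun h => absurd l2 (by simp [h])
      rw [Finset.card_insert_of_notMem (by simp [*]), Finset.card_insert_of_notMem (by simp [*]),
        Finset.card_pair n6]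
  rw [← eV, ← eE, ← eX, ← hV, ← hE, ← hX, Finset.mul_sum, ← Finset.sum_add_distrib]
  refine Finset.sum_le_sum fun S hS => ?_
  rw [Finset.mem_powerset] at hS
  have hw := bernoulliWeight_nonneg (U := P) (S := S) h0 h1
  have key : (E.filter fun e => {e.1, e.2} ⊆ S).card ≤
      3 * (P.filter fun x => {x} ⊆ S).card +
        ((crossings E).filter fun x => {x.1.1, x.1.2, x.2.1, x.2.2} ⊆ S).card := by
    have hDS : IsDrawing S (E.filter fun e => {e.1, e.2} ⊆ S) := by
      refine hD.mono hS (Finset.filter_subset _ _) ?_ ?_ <;> intro e he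
      · exact (Finset.mem_filter.1 he).2 (by simp)
      · exact (Finset.mem_filter.1 he).2 (by simp)
    refine hDS.card_le_add_crossings.trans (add_le_add ?_ ?_)
    · refine Nat.mul_le_mul_left _ (Finset.card_le_card fun x hx => ?_)
      simp [hS hx, hx]
    · refine Finset.card_le_card fun x hx => ?_
      simp only [mem_crossings, Finset.mem_filter, Finset.insert_subset_iff,
        Finset.singleton_subset_iff] at hx ⊢
      tauto
  calc _ ≤ bernoulliWeight p P S * ((3 * (P.filter fun x => {x} ⊆ S).card +
        ((crossings E).filter fun x => {x.1.1, x.1.2, x.2.1, x.2.2} ⊆ S).card : ℕ) : ℝ) :=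
        mul_le_mul_of_nonneg_left (by exact_mod_cast key) hw
    _ = _ := by push_cast; ring

end Crossings

section RichLines

variable {P : Finset (ℝ × ℝ)}

/-- The points of `P` on the line through `a` and `b`. -/
noncomputable def lineSet (P : Finset (ℝ × ℝ)) (a b : ℝ × ℝ) : Finset (ℝ × ℝ) :=
  P.filter fun p => p.2 = lineAt a b p.1

lemma mem_lineSet {a b p : ℝ × ℝ} : p ∈ lineSet P a b ↔ p ∈ P ∧ p.2 = lineAt a b p.1 := by
  simp [lineSet]

lemma left_mem_lineSet {a b : ℝ × ℝ} (ha : a ∈ P) : a ∈ lineSet P a b :=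
  mem_lineSet.2 ⟨ha, (lineAt_left a b).symm⟩

lemma right_mem_lineSet {a b : ℝ × ℝ} (hb : b ∈ P) (h : a.1 ≠ b.1) : b ∈ lineSet P a b :=
  mem_lineSet.2 ⟨hb, (lineAt_right_of_ne h).symm⟩

lemma lineAt_eq_of_mem {a b c d : ℝ × ℝ} (hc : c ∈ lineSet P a b) (hd : d ∈ lineSet P a b)
    (h : c.1 ≠ d.1) : lineAt c d = lineAt a b := by
  have h1 := (mem_lineSet.1 hc).2
  have h2 := (mem_lineSet.1 hd).2
  have hs : slopeOf c d = slopeOf a b := by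
    have hne : d.1 - c.1 ≠ 0 := sub_ne_zero.2 h.symm
    rw [slopeOf, div_eq_iff hne, h1, h2, lineAt_sub]
  funext x
  have := lineAt_sub a b x c.1
  rw [lineAt, hs]
  linarith

lemma lineSet_eq_of_mem {a b c d : ℝ × ℝ} (hc : c ∈ lineSet P a b) (hd : d ∈ lineSet P a b)
    (h : c.1 ≠ d.1) : lineSet P c d = lineSet P a b := by
  simp only [lineSet, lineAt_eq_of_mem hc hd h]

/-- The lines spanned by `P` with at least `k` points of `P`, as subsets of `P`. -/
noncomputable def richLines (P : Finset (ℝ × ℝ)) (k : ℕ) : Finset (Finset (ℝ × ℝ)) :=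
  (P.offDiag.image fun e => lineSet P e.1 e.2).filter fun l => k ≤ l.card

open Classical in
/-- The segments between consecutive points of `P` on the lines with at least `k` points. -/
noncomputable def richEdges (P : Finset (ℝ × ℝ)) (k : ℕ) : Finset ((ℝ × ℝ) × (ℝ × ℝ)) :=
  P.offDiag.filter fun e => e.1.1 < e.2.1 ∧ k ≤ (lineSet P e.1 e.2).card ∧
    ∀ p ∈ lineSet P e.1 e.2, ¬ (e.1.1 < p.1 ∧ p.1 < e.2.1)

lemma mem_richEdges {k : ℕ} {e : (ℝ × ℝ) × (ℝ × ℝ)} : e ∈ richEdges P k ↔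
    (e.1 ∈ P ∧ e.2 ∈ P ∧ e.1 ≠ e.2) ∧ e.1.1 < e.2.1 ∧ k ≤ (lineSet P e.1 e.2).card ∧
    ∀ p ∈ lineSet P e.1 e.2, ¬ (e.1.1 < p.1 ∧ p.1 < e.2.1) := by
  simp [richEdges]

lemma mem_richLines {k : ℕ} {l : Finset (ℝ × ℝ)} : l ∈ richLines P k ↔
    (∃ a ∈ P, ∃ b ∈ P, a ≠ b ∧ lineSet P a b = l) ∧ k ≤ l.card := by
  simp only [richLines, Finset.mem_filter, Finset.mem_image, Finset.mem_offDiag]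
  constructor
  · rintro ⟨⟨e, ⟨ha, hb, hab⟩, h⟩, hk⟩
    exact ⟨⟨e.1, ha, e.2, hb, hab, h⟩, hk⟩
  · rintro ⟨⟨a, ha, b, hb, hab, h⟩, hk⟩
    exact ⟨⟨(a, b), ⟨ha, hb, hab⟩, h⟩, hk⟩

lemma isDrawing_richEdges (hP : ∀ p ∈ P, ∀ q ∈ P, p.1 = q.1 → p = q) (k : ℕ) :
    IsDrawing P (richEdges P k) where
  injOn := hP
  left_mem _ he := (mem_richEdges.1 he).1.1
  right_mem _ he := (mem_richEdges.1 he).1.2.1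
  lt _ he := (mem_richEdges.1 he).2.1
  avoids _ he p hp h1 h2 h3 :=
    (mem_richEdges.1 he).2.2.2 p (mem_lineSet.2 ⟨hp, h3⟩) ⟨h1, h2⟩

lemma card_richLines_mul_le (hP : ∀ p ∈ P, ∀ q ∈ P, p.1 = q.1 → p = q) (k : ℕ) :
    (richLines P k).card * (k - 1) ≤ (richEdges P k).card := by
  classical
  rw [Finset.card_eq_sum_card_fiberwise (s := richEdges P k) (f := fun e => lineSet P e.1 e.2)
    (t := richLines P k)]
  · rw [← smul_eq_mul]
    refine Finset.card_nsmul_le_sum _ _ _ fun l hl => ?_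
    obtain ⟨⟨a, ha, b, hb, hab, rfl⟩, hk⟩ := mem_richLines.1 hl
    obtain ⟨m, hm, hmax⟩ := Finset.exists_max_image (lineSet P a b) (fun p => p.1)
      ⟨a, left_mem_lineSet ha⟩
    have hnext : ∀ p ∈ (lineSet P a b).erase m, ∃ q ∈ lineSet P a b, p.1 < q.1 ∧
        ∀ r ∈ lineSet P a b, ¬ (p.1 < r.1 ∧ r.1 < q.1) := by
      intro p hp
      obtain ⟨hpm, hp⟩ := Finset.mem_erase.1 hp
      have hlt : p.1 < m.1 := lt_of_le_of_ne (hmax p hp)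
        fun h => hpm (hP _ (mem_lineSet.1 hp).1 _ (mem_lineSet.1 hm).1 h)
      obtain ⟨q, hq, hmin⟩ := Finset.exists_min_image ((lineSet P a b).filter fun r => p.1 < r.1)
        (fun r => r.1) ⟨m, by simp [hm, hlt]⟩
      simp only [Finset.mem_filter] at hq hmin
      exact ⟨q, hq.1, hq.2, fun r hr h => absurd (hmin r ⟨hr, h.1⟩) (not_le.2 h.2)⟩
    choose! nx hnx using hnext
    calc k - 1 ≤ (lineSet P a b).card - 1 := Nat.sub_le_sub_right hk 1
      _ = ((lineSet P a b).erase m).card := (Finset.card_erase_of_mem hm).symm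
      _ ≤ _ := ?_
    refine Finset.card_le_card_of_injOn (fun p => (p, nx p)) ?_ ?_
    · intro p hp
      obtain ⟨h1, h2, h3⟩ := hnx p hp
      have hpl := (Finset.mem_erase.1 hp).2
      have hls := lineSet_eq_of_mem hpl h1 h2.ne
      simp only [Finset.coe_filter, Set.mem_ofPred_eq, mem_richEdges, hls]
      exact ⟨⟨⟨(mem_lineSet.1 hpl).1, (mem_lineSet.1 h1).1, fun h => h2.ne (by rw [← h])⟩,
        h2, hk, h3⟩, trivial⟩
    · intro p _ q _ h
      exact (Prod.mk.inj h).1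
  · intro e he
    obtain ⟨⟨h1, h2, h3⟩, -, h4, -⟩ := mem_richEdges.1 he
    exact mem_richLines.2 ⟨⟨_, h1, _, h2, h3, rfl⟩, h4⟩

lemma ProperlyCross.exists_common {a b c d : ℝ × ℝ} (hab : a.1 < b.1) (hcd : c.1 < d.1)
    (h : ProperlyCross a b c d) : slopeOf a b ≠ slopeOf c d ∧ ∃ x, a.1 < x ∧ x < b.1 ∧ c.1 < x ∧
      x < d.1 ∧ lineAt a b x = lineAt c d x := by
  obtain ⟨h1, h2⟩ := h
  have ea := lineAt_left a b
  have eb := lineAt_right hab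
  have ec := lineAt_left c d
  have ed := lineAt_right hcd
  rw [← ec, ← ed] at h1
  rw [← ea, ← eb] at h2
  set α := slopeOf a b - slopeOf c d with hα
  have key : ∀ y z, (lineAt a b y - lineAt c d y) - (lineAt a b z - lineAt c d z)
      = α * (y - z) := by
    intro y z
    linear_combination lineAt_sub a b y z - lineAt_sub c d y z
  have hne : α ≠ 0 := by
    intro h0
    have := key c.1 d.1
    rw [h0, zero_mul, sub_eq_zero] at this
    rw [show lineAt c d c.1 - lineAt a b c.1 = lineAt c d d.1 - lineAt a b d.1 by linarith] at h1
    exact absurd h1 (not_lt.2 (mul_self_nonneg _))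
  refine ⟨sub_ne_zero.1 hne, a.1 - (lineAt a b a.1 - lineAt c d a.1) / α, ?_⟩
  set x := a.1 - (lineAt a b a.1 - lineAt c d a.1) / α with hx
  have hroot : lineAt a b x - lineAt c d x = 0 := by
    have := key x a.1
    have h3 : α * (x - a.1) = - (lineAt a b a.1 - lineAt c d a.1) := by
      rw [hx]; field_simp; ring
    linarith
  have hD : ∀ y, lineAt a b y - lineAt c d y = α * (y - x) := by
    intro y; have := key y x; linarith
  have hpos : 0 < α ^ 2 := by positivity
  have g1 : (c.1 - x) * (d.1 - x) < 0 := by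
    have : α ^ 2 * ((c.1 - x) * (d.1 - x)) < 0 := by
      have e1 := hD c.1
      have e2 := hD d.1
      calc _ = (α * (c.1 - x)) * (α * (d.1 - x)) := by ring
        _ = (lineAt c d c.1 - lineAt a b c.1) * (lineAt c d d.1 - lineAt a b d.1) := by
          rw [← e1, ← e2]; ring
        _ < 0 := h1
    by_contra hc
    exact absurd this (not_lt.2 (mul_nonneg hpos.le (not_lt.1 hc)))
  have g2 : (a.1 - x) * (b.1 - x) < 0 := by
    have : α ^ 2 * ((a.1 - x) * (b.1 - x)) < 0 := by
      have e1 := hD a.1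
      have e2 := hD b.1
      calc _ = (α * (a.1 - x)) * (α * (b.1 - x)) := by ring
        _ < 0 := by rw [← e1, ← e2]; exact h2
    by_contra hc
    exact absurd this (not_lt.2 (mul_nonneg hpos.le (not_lt.1 hc)))
  rw [mul_neg_iff] at g1 g2
  refine ⟨?_, ?_, ?_, ?_, sub_eq_zero.1 hroot⟩
  · rcases g2 with h | h <;> linarith
  · rcases g2 with h | h <;> linarith
  · rcases g1 with h | h <;> linarith
  · rcases g1 with h | h <;> linarith

lemma eq_of_mem_richEdges (hP : ∀ p ∈ P, ∀ q ∈ P, p.1 = q.1 → p = q) {k : ℕ}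
    {e f : (ℝ × ℝ) × (ℝ × ℝ)} (he : e ∈ richEdges P k) (hf : f ∈ richEdges P k)
    (h : lineSet P e.1 e.2 = lineSet P f.1 f.2) {x : ℝ} (h1 : e.1.1 < x) (h2 : x < e.2.1)
    (h3 : f.1.1 < x) (h4 : x < f.2.1) : e = f := by
  obtain ⟨⟨he1, he2, -⟩, hel, -, he3⟩ := mem_richEdges.1 he
  obtain ⟨⟨hf1, hf2, -⟩, hfl, -, hf3⟩ := mem_richEdges.1 hf
  have a1 : e.1 ∈ lineSet P f.1 f.2 := h ▸ left_mem_lineSet he1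
  have a2 : e.2 ∈ lineSet P f.1 f.2 := h ▸ right_mem_lineSet he2 hel.ne
  have b1 : f.1 ∈ lineSet P e.1 e.2 := h.symm ▸ left_mem_lineSet hf1
  have b2 : f.2 ∈ lineSet P e.1 e.2 := h.symm ▸ right_mem_lineSet hf2 hfl.ne
  refine Prod.ext (hP _ he1 _ hf1 ?_) (hP _ he2 _ hf2 ?_)
  · rcases lt_trichotomy e.1.1 f.1.1 with hlt | heq | hgt
    · exact absurd ⟨hlt, by linarith⟩ (he3 _ b1)
    · exact heq
    · exact absurd ⟨hgt, by linarith⟩ (hf3 _ a1)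
  · rcases lt_trichotomy e.2.1 f.2.1 with hlt | heq | hgt
    · exact absurd ⟨by linarith, hlt⟩ (hf3 _ a2)
    · exact heq
    · exact absurd ⟨by linarith, hgt⟩ (he3 _ b2)

lemma card_crossings_richEdges_le (hP : ∀ p ∈ P, ∀ q ∈ P, p.1 = q.1 → p = q) (k : ℕ) :
    (crossings (richEdges P k)).card ≤ (richLines P k).card ^ 2 := by
  rw [sq, ← Finset.card_product]
  have hlines : ∀ e ∈ richEdges P k, lineSet P e.1 e.2 ∈ richLines P k := by
    intro e he
    obtain ⟨⟨h1, h2, h3⟩, -, h4, -⟩ := mem_richEdges.1 he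
    exact mem_richLines.2 ⟨⟨_, h1, _, h2, h3, rfl⟩, h4⟩
  have hfun : ∀ e ∈ richEdges P k, ∀ f ∈ richEdges P k,
      lineSet P e.1 e.2 = lineSet P f.1 f.2 → lineAt e.1 e.2 = lineAt f.1 f.2 := by
    intro e he f hf h
    obtain ⟨⟨he1, he2, -⟩, hel, -, -⟩ := mem_richEdges.1 he
    exact lineAt_eq_of_mem (h ▸ left_mem_lineSet he1) (h ▸ right_mem_lineSet he2 hel.ne) hel.ne
  refine Finset.card_le_card_of_injOn
    (fun x => (lineSet P x.1.1 x.1.2, lineSet P x.2.1 x.2.2)) ?_ ?_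
  · intro x hx
    obtain ⟨h1, h2, -⟩ := mem_crossings.1 hx
    exact Finset.mem_product.2 ⟨hlines _ h1, hlines _ h2⟩
  · rintro ⟨e, f⟩ hx ⟨e', f'⟩ hx' h
    obtain ⟨he, hf, hc⟩ := mem_crossings.1 hx
    obtain ⟨he', hf', hc'⟩ := mem_crossings.1 hx'
    simp only [Prod.mk.injEq] at h he hf hc he' hf' hc'
    obtain ⟨hle, hlf⟩ := h
    obtain ⟨hs, x, x1, x2, x3, x4, x5⟩ :=
      hc.exists_common (mem_richEdges.1 he).2.1 (mem_richEdges.1 hf).2.1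
    obtain ⟨-, y, y1, y2, y3, y4, y5⟩ :=
      hc'.exists_common (mem_richEdges.1 he').2.1 (mem_richEdges.1 hf').2.1
    rw [← hfun e he e' he' hle, ← hfun f hf f' hf' hlf] at y5
    have hxy : x = y := by
      have h1 := lineAt_sub e.1 e.2 x y
      have h2 := lineAt_sub f.1 f.2 x y
      have h3 : (slopeOf e.1 e.2 - slopeOf f.1 f.2) * (x - y) = 0 := by linarith
      rcases mul_eq_zero.1 h3 with h | h
      · exact absurd (sub_eq_zero.1 h) hs
      · exact sub_eq_zero.1 h
    subst hxy
    rw [eq_of_mem_richEdges hP he he' hle x1 x2 y1 y2,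
      eq_of_mem_richEdges hP hf hf' hlf x3 x4 y3 y4]

/-- The Szemerédi–Trotter bound on the number of lines with at least `k` points. -/
lemma card_richLines_mul_cube_le (hP : ∀ p ∈ P, ∀ q ∈ P, p.1 = q.1 → p = q) (s : ℕ) (hs : 1 ≤ s)
    (hsP : s ^ 2 ≤ P.card) :
    ((richLines P (s + 1)).card : ℝ) * (s : ℝ) ^ 3 ≤ 72 * (P.card : ℝ) ^ 2 := by
  have h1 := card_richLines_mul_le hP (s + 1)
  have h2 := card_crossings_richEdges_le hP (s + 1)
  rw [Nat.add_sub_cancel] at h1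
  have h1' : ((richLines P (s + 1)).card : ℝ) * s ≤ (richEdges P (s + 1)).card := by
    exact_mod_cast h1
  have h2' : ((crossings (richEdges P (s + 1))).card : ℝ) ≤ (richLines P (s + 1)).card ^ 2 := by
    exact_mod_cast h2
  have hn : (1 : ℝ) ≤ P.card := by
    have : 1 ≤ s ^ 2 := Nat.one_le_pow _ _ hs
    exact_mod_cast this.trans hsP
  have hs' : (1 : ℝ) ≤ s := by exact_mod_cast hs
  have hsP' : (s : ℝ) ^ 2 ≤ P.card := by exact_mod_cast hsP
  set m : ℝ := ((richLines P (s + 1)).card : ℝ) with hm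
  have hm0 : 0 ≤ m := Nat.cast_nonneg _
  set n : ℝ := (P.card : ℝ)
  by_cases hcase : m * s ≤ 6 * n
  · calc m * (s : ℝ) ^ 3 = (m * s) * (s : ℝ) ^ 2 := by ring
      _ ≤ (6 * n) * n := mul_le_mul hcase hsP' (by positivity) (by positivity)
      _ ≤ 72 * n ^ 2 := by nlinarith
  · have hms : 6 * n < m * s := not_le.1 hcase
    have hpos : 0 < m * s := by linarith
    have hmpos : 0 < m := pos_of_mul_pos_left hpos (by linarith)
    have hp1 : 6 * n / (m * s) ≤ 1 := (div_le_one hpos).2 hms.le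
    have hp0 : 0 < 6 * n / (m * s) := by positivity
    have key := (isDrawing_richEdges hP (s + 1)).sq_mul_card_le hp0.le hp1
    set p := 6 * n / (m * s) with hp
    have hpm : p * (m * s) = 6 * n := div_mul_cancel₀ _ hpos.ne'
    have k1 : p ^ 2 * (m * s) ≤ 3 * (p * n) + p ^ 4 * m ^ 2 :=
      (mul_le_mul_of_nonneg_left h1' (by positivity)).trans
        (key.trans (by gcongr))
    have k2 : p * (3 * n) ≤ p * (p ^ 3 * m ^ 2) := by
      have : p ^ 2 * (m * s) = p * (6 * n) := by rw [← hpm]; ring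
      nlinarith
    have k3 : 3 * n ≤ p ^ 3 * m ^ 2 := le_of_mul_le_mul_left k2 hp0
    have k4 : 3 * n * (m * s) ^ 3 ≤ (6 * n) ^ 3 * m ^ 2 := by
      calc 3 * n * (m * s) ^ 3 ≤ p ^ 3 * m ^ 2 * (m * s) ^ 3 := by gcongr
        _ = (p * (m * s)) ^ 3 * m ^ 2 := by ring
        _ = _ := by rw [hpm]
    have k5 : (3 * n * m ^ 2) * (m * (s : ℝ) ^ 3) ≤ (3 * n * m ^ 2) * (72 * n ^ 2) := by
      calc _ = 3 * n * (m * s) ^ 3 := by ring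
        _ ≤ _ := k4
        _ = _ := by ring
    exact le_of_mul_le_mul_left k5 (by positivity)

end RichLines

/-- Three distinct points on a common line. -/
def CollinearTriple (x y z : ℝ × ℝ) : Prop :=
  x ≠ y ∧ x ≠ z ∧ y ≠ z ∧ Collinear ℝ {x, y, z}

lemma collinear_of_forall_det {a b : ℝ × ℝ} (hab : a ≠ b) {T : Set (ℝ × ℝ)}
    (hT : ∀ c ∈ T, (b.1 - a.1) * (c.2 - a.2) = (c.1 - a.1) * (b.2 - a.2)) : Collinear ℝ T := by
  rw [collinear_iff_exists_forall_eq_smul_vadd]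
  refine ⟨a, b - a, fun c hc => ?_⟩
  have h := hT c hc
  by_cases h1 : b.1 - a.1 = 0
  · have h2 : b.2 - a.2 ≠ 0 := fun h2 =>
      hab (Prod.ext (sub_eq_zero.1 h1).symm (sub_eq_zero.1 h2).symm)
    have h3 : c.1 - a.1 = 0 := by
      rw [h1, zero_mul, eq_comm, mul_eq_zero] at h
      exact h.resolve_right h2
    refine ⟨(c.2 - a.2) / (b.2 - a.2), Prod.ext ?_ ?_⟩
    · simp only [vadd_eq_add, Prod.fst_add, Prod.smul_fst, Prod.fst_sub, h1, smul_eq_mul]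
      linarith
    · simp only [vadd_eq_add, Prod.snd_add, Prod.smul_snd, Prod.snd_sub, smul_eq_mul]
      field_simp
      ring
  · refine ⟨(c.1 - a.1) / (b.1 - a.1), Prod.ext ?_ ?_⟩
    · simp only [vadd_eq_add, Prod.fst_add, Prod.smul_fst, Prod.fst_sub, smul_eq_mul]
      field_simp
      ring
    · simp only [vadd_eq_add, Prod.snd_add, Prod.smul_snd, Prod.snd_sub, smul_eq_mul]
      rw [div_mul_eq_mul_div, ← h]
      field_simp
      ring

lemma collinear_triple_iff_det {a b c : ℝ × ℝ} (hab : a ≠ b) : Collinear ℝ {a, b, c} ↔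
    (b.1 - a.1) * (c.2 - a.2) = (c.1 - a.1) * (b.2 - a.2) := by
  constructor
  · intro h
    rw [collinear_iff_of_mem (p₀ := a) (by simp)] at h
    obtain ⟨v, hv⟩ := h
    obtain ⟨r, hr⟩ := hv b (by simp)
    obtain ⟨s, hs⟩ := hv c (by simp)
    rw [hr, hs]
    simp only [vadd_eq_add, Prod.fst_add, Prod.smul_fst, Prod.snd_add, Prod.smul_snd, smul_eq_mul]
    ring
  · intro h
    refine collinear_of_forall_det hab ?_
    rintro p (rfl | rfl | rfl)
    · ring
    · ring
    · exact h

lemma collinear_triple_iff_lineAt {a b c : ℝ × ℝ} (hab : a.1 ≠ b.1) :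
    Collinear ℝ {a, b, c} ↔ c.2 = lineAt a b c.1 := by
  have hne : b.1 - a.1 ≠ 0 := sub_ne_zero.2 hab.symm
  rw [collinear_triple_iff_det (fun h => hab (by rw [h])), lineAt, slopeOf]
  constructor
  · intro h
    field_simp
    linarith
  · intro h
    rw [h]
    field_simp
    ring

section Count

variable {P : Finset (ℝ × ℝ)}

open Classical in
/-- The number of points of `P` other than `x` and `y` on the line `xy` (zero if `x = y`). -/
noncomputable def tripleCount (P : Finset (ℝ × ℝ)) (x y : ℝ × ℝ) : ℕ :=
  (P.filter fun z => CollinearTriple x y z).card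

lemma tripleCount_le (hP : ∀ p ∈ P, ∀ q ∈ P, p.1 = q.1 → p = q) {x y : ℝ × ℝ} (hx : x ∈ P)
    (hy : y ∈ P) (hxy : x ≠ y) : tripleCount P x y ≤ (lineSet P x y).card - 2 := by
  classical
  have hxy1 : x.1 ≠ y.1 := fun h => hxy (hP _ hx _ hy h)
  have hsub : {x, y} ⊆ lineSet P x y := by
    simp [Finset.insert_subset_iff, left_mem_lineSet hx, right_mem_lineSet hy hxy1]
  rw [tripleCount, ← Finset.card_pair hxy, ← Finset.card_sdiff_of_subset hsub]
  refine Finset.card_le_card fun z hz => ?_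
  obtain ⟨hzP, -, h1, h2, h3⟩ := Finset.mem_filter.1 hz
  simp only [Finset.mem_sdiff, mem_lineSet, Finset.mem_insert, Finset.mem_singleton, not_or]
  exact ⟨⟨hzP, (collinear_triple_iff_lineAt hxy1).1 h3⟩, h1.symm, h2.symm⟩

lemma sum_Icc_eq (s : ℕ) :
    ∑ k ∈ Finset.Icc 1 s, 3 * ((k : ℝ) - 1) * (k - 2) = s * (s - 1) * (s - 2) := by
  induction s with
  | zero => simp
  | succ s ih => rw [Finset.sum_Icc_succ_top (by omega), ih]; push_cast; ring

lemma card_richLines_mul_le' (hP : ∀ p ∈ P, ∀ q ∈ P, p.1 = q.1 → p = q) {ℓ k : ℕ} (hk : 1 ≤ k)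
    (hkl : k ≤ ℓ) (hn : ℓ ^ 2 ≤ P.card) :
    ((richLines P k).card : ℝ) * (3 * ((k : ℝ) - 1) * (k - 2))
      ≤ 216 * (P.card : ℝ) ^ 2 * ((k : ℝ) - 1)⁻¹ := by
  obtain ⟨s, rfl⟩ := Nat.exists_eq_add_of_le' hk
  rcases Nat.eq_zero_or_pos s with rfl | hs
  · simp
  · have h := card_richLines_mul_cube_le hP s hs
      ((Nat.pow_le_pow_left (by omega) 2).trans hn)
    have hs0 : (0 : ℝ) < s := by exact_mod_cast hs
    push_cast
    rw [show (s : ℝ) + 1 - 1 = s by ring, ← div_eq_mul_inv, le_div_iff₀ hs0]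
    have h2 : ((richLines P (s + 1)).card : ℝ) * (3 * (s : ℝ) * (s + 1 - 2)) * s
        ≤ 3 * ((richLines P (s + 1)).card * (s : ℝ) ^ 3) := by
      have : (0 : ℝ) ≤ (richLines P (s + 1)).card := Nat.cast_nonneg _
      nlinarith [mul_nonneg this (sq_nonneg (s : ℝ))]
    linarith

lemma sum_Icc_inv_eq_harmonic (t : ℕ) :
    ∑ k ∈ Finset.Icc 1 (t + 1), ((k : ℝ) - 1)⁻¹ = (harmonic t : ℝ) := by
  induction t with
  | zero => simp
  | succ t ih =>
    rw [Finset.sum_Icc_succ_top (by omega), ih, harmonic_succ]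
    push_cast
    ring

lemma sum_Icc_inv_le (ℓ : ℕ) : ∑ k ∈ Finset.Icc 1 ℓ, ((k : ℝ) - 1)⁻¹ ≤ 1 + Real.log ℓ := by
  cases ℓ with
  | zero => simp
  | succ t =>
    rw [sum_Icc_inv_eq_harmonic]
    refine le_trans ?_ (harmonic_le_one_add_log (t + 1))
    rw [harmonic_succ, Rat.cast_add]
    exact le_add_of_nonneg_right (by positivity)

lemma sum_tripleCount_le_of_injOn (hP : ∀ p ∈ P, ∀ q ∈ P, p.1 = q.1 → p = q) {ℓ : ℕ}
    (hℓ : ∀ a b, a ≠ b → (lineSet P a b).card ≤ ℓ) (hn : ℓ ^ 2 ≤ P.card) :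
    ∑ x ∈ P, ∑ y ∈ P, (tripleCount P x y : ℝ) ≤ 216 * (P.card : ℝ) ^ 2 * (1 + Real.log ℓ) := by
  classical
  have hstep : ∑ x ∈ P, ∑ y ∈ P, (tripleCount P x y : ℝ)
      = ∑ e ∈ P.offDiag, (tripleCount P e.1 e.2 : ℝ) := by
    rw [← Finset.sum_product', ← Finset.product_eq_sprod]
    symm
    refine Finset.sum_subset (fun e he => ?_) (fun e he he' => ?_)
    · obtain ⟨h1, h2, -⟩ := Finset.mem_offDiag.1 he
      exact Finset.mem_product.2 ⟨h1, h2⟩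
    · have : e.1 = e.2 := by
        by_contra hne
        obtain ⟨h1, h2⟩ := Finset.mem_product.1 he
        exact he' (Finset.mem_offDiag.2 ⟨h1, h2, hne⟩)
      simp [tripleCount, CollinearTriple, this]
  have hmaps : ∀ e ∈ P.offDiag, lineSet P e.1 e.2 ∈ richLines P 1 := by
    intro e he
    obtain ⟨h1, h2, h3⟩ := Finset.mem_offDiag.1 he
    exact mem_richLines.2 ⟨⟨_, h1, _, h2, h3, rfl⟩,
      Finset.card_pos.2 ⟨e.1, left_mem_lineSet h1⟩⟩
  rw [hstep, ← Finset.sum_fiberwise_of_maps_to hmaps]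
  calc ∑ l ∈ richLines P 1, ∑ e ∈ P.offDiag with lineSet P e.1 e.2 = l, (tripleCount P e.1 e.2 : ℝ)
      ≤ ∑ l ∈ richLines P 1, (l.card : ℝ) * (l.card - 1) * (l.card - 2) := by
        refine Finset.sum_le_sum fun l hl => ?_
        obtain ⟨⟨a, ha, b, hb, hab, hlab⟩, hl1⟩ := mem_richLines.1 hl
        have hl2 : 2 ≤ l.card := by
          rw [← Finset.card_pair hab, ← hlab]
          refine Finset.card_le_card ?_
          simp [Finset.insert_subset_iff, left_mem_lineSet ha,
            right_mem_lineSet hb fun h => hab (hP _ ha _ hb h)]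
        have hcard : ((P.offDiag.filter fun e => lineSet P e.1 e.2 = l).card : ℝ)
            ≤ l.card * (l.card - 1) := by
          have : (P.offDiag.filter fun e => lineSet P e.1 e.2 = l).card ≤ l.offDiag.card := by
            refine Finset.card_le_card fun e he => ?_
            obtain ⟨heP, rfl⟩ := Finset.mem_filter.1 he
            obtain ⟨h1, h2, h3⟩ := Finset.mem_offDiag.1 heP
            exact Finset.mem_offDiag.2 ⟨left_mem_lineSet h1,
              right_mem_lineSet h2 fun h => h3 (hP _ h1 _ h2 h), h3⟩
          rw [Finset.offDiag_card, ← Nat.mul_sub_one] at this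
          have h' : ((l.card - 1 : ℕ) : ℝ) = l.card - 1 := by
            rw [Nat.cast_sub hl1]; simp
          rw [← h']
          exact_mod_cast this
        calc _ ≤ (P.offDiag.filter fun e => lineSet P e.1 e.2 = l).card • ((l.card : ℝ) - 2) := by
              refine Finset.sum_le_card_nsmul _ _ _ fun e he => ?_
              obtain ⟨heP, rfl⟩ := Finset.mem_filter.1 he
              obtain ⟨h1, h2, h3⟩ := Finset.mem_offDiag.1 heP
              have := tripleCount_le hP h1 h2 h3
              have h' : (((lineSet P e.1 e.2).card - 2 : ℕ) : ℝ)
                  = (lineSet P e.1 e.2).card - 2 := by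
                rw [Nat.cast_sub hl2]; simp
              rw [← h']
              exact_mod_cast this
          _ ≤ _ := by
              rw [nsmul_eq_mul]
              refine mul_le_mul_of_nonneg_right hcard ?_
              have : (2 : ℝ) ≤ l.card := by exact_mod_cast hl2
              linarith
    _ = ∑ l ∈ richLines P 1, ∑ k ∈ Finset.Icc 1 ℓ,
          if k ≤ l.card then 3 * ((k : ℝ) - 1) * (k - 2) else 0 := by
        refine Finset.sum_congr rfl fun l hl => ?_
        obtain ⟨⟨a, ha, b, hb, hab, rfl⟩, -⟩ := mem_richLines.1 hl
        rw [← sum_Icc_eq, ← Finset.sum_filter]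
        refine Finset.sum_congr ?_ fun _ _ => rfl
        ext k
        have := hℓ a b hab
        simp only [Finset.mem_Icc, Finset.mem_filter]
        omega
    _ = ∑ k ∈ Finset.Icc 1 ℓ, ((richLines P k).card : ℝ) * (3 * ((k : ℝ) - 1) * (k - 2)) := by
        rw [Finset.sum_comm]
        refine Finset.sum_congr rfl fun k hk => ?_
        rw [← Finset.sum_filter, Finset.sum_const, nsmul_eq_mul]
        congr 3
        ext l
        have := (Finset.mem_Icc.1 hk).1
        simp only [Finset.mem_filter, mem_richLines]
        exact ⟨fun h => ⟨h.1.1, h.2⟩, fun h => ⟨⟨h.1, this.trans h.2⟩, h.2⟩⟩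
    _ ≤ ∑ k ∈ Finset.Icc 1 ℓ, 216 * (P.card : ℝ) ^ 2 * ((k : ℝ) - 1)⁻¹ := by
        refine Finset.sum_le_sum fun k hk => ?_
        obtain ⟨h1, h2⟩ := Finset.mem_Icc.1 hk
        exact card_richLines_mul_le' hP h1 h2 hn
    _ ≤ _ := by
        rw [← Finset.mul_sum]
        exact mul_le_mul_of_nonneg_left (sum_Icc_inv_le ℓ) (by positivity)

/-- A shear of the plane. -/
def shear (t : ℝ) (p : ℝ × ℝ) : ℝ × ℝ := (p.1 + t * p.2, p.2)

lemma shear_injective (t : ℝ) : Function.Injective (shear t) := by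
  intro p q h
  simp only [shear, Prod.mk.injEq] at h
  obtain ⟨h1, h2⟩ := h
  rw [h2] at h1
  exact Prod.ext (by linarith) h2

lemma exists_shear_injOn (P : Finset (ℝ × ℝ)) :
    ∃ t : ℝ, ∀ p ∈ P, ∀ q ∈ P, (shear t p).1 = (shear t q).1 → p = q := by
  classical
  obtain ⟨t, ht⟩ := Infinite.exists_notMem_finset
    ((P ×ˢ P).image fun e => -(e.1.1 - e.2.1) / (e.1.2 - e.2.2))
  refine ⟨t, fun p hp q hq h => ?_⟩
  simp only [shear] at h
  by_cases h2 : p.2 - q.2 = 0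
  · have h3 : p.2 = q.2 := sub_eq_zero.1 h2
    exact Prod.ext (by rw [h3] at h; linarith) h3
  · refine absurd (Finset.mem_image.2 ⟨(p, q), Finset.mem_product.2 ⟨hp, hq⟩, ?_⟩) ht
    rw [div_eq_iff h2]
    linarith

lemma collinearTriple_shear {t : ℝ} {x y z : ℝ × ℝ} :
    CollinearTriple (shear t x) (shear t y) (shear t z) ↔ CollinearTriple x y z := by
  have hi : ∀ a b, shear t a ≠ shear t b ↔ a ≠ b := fun a b => (shear_injective t).ne_iff
  simp only [CollinearTriple, hi]
  refine and_congr_right fun hxy => and_congr_right fun _ => and_congr_right fun _ => ?_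
  rw [collinear_triple_iff_det hxy, collinear_triple_iff_det ((hi _ _).2 hxy)]
  simp only [shear]
  constructor <;> intro h <;> linear_combination h

lemma collinear_shear_preimage (t : ℝ) (a b : ℝ × ℝ) :
    Collinear ℝ {p | (shear t p).2 = lineAt a b (shear t p).1} := by
  obtain ⟨c, s, hcs⟩ : ∃ c s : ℝ, ∀ x, lineAt a b x = c + s * x :=
    ⟨a.2 - slopeOf a b * a.1, slopeOf a b, fun x => by simp only [lineAt]; ring⟩
  refine collinear_of_forall_det (a := (-(t * c), c)) (b := (1 - t * (c + s), c + s)) ?_ ?_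
  · intro h
    obtain ⟨h1, h2⟩ := Prod.mk.inj h
    have : s = 0 := by linarith
    rw [this] at h1
    linarith
  · intro p hp
    simp only [shear, hcs, Set.mem_ofPred_eq] at hp
    linear_combination hp

/-- A set of `n` points with at most `ℓ ≤ √n` collinear spans `O(n² log ℓ)` collinear triples. -/
theorem sum_tripleCount_le {ℓ : ℕ} (hP : AtMostCollinear P ℓ) (hn : ℓ ^ 2 ≤ P.card) :
    ∑ x ∈ P, ∑ y ∈ P, (tripleCount P x y : ℝ) ≤ 216 * (P.card : ℝ) ^ 2 * (1 + Real.log ℓ) := by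
  classical
  obtain ⟨t, ht⟩ := exists_shear_injOn P
  have hinj := shear_injective t
  have hcard : (P.image (shear t)).card = P.card := Finset.card_image_of_injective _ hinj
  have hcount : ∀ x y, tripleCount (P.image (shear t)) (shear t x) (shear t y)
      = tripleCount P x y := by
    intro x y
    rw [tripleCount, tripleCount, Finset.filter_image, Finset.card_image_of_injective _ hinj]
    simp only [collinearTriple_shear]
  have key := sum_tripleCount_le_of_injOn (P := P.image (shear t)) (ℓ := ℓ) ?_ ?_ ?_
  · rw [hcard, Finset.sum_image hinj.injOn] at key
    simpa only [Finset.sum_image hinj.injOn, hcount] using key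
  · simp only [Finset.mem_image]
    rintro _ ⟨p, hp, rfl⟩ _ ⟨q, hq, rfl⟩ h
    rw [ht p hp q hq h]
  · intro a b _
    rw [lineSet, Finset.filter_image, Finset.card_image_of_injective _ hinj]
    refine hP _ (Finset.filter_subset _ _) ((collinear_shear_preimage t a b).subset ?_)
    intro p hp
    exact (Finset.mem_filter.1 hp).2
  · rwa [hcard]

end Count

section Harris

variable {V : Type*}

lemma sum_prod_powerset_pos {a : V → ℝ} (ha : ∀ x, 0 ≤ a x) (A : Finset V) :
    0 < ∑ J ∈ A.powerset, ∏ x ∈ J, a x := by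
  refine Finset.sum_pos' (fun J _ => Finset.prod_nonneg fun x _ => ha x)
    ⟨∅, by simp, by simp⟩

variable [DecidableEq V]

/-- Harris' inequality for two decreasing events under a product weight. -/
lemma sum_filter_mul_sum_filter_le [Fintype V] {a : V → ℝ} (ha : ∀ x, 0 ≤ a x) (A : Finset V)
    {p q : Finset V → Prop} [DecidablePred p] [DecidablePred q]
    (hp : ∀ s t, s ⊆ t → p t → p s) (hq : ∀ s t, s ⊆ t → q t → q s) :
    (∑ J ∈ A.powerset with p J, ∏ x ∈ J, a x) * (∑ J ∈ A.powerset with q J, ∏ x ∈ J, a x)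
      ≤ (∑ J ∈ A.powerset, ∏ x ∈ J, a x) * ∑ J ∈ A.powerset with p J ∧ q J, ∏ x ∈ J, a x := by
  set m : Finset V → ℝ := fun J => if J ⊆ A then ∏ x ∈ J, a x else 0 with hm
  have hm0 : 0 ≤ m := fun J => by
    simp only [hm, Pi.zero_apply]
    split_ifs
    · exact Finset.prod_nonneg fun x _ => ha x
    · rfl
  have key := fkg (fun J => if p J then (0 : ℝ) else 1) (fun J => if q J then (0 : ℝ) else 1) m hm0
    (fun J => by dsimp; split_ifs <;> norm_num) (fun J => by dsimp; split_ifs <;> norm_num)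
    (fun s t hst => by
      dsimp
      split_ifs with h1 h2 h2
      · rfl
      · norm_num
      · exact absurd (hp s t hst h2) h1
      · rfl)
    (fun s t hst => by
      dsimp
      split_ifs with h1 h2 h2
      · rfl
      · norm_num
      · exact absurd (hq s t hst h2) h1
      · rfl)
    (fun s t => by
      by_cases h1 : s ⊆ A
      · by_cases h2 : t ⊆ A
        · have h3 : s ⊓ t ⊆ A := Finset.inter_subset_left.trans h1
          have h4 : s ⊔ t ⊆ A := Finset.union_subset h1 h2
          simp only [hm, h1, h2, h3, h4, if_true]
          rw [mul_comm (∏ x ∈ s ⊓ t, a x)]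
          exact (Finset.prod_union_inter (f := a) (s₁ := s) (s₂ := t)).ge
        · rw [show m t = 0 from if_neg h2, mul_zero]
          exact mul_nonneg (hm0 _) (hm0 _)
      · rw [show m s = 0 from if_neg h1, zero_mul]
        exact mul_nonneg (hm0 _) (hm0 _))
  have hsum : ∀ r : Finset V → Prop, ∀ [DecidablePred r],
      ∑ J ∈ A.powerset with r J, ∏ x ∈ J, a x = ∑ J, m J * if r J then 1 else 0 := by
    intro r _
    have h : (A.powerset.filter r) = Finset.univ.filter fun J => J ⊆ A ∧ r J := by
      ext J; simp
    rw [h, Finset.sum_filter]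
    refine Finset.sum_congr rfl fun J _ => ?_
    by_cases h1 : J ⊆ A <;> by_cases h2 : r J <;> simp [hm, h1, h2]
  have hS : ∑ J ∈ A.powerset, ∏ x ∈ J, a x = ∑ J, m J := by
    simpa using hsum fun _ => True
  have e1 : ∀ r : Finset V → Prop, ∀ [DecidablePred r],
      ∑ J, m J * (if r J then (0 : ℝ) else 1)
        = ∑ J, m J - ∑ J, m J * (if r J then (1 : ℝ) else 0) := by
    intro r _
    rw [← Finset.sum_sub_distrib]
    refine Finset.sum_congr rfl fun J _ => ?_
    split_ifs <;> ring
  have e2 : ∑ J, m J * ((if p J then (0 : ℝ) else 1) * if q J then (0 : ℝ) else 1)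
      = ∑ J, m J - (∑ J, m J * if p J then (1 : ℝ) else 0)
        - (∑ J, m J * if q J then (1 : ℝ) else 0)
        + ∑ J, m J * if p J ∧ q J then (1 : ℝ) else 0 := by
    rw [← Finset.sum_sub_distrib, ← Finset.sum_sub_distrib, ← Finset.sum_add_distrib]
    refine Finset.sum_congr rfl fun J _ => ?_
    by_cases h1 : p J <;> by_cases h2 : q J <;> simp [h1, h2]
  rw [hsum, hsum, hsum, hS]
  rw [e1, e1, e2] at key
  linarith

/-- Avoiding a family of pairs under a product weight with factors in `[0, 1]`. -/
lemma sum_powerset_mul_exp_le [Fintype V] {a : V → ℝ} (ha : ∀ x, 0 ≤ a x) (ha1 : ∀ x, a x ≤ 1)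
    (A : Finset V) (E : Finset (V × V)) :
    (∑ J ∈ A.powerset, ∏ x ∈ J, a x) * Real.exp (-2 *
        ((∑ e ∈ E, ∑ J ∈ A.powerset with e.1 ∈ J ∧ e.2 ∈ J, ∏ x ∈ J, a x)
          / ∑ J ∈ A.powerset, ∏ x ∈ J, a x))
      ≤ ∑ J ∈ A.powerset with ∀ e ∈ E, ¬(e.1 ∈ J ∧ e.2 ∈ J), ∏ x ∈ J, a x := by
  have hS := sum_prod_powerset_pos ha A
  set S := ∑ J ∈ A.powerset, ∏ x ∈ J, a x with hSdef
  have hhalf : ∀ e : V × V,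
      ∑ J ∈ A.powerset with e.1 ∈ J ∧ e.2 ∈ J, ∏ x ∈ J, a x ≤ S / 2 := by
    intro e
    by_cases he : e.1 ∈ A
    · have h1 : ∑ J ∈ A.powerset with e.1 ∈ J ∧ e.2 ∈ J, ∏ x ∈ J, a x
          ≤ ∑ J ∈ A.powerset with e.1 ∈ J, ∏ x ∈ J, a x :=
        Finset.sum_le_sum_of_subset_of_nonneg
          (Finset.monotone_filter_right _ fun J _ h => h.1)
          fun J _ _ => Finset.prod_nonneg fun x _ => ha x
      have hn : e.1 ∉ A.erase e.1 := Finset.notMem_erase _ _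
      have h2 := Finset.sum_powerset_insert hn fun J => ∏ x ∈ J, a x
      have h3 := Finset.sum_powerset_insert hn fun J => if e.1 ∈ J then ∏ x ∈ J, a x else 0
      rw [Finset.insert_erase he] at h2 h3
      rw [Finset.sum_filter (fun J => e.1 ∈ J)] at h1
      have h4 : ∑ J ∈ (A.erase e.1).powerset, (if e.1 ∈ J then ∏ x ∈ J, a x else 0) = 0 := by
        refine Finset.sum_eq_zero fun J hJ => if_neg fun h => hn (Finset.mem_powerset.1 hJ h)
      have h5 : ∑ J ∈ (A.erase e.1).powerset, (if e.1 ∈ insert e.1 J then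
          ∏ x ∈ insert e.1 J, a x else 0)
          = ∑ J ∈ (A.erase e.1).powerset, ∏ x ∈ insert e.1 J, a x := by
        simp
      have h6 : ∑ J ∈ (A.erase e.1).powerset, ∏ x ∈ insert e.1 J, a x
          ≤ ∑ J ∈ (A.erase e.1).powerset, ∏ x ∈ J, a x := by
        refine Finset.sum_le_sum fun J hJ => ?_
        rw [Finset.prod_insert fun h => hn (Finset.mem_powerset.1 hJ h)]
        exact mul_le_of_le_one_left (Finset.prod_nonneg fun x _ => ha x) (ha1 _)
      linarith
    · rw [Finset.filter_false_of_mem, Finset.sum_empty]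
      · positivity
      · exact fun J hJ h => he (Finset.mem_powerset.1 hJ h.1)
  induction E using Finset.induction_on with
  | empty => simp [hSdef]
  | insert e E he ih =>
    set s := ∑ J ∈ A.powerset with e.1 ∈ J ∧ e.2 ∈ J, ∏ x ∈ J, a x with hs
    have hs0 : 0 ≤ s := Finset.sum_nonneg fun J _ => Finset.prod_nonneg fun x _ => ha x
    have hq : Real.exp (-2 * (s / S)) ≤ 1 - s / S := by
      have hq1 : s / S ≤ 1 / 2 := by
        rw [div_le_iff₀ hS]; linarith [hhalf e]
      have hq0 : 0 ≤ s / S := by positivity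
      have h1 := Real.add_one_le_exp (2 * (s / S))
      rw [neg_mul, Real.exp_neg, inv_le_comm₀ (Real.exp_pos _) (by linarith)]
      refine le_trans ?_ h1
      rw [inv_le_iff_one_le_mul₀ (by linarith)]
      nlinarith
    have hcompl : ∑ J ∈ A.powerset with ¬(e.1 ∈ J ∧ e.2 ∈ J), ∏ x ∈ J, a x = S - s := by
      rw [hs, hSdef, ← Finset.sum_filter_add_sum_filter_not A.powerset
        (fun J => e.1 ∈ J ∧ e.2 ∈ J)]
      ring
    have hH := sum_filter_mul_sum_filter_le ha A
      (p := fun J => ∀ e ∈ E, ¬(e.1 ∈ J ∧ e.2 ∈ J)) (q := fun J => ¬(e.1 ∈ J ∧ e.2 ∈ J))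
      (fun s t hst h e he h' => h e he ⟨hst h'.1, hst h'.2⟩)
      (fun s t hst h h' => h ⟨hst h'.1, hst h'.2⟩)
    rw [hcompl] at hH
    have hset : (A.powerset.filter fun J => ∀ e' ∈ insert e E, ¬(e'.1 ∈ J ∧ e'.2 ∈ J))
        = A.powerset.filter fun J => (∀ e ∈ E, ¬(e.1 ∈ J ∧ e.2 ∈ J)) ∧ ¬(e.1 ∈ J ∧ e.2 ∈ J) := by
      ext J
      simp only [Finset.mem_filter, Finset.forall_mem_insert, and_comm]
    rw [Finset.sum_insert he, ← hs, hset, add_div, mul_add, add_comm, Real.exp_add, ← mul_assoc]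
    have h1 : S * Real.exp (-2 * ((∑ e ∈ E, ∑ J ∈ A.powerset with e.1 ∈ J ∧ e.2 ∈ J,
        ∏ x ∈ J, a x) / S)) * (S - s) ≤ S * ∑ J ∈ A.powerset with
          (∀ e ∈ E, ¬(e.1 ∈ J ∧ e.2 ∈ J)) ∧ ¬(e.1 ∈ J ∧ e.2 ∈ J), ∏ x ∈ J, a x :=
      (mul_le_mul_of_nonneg_right ih (by linarith [hhalf e])).trans hH
    have h2 : S * (1 - s / S) = S - s := by field_simp
    refine (mul_le_mul_of_nonneg_left hq (by positivity)).trans ?_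
    rw [← h2] at h1
    refine le_of_mul_le_mul_left ?_ hS
    linarith

end Harris

/-- A 3-uniform hypergraph, given as a symmetric relation on distinct vertices. -/
structure IsTripleSystem {V : Type*} (T : V → V → V → Prop) : Prop where
  swap : ∀ {x y z}, T x y z → T y x z
  rotate : ∀ {x y z}, T x y z → T y z x
  ne : ∀ {x y z}, T x y z → x ≠ y

/-- Independent sets of a hypergraph. -/
abbrev IsIndep {V : Type*} (T : V → V → V → Prop) (I : Finset V) : Prop :=
  ∀ x ∈ I, ∀ y ∈ I, ∀ z ∈ I, ¬T x y z

section TripleSystem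

variable {V : Type*} [Fintype V] [DecidableEq V] (T : V → V → V → Prop)
  [∀ x y z, Decidable (T x y z)]

/-- The number of edges through a pair. -/
noncomputable def codegree (x y : V) : ℝ := ((Finset.univ.filter fun z => T x y z).card : ℝ)

/-- The total codegree of `v` with the members of `I`. -/
noncomputable def codegreeSum (v : V) (I : Finset V) : ℝ := ∑ x ∈ I, codegree T v x

/-- The total codegree of the ordered pairs in `I`. -/
noncomputable def energy (I : Finset V) : ℝ := ∑ x ∈ I, codegreeSum T x I

/-- The ordered pairs in `I` forming an edge with `v`. -/
def linkPairs (v : V) (I : Finset V) : Finset (V × V) := (I ×ˢ I).filter fun e => T v e.1 e.2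

/-- The weight of the set `I`, penalising its energy. -/
noncomputable def energyWeight (β : ℝ) (I : Finset V) : ℝ := Real.exp (-(β * energy T I))

variable {T}

section Basic

omit [DecidableEq V]

lemma codegree_nonneg (x y : V) : 0 ≤ codegree T x y := Nat.cast_nonneg _

lemma codegree_comm (hT : IsTripleSystem T) (x y : V) : codegree T x y = codegree T y x := by
  unfold codegree
  congr 2
  ext z
  simp only [Finset.mem_filter, Finset.mem_univ, true_and]
  exact ⟨hT.swap, hT.swap⟩

lemma codegree_self (hT : IsTripleSystem T) (x : V) : codegree T x x = 0 := by
  unfold codegree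
  rw [Finset.filter_false_of_mem, Finset.card_empty, Nat.cast_zero]
  exact fun z _ h => hT.ne h rfl

lemma codegreeSum_nonneg (v : V) (I : Finset V) : 0 ≤ codegreeSum T v I :=
  Finset.sum_nonneg fun _ _ => codegree_nonneg _ _

lemma codegreeSum_mono (v : V) {I J : Finset V} (h : I ⊆ J) :
    codegreeSum T v I ≤ codegreeSum T v J :=
  Finset.sum_le_sum_of_subset_of_nonneg h fun _ _ _ => codegree_nonneg _ _

lemma energy_nonneg (I : Finset V) : 0 ≤ energy T I :=
  Finset.sum_nonneg fun _ _ => codegreeSum_nonneg _ _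

lemma energyWeight_pos (β : ℝ) (I : Finset V) : 0 < energyWeight T β I := Real.exp_pos _

end Basic

lemma energy_union (hT : IsTripleSystem T) {I J : Finset V} (h : Disjoint I J) :
    energy T (I ∪ J) = energy T I + 2 * ∑ x ∈ J, codegreeSum T x I + energy T J := by
  have h1 : ∑ x ∈ I, codegreeSum T x J = ∑ x ∈ J, codegreeSum T x I := by
    unfold codegreeSum
    rw [Finset.sum_comm]
    exact Finset.sum_congr rfl fun x _ => Finset.sum_congr rfl fun y _ => codegree_comm hT _ _
  have h2 : ∀ x, codegreeSum T x (I ∪ J) = codegreeSum T x I + codegreeSum T x J := fun x =>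
    Finset.sum_union h
  unfold energy
  rw [Finset.sum_union h]
  simp only [h2, Finset.sum_add_distrib, h1]
  ring

lemma energy_insert (hT : IsTripleSystem T) {v : V} {I : Finset V} (h : v ∉ I) :
    energy T (insert v I) = energy T I + 2 * codegreeSum T v I := by
  rw [Finset.insert_eq, Finset.union_comm, energy_union hT (by simpa using h)]
  simp [energy, codegreeSum, codegree_self hT]

omit [Fintype V] [∀ x y z, Decidable (T x y z)] in
lemma isIndep_insert_iff (hT : IsTripleSystem T) (v : V) (I : Finset V) :
    IsIndep T (insert v I) ↔ IsIndep T I ∧ ∀ x ∈ I, ∀ y ∈ I, ¬T v x y := by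
  constructor
  · intro h
    have hs := Finset.subset_insert v I
    exact ⟨fun x hx y hy z hz => h x (hs hx) y (hs hy) z (hs hz),
      fun x hx y hy => h v (Finset.mem_insert_self _ _) x (hs hx) y (hs hy)⟩
  · rintro ⟨h1, h2⟩ x hx y hy z hz hxyz
    have hxy := hT.ne hxyz
    have hyz := hT.ne (hT.rotate hxyz)
    have hzx := hT.ne (hT.rotate (hT.rotate hxyz))
    rcases Finset.mem_insert.1 hx with rfl | hx
    · exact h2 y (Finset.mem_of_mem_insert_of_ne hy hxy.symm) z
        (Finset.mem_of_mem_insert_of_ne hz hzx) hxyz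
    rcases Finset.mem_insert.1 hy with rfl | hy
    · exact h2 z (Finset.mem_of_mem_insert_of_ne hz hyz.symm) x
        (Finset.mem_of_mem_insert_of_ne hx hxy) (hT.rotate hxyz)
    rcases Finset.mem_insert.1 hz with rfl | hz
    · exact h2 x (Finset.mem_of_mem_insert_of_ne hx hzx.symm) y
        (Finset.mem_of_mem_insert_of_ne hy hyz) (hT.rotate (hT.rotate hxyz))
    · exact h1 x hx y hy z hz hxyz

/-- If no edge inside `Q` has two vertices in `L`, then independent subsets of `Q` are unions of an
independent subset of `Q \ L` and an arbitrary set of compatible vertices of `L`. -/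
lemma sum_isIndep_eq_sum_sum (hT : IsTripleSystem T) {Q L : Finset V} (hLQ : L ⊆ Q)
    (hL : ∀ a ∈ L, ∀ b ∈ L, ∀ c ∈ Q, ¬T a b c) (F : Finset V → ℝ) :
    ∑ I ∈ Q.powerset with IsIndep T I, F I
      = ∑ I ∈ (Q \ L).powerset with IsIndep T I,
          ∑ J ∈ (L.filter fun x => IsIndep T (insert x I)).powerset, F (I ∪ J) := by
  rw [Finset.sum_sigma']
  refine Finset.sum_nbij' (fun I => ⟨I \ L, I ∩ L⟩) (fun s => s.1 ∪ s.2) ?_ ?_ ?_ ?_ ?_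
  · intro I hI
    simp only [Finset.mem_filter, Finset.mem_powerset] at hI
    obtain ⟨hIQ, hI⟩ := hI
    simp only [Finset.mem_sigma, Finset.mem_filter, Finset.mem_powerset]
    refine ⟨⟨Finset.sdiff_subset_sdiff hIQ subset_rfl, fun x hx y hy z hz =>
      hI x (Finset.sdiff_subset hx) y (Finset.sdiff_subset hy) z (Finset.sdiff_subset hz)⟩, ?_⟩
    intro x hx
    obtain ⟨hxI, hxL⟩ := Finset.mem_inter.1 hx
    refine Finset.mem_filter.2 ⟨hxL, fun a ha b hb c hc => ?_⟩
    have hs : insert x (I \ L) ⊆ I := Finset.insert_subset hxI Finset.sdiff_subset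
    exact hI a (hs ha) b (hs hb) c (hs hc)
  · rintro ⟨I, J⟩ hs
    simp only [Finset.mem_sigma, Finset.mem_filter, Finset.mem_powerset] at hs
    obtain ⟨⟨hIQ, hI⟩, hJ⟩ := hs
    have hJL : J ⊆ L := hJ.trans (Finset.filter_subset _ _)
    have hsub : I ∪ J ⊆ Q :=
      Finset.union_subset (hIQ.trans Finset.sdiff_subset) (hJL.trans hLQ)
    have hJI : ∀ a ∈ J, ∀ b ∈ I, ∀ c ∈ I, ¬T a b c := fun a ha b hb c hc =>
      (Finset.mem_filter.1 (hJ ha)).2 a (Finset.mem_insert_self _ _) b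
        (Finset.mem_insert_of_mem hb) c (Finset.mem_insert_of_mem hc)
    simp only [Finset.mem_filter, Finset.mem_powerset]
    refine ⟨hsub, fun a ha b hb c hc habc => ?_⟩
    rcases Finset.mem_union.1 ha with ha' | ha' <;> rcases Finset.mem_union.1 hb with hb' | hb' <;>
      rcases Finset.mem_union.1 hc with hc' | hc'
    · exact hI a ha' b hb' c hc' habc
    · exact hJI c hc' a ha' b hb' (hT.rotate (hT.rotate habc))
    · exact hJI b hb' c hc' a ha' (hT.rotate habc)
    · exact hL b (hJL hb') c (hJL hc') a (hsub ha) (hT.rotate habc)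
    · exact hJI a ha' b hb' c hc' habc
    · exact hL c (hJL hc') a (hJL ha') b (hsub hb) (hT.rotate (hT.rotate habc))
    · exact hL a (hJL ha') b (hJL hb') c (hsub hc) habc
    · exact hL a (hJL ha') b (hJL hb') c (hsub hc) habc
  · intro I _
    exact Finset.sdiff_union_inter I L
  · rintro ⟨I, J⟩ hs
    simp only [Finset.mem_sigma, Finset.mem_filter, Finset.mem_powerset] at hs
    obtain ⟨⟨hIQ, hI⟩, hJ⟩ := hs
    have hJL : J ⊆ L := hJ.trans (Finset.filter_subset _ _)
    have hIL : Disjoint I L := Finset.disjoint_of_subset_left hIQ Finset.sdiff_disjoint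
    have h1 : (I ∪ J) \ L = I := by
      rw [Finset.union_sdiff_distrib, Finset.sdiff_eq_self_of_disjoint hIL,
        Finset.sdiff_eq_empty_iff_subset.2 hJL, Finset.union_empty]
    have h2 : (I ∪ J) ∩ L = J := by
      rw [Finset.union_inter_distrib_right, Finset.disjoint_iff_inter_eq_empty.1 hIL,
        Finset.inter_eq_left.2 hJL, Finset.empty_union]
    simp only [h1, h2]
  · intro I _
    rw [Finset.sdiff_union_inter]

set_option maxHeartbeats 1000000 in
/-- Cost of adding `v` when the link of `v` in `Q` is spread out: the local estimate over all the
extensions of a fixed independent set `I` by compatible vertices. -/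
lemma sum_extensions_le (hT : IsTripleSystem T) {v : V} {I A : Finset V} {β κ : ℝ}
    (hvI : v ∉ I) (hvA : v ∉ A) (hIA : Disjoint I A) (hβ : 0 ≤ β) (hκ : Real.exp κ ≤ 2)
    (hA : ∀ J ⊆ A, β * (energy T J + 2 * codegreeSum T v J) ≤ κ) (τ : ℝ) :
    Real.exp (-κ - τ) * ∑ J ∈ A.powerset, energyWeight T β (I ∪ J) *
        (1 + τ - (2 * β * codegreeSum T v (I ∪ J) + 4 * (linkPairs T v (I ∪ J)).card))
      ≤ ∑ J ∈ A.powerset with ∀ e ∈ linkPairs T v A, ¬(e.1 ∈ J ∧ e.2 ∈ J),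
          energyWeight T β (insert v (I ∪ J)) := by
  set a : V → ℝ := fun x => Real.exp (-(2 * β * codegreeSum T x I)) with ha
  have ha0 : ∀ x, 0 ≤ a x := fun x => (Real.exp_pos _).le
  have ha1 : ∀ x, a x ≤ 1 := fun x => by
    rw [ha, Real.exp_le_one_iff, neg_nonpos]
    exact mul_nonneg (by positivity) (codegreeSum_nonneg _ _)
  set m : Finset V → ℝ := fun J => ∏ x ∈ J, a x with hm
  have hm0 : ∀ J, 0 < m J := fun J => Finset.prod_pos fun x _ => Real.exp_pos _
  set S := ∑ J ∈ A.powerset, m J with hS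
  have hS0 : 0 < S := sum_prod_powerset_pos ha0 A
  set w := energyWeight T β I with hw
  have hw0 : 0 < w := energyWeight_pos _ _
  have hWJ : ∀ J ∈ A.powerset,
      energyWeight T β (I ∪ J) = w * m J * Real.exp (-(β * energy T J)) := by
    intro J hJ
    rw [Finset.mem_powerset] at hJ
    rw [hm, hw]
    simp only [ha, energyWeight]
    rw [← Real.exp_sum, ← Real.exp_add, ← Real.exp_add,
      energy_union hT (Finset.disjoint_of_subset_right hJ hIA), Finset.sum_neg_distrib,
      ← Finset.mul_sum]
    congr 1; ring
  have hle : ∀ J ∈ A.powerset, energyWeight T β (I ∪ J) ≤ w * m J := by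
    intro J hJ
    rw [hWJ J hJ]
    refine mul_le_of_le_one_right (mul_nonneg hw0.le (hm0 J).le) ?_
    rw [Real.exp_le_one_iff, neg_nonpos]
    exact mul_nonneg hβ (energy_nonneg _)
  have hge : ∀ J ∈ A.powerset, w * m J ≤ 2 * energyWeight T β (I ∪ J) := by
    intro J hJ
    rw [hWJ J hJ]
    have h1 := hA J (Finset.mem_powerset.1 hJ)
    have h2 : Real.exp (β * energy T J) ≤ 2 := by
      refine le_trans (Real.exp_le_exp.2 ?_) hκ
      nlinarith [mul_nonneg hβ (codegreeSum_nonneg (T := T) v J)]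
    have h3 : Real.exp (β * energy T J) * Real.exp (-(β * energy T J)) = 1 := by
      rw [← Real.exp_add]; simp
    have h4 := mul_le_mul_of_nonneg_right h2 (Real.exp_pos (-(β * energy T J))).le
    have h5 := mul_nonneg hw0.le (hm0 J).le
    nlinarith
  have hins : ∀ J ∈ A.powerset, Real.exp (-κ) * (Real.exp (-(2 * β * codegreeSum T v I)) *
      (w * m J)) ≤ energyWeight T β (insert v (I ∪ J)) := by
    intro J hJ
    have hJ' := Finset.mem_powerset.1 hJ
    have hv : v ∉ I ∪ J := by
      rw [Finset.mem_union]; exact fun h => h.elim hvI fun h => hvA (hJ' h)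
    have h1 : energyWeight T β (insert v (I ∪ J))
        = Real.exp (-(β * (energy T J + 2 * codegreeSum T v J)))
          * (Real.exp (-(2 * β * codegreeSum T v I)) * (w * m J)) := by
      have h2 : energyWeight T β (insert v (I ∪ J))
          = energyWeight T β (I ∪ J) * Real.exp (-(2 * β * codegreeSum T v (I ∪ J))) := by
        unfold energyWeight
        rw [energy_insert hT hv, ← Real.exp_add]
        congr 1; ring
      have h3 : codegreeSum T v (I ∪ J) = codegreeSum T v I + codegreeSum T v J :=
        Finset.sum_union (Finset.disjoint_of_subset_right hJ' hIA)
      rw [h2, hWJ J hJ, h3, show -(2 * β * (codegreeSum T v I + codegreeSum T v J))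
        = -(2 * β * codegreeSum T v I) + -(2 * β * codegreeSum T v J) by ring, Real.exp_add,
        show -(β * (energy T J + 2 * codegreeSum T v J))
        = -(β * energy T J) + -(2 * β * codegreeSum T v J) by ring, Real.exp_add]
      ring
    rw [h1]
    refine mul_le_mul_of_nonneg_right (Real.exp_le_exp.2 (neg_le_neg (hA J hJ'))) ?_
    exact mul_nonneg (Real.exp_pos _).le (mul_nonneg hw0.le (hm0 J).le)
  -- the two sums over pairs
  set Y := ∑ J ∈ A.powerset, m J * (linkPairs T v J).card with hY
  have hYeq : ∑ e ∈ linkPairs T v A, ∑ J ∈ A.powerset with e.1 ∈ J ∧ e.2 ∈ J, m J = Y := by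
    simp_rw [Finset.sum_filter]
    rw [Finset.sum_comm]
    refine Finset.sum_congr rfl fun J hJ => ?_
    rw [← Finset.sum_filter, Finset.sum_const, nsmul_eq_mul, mul_comm]
    congr 3
    ext e
    have hJ' := Finset.mem_powerset.1 hJ
    simp only [linkPairs, Finset.mem_filter, Finset.mem_product]
    exact ⟨fun h => ⟨h.2, h.1.2⟩, fun h => ⟨⟨⟨hJ' h.1.1, hJ' h.1.2⟩, h.2⟩, h.1⟩⟩
  have hHarris := sum_powerset_mul_exp_le ha0 ha1 A (linkPairs T v A)
  change S * Real.exp (-2 * ((∑ e ∈ linkPairs T v A,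
    ∑ J ∈ A.powerset with e.1 ∈ J ∧ e.2 ∈ J, m J) / S))
    ≤ ∑ J ∈ A.powerset with ∀ e ∈ linkPairs T v A, ¬(e.1 ∈ J ∧ e.2 ∈ J), m J at hHarris
  rw [hYeq] at hHarris
  set G := ∑ J ∈ A.powerset, energyWeight T β (I ∪ J) with hG
  have hG0 : 0 < G := Finset.sum_pos (fun J _ => energyWeight_pos _ _) ⟨∅, by simp⟩
  have hGS : G ≤ w * S := by rw [hS, Finset.mul_sum]; exact Finset.sum_le_sum hle
  clear_value m w
  clear_value S Y G
  clear hA hWJ ha0 ha1 hm hw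
  set t := 2 * β * codegreeSum T v I + 2 * (Y / S) with ht
  clear_value t
  calc _ = Real.exp (-κ) * (Real.exp (-τ) * (G * (1 + τ) - ∑ J ∈ A.powerset,
        energyWeight T β (I ∪ J) * (2 * β * codegreeSum T v (I ∪ J)
          + 4 * (linkPairs T v (I ∪ J)).card))) := by
        rw [sub_eq_add_neg, Real.exp_add, hG, Finset.sum_mul, ← Finset.sum_sub_distrib, mul_assoc]
        simp only [mul_sub]
    _ ≤ Real.exp (-κ) * (Real.exp (-τ) * (G * (1 + τ) - G * t)) := by
        gcongr
        have h1 : G * (2 * (Y / S)) ≤ w * (2 * Y) := by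
          have hY0 : 0 ≤ Y := by
            rw [hY]
            exact Finset.sum_nonneg fun J _ => mul_nonneg (hm0 J).le (Nat.cast_nonneg _)
          calc G * (2 * (Y / S)) ≤ w * S * (2 * (Y / S)) := by gcongr
            _ = w * (2 * (S * (Y / S))) := by ring
            _ = w * (2 * Y) := by rw [mul_div_cancel₀ _ hS0.ne']
        have h2 : G * t ≤ ∑ J ∈ A.powerset, (energyWeight T β (I ∪ J)
            * (2 * β * codegreeSum T v I) + w * (2 * (m J * (linkPairs T v J).card))) := by
          rw [Finset.sum_add_distrib, ← Finset.sum_mul, ← Finset.mul_sum, ← Finset.mul_sum,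
            ← hG, ← hY, ht, mul_add]
          linarith
        refine h2.trans (Finset.sum_le_sum fun J hJ => ?_)
        rw [mul_add]
        refine add_le_add ?_ ?_
        · refine mul_le_mul_of_nonneg_left ?_ (energyWeight_pos _ _).le
          exact mul_le_mul_of_nonneg_left (codegreeSum_mono _ Finset.subset_union_left)
            (by positivity)
        · have h3 : ((linkPairs T v J).card : ℝ) ≤ (linkPairs T v (I ∪ J)).card := by
            refine Nat.cast_le.2 (Finset.card_le_card ?_)
            exact Finset.filter_subset_filter _ (Finset.product_subset_product
              Finset.subset_union_right Finset.subset_union_right)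
          calc w * (2 * (m J * (linkPairs T v J).card))
              = w * m J * (2 * (linkPairs T v J).card) := by ring
            _ ≤ 2 * energyWeight T β (I ∪ J) * (2 * (linkPairs T v (I ∪ J)).card) := by
                refine mul_le_mul (hge J hJ) (by linarith) (by positivity) ?_
                exact mul_nonneg zero_le_two (energyWeight_pos _ _).le
            _ = _ := by ring
    _ ≤ Real.exp (-κ) * (G * Real.exp (-t)) := by
        refine mul_le_mul_of_nonneg_left ?_ (Real.exp_pos _).le
        have h1 := Real.add_one_le_exp (τ - t)
        have h2 : Real.exp (-t) = Real.exp (-τ) * Real.exp (τ - t) := by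
          rw [← Real.exp_add]; congr 1; ring
        rw [h2]
        calc _ = G * (Real.exp (-τ) * (τ - t + 1)) := by ring
          _ ≤ _ := by gcongr
    _ ≤ Real.exp (-κ) * (w * S * Real.exp (-t)) := by gcongr
    _ = Real.exp (-κ) * (Real.exp (-(2 * β * codegreeSum T v I)) *
          (w * (S * Real.exp (-2 * (Y / S))))) := by
        rw [ht, neg_add, Real.exp_add, neg_mul]
        ring
    _ ≤ Real.exp (-κ) * (Real.exp (-(2 * β * codegreeSum T v I)) *
          (w * ∑ J ∈ A.powerset with ∀ e ∈ linkPairs T v A, ¬(e.1 ∈ J ∧ e.2 ∈ J), m J)) := by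
        gcongr
    _ = ∑ J ∈ A.powerset with ∀ e ∈ linkPairs T v A, ¬(e.1 ∈ J ∧ e.2 ∈ J),
          Real.exp (-κ) * (Real.exp (-(2 * β * codegreeSum T v I)) * (w * m J)) := by
        rw [Finset.mul_sum, Finset.mul_sum, Finset.mul_sum]
    _ ≤ _ := Finset.sum_le_sum fun J hJ => hins J (Finset.mem_filter.1 hJ).1

/-- Cost of adding `v` when the link of `v` in `Q` is spread out. -/
lemma sum_isIndep_insert_ge (hT : IsTripleSystem T) {v : V} {Q L : Finset V} {β κ : ℝ}
    (hv : v ∉ Q) (hLQ : L ⊆ Q) (hlink : ∀ x ∈ Q, ∀ y ∈ Q, T v x y → x ∈ L)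
    (hL : ∀ a ∈ L, ∀ b ∈ L, ∀ c ∈ Q, ¬T a b c) (hβ : 0 ≤ β) (hκ : Real.exp κ ≤ 2)
    (hA : ∀ J ⊆ L, β * (energy T J + 2 * codegreeSum T v J) ≤ κ) (τ : ℝ) :
    Real.exp (-κ - τ) * ∑ I ∈ Q.powerset with IsIndep T I, energyWeight T β I *
        (1 + τ - (2 * β * codegreeSum T v I + 4 * (linkPairs T v I).card))
      ≤ ∑ I ∈ Q.powerset with IsIndep T (insert v I), energyWeight T β (insert v I) := by
  have h1 : (Q.powerset.filter fun I => IsIndep T (insert v I))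
      = (Q.powerset.filter fun I => IsIndep T I).filter fun I => ∀ x ∈ I, ∀ y ∈ I, ¬T v x y := by
    rw [Finset.filter_filter]
    exact Finset.filter_congr fun I _ => isIndep_insert_iff hT v I
  rw [h1, Finset.sum_filter (s := Q.powerset.filter fun I => IsIndep T I),
    sum_isIndep_eq_sum_sum hT hLQ hL, sum_isIndep_eq_sum_sum hT hLQ hL, Finset.mul_sum]
  refine Finset.sum_le_sum fun I hI => ?_
  have hIQ := Finset.mem_powerset.1 (Finset.mem_filter.1 hI).1
  set A := L.filter fun x => IsIndep T (insert x I) with hAdef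
  have hAL : A ⊆ L := Finset.filter_subset _ _
  have hIL : Disjoint I L := Finset.disjoint_of_subset_left hIQ Finset.sdiff_disjoint
  have h2 := sum_extensions_le hT (I := I) (A := A) (fun h => hv (Finset.sdiff_subset (hIQ h)))
    (fun h => hv (hLQ (hAL h))) (Finset.disjoint_of_subset_right hAL hIL) hβ hκ
    (fun J hJ => hA J (hJ.trans hAL)) τ
  refine h2.trans_eq ?_
  rw [Finset.sum_filter]
  refine Finset.sum_congr rfl fun J hJ => ?_
  have hJA := Finset.mem_powerset.1 hJ
  refine if_congr ?_ rfl rfl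
  constructor
  · intro h x hx y hy hxy
    have hsub : I ∪ J ⊆ Q :=
      Finset.union_subset (hIQ.trans Finset.sdiff_subset) ((hJA.trans hAL).trans hLQ)
    have hxL := hlink x (hsub hx) y (hsub hy) hxy
    have hyL := hlink y (hsub hy) x (hsub hx) (hT.swap (hT.rotate (hT.rotate hxy)))
    have hxJ := (Finset.mem_union.1 hx).resolve_left fun h => Finset.disjoint_left.1 hIL h hxL
    have hyJ := (Finset.mem_union.1 hy).resolve_left fun h => Finset.disjoint_left.1 hIL h hyL
    refine h (x, y) ?_ ⟨hxJ, hyJ⟩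
    simp [linkPairs, hJA hxJ, hJA hyJ, hxy]
  · rintro h ⟨x, y⟩ he ⟨hx, hy⟩
    exact h x (Finset.mem_union_right _ hx) y (Finset.mem_union_right _ hy)
      (Finset.mem_filter.1 he).2

end TripleSystem

section PartitionFunction

variable {V : Type*} [Fintype V] [DecidableEq V] {T : V → V → V → Prop}
  [∀ x y z, Decidable (T x y z)] {β κ p : ℝ} {K : ℕ}

variable (T) in
/-- The total weight of the independent subsets of `Q`. -/
noncomputable def partitionFn (β : ℝ) (Q : Finset V) : ℝ :=
  ∑ I ∈ Q.powerset with IsIndep T I, energyWeight T β I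

variable (T) in
/-- The total weight of the independent sets consisting of `v` and a subset of `Q`. -/
noncomputable def partitionFnThrough (β : ℝ) (Q : Finset V) (v : V) : ℝ :=
  ∑ I ∈ Q.powerset with IsIndep T (insert v I), energyWeight T β (insert v I)

lemma one_le_partitionFn (β : ℝ) (Q : Finset V) : 1 ≤ partitionFn T β Q := by
  have h : energyWeight T β ∅ = 1 := by simp [energyWeight, energy]
  rw [← h]
  refine Finset.single_le_sum (f := fun I => energyWeight T β I)
    (fun I _ => (energyWeight_pos _ _).le) ?_
  simp [IsIndep]

lemma partitionFn_pos (β : ℝ) (Q : Finset V) : 0 < partitionFn T β Q :=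
  zero_lt_one.trans_le (one_le_partitionFn β Q)

lemma partitionFnThrough_nonneg (β : ℝ) (Q : Finset V) (v : V) :
    0 ≤ partitionFnThrough T β Q v :=
  Finset.sum_nonneg fun _ _ => (energyWeight_pos _ _).le

lemma partitionFn_insert (β : ℝ) {Q : Finset V} {v : V} (hv : v ∉ Q) :
    partitionFn T β (insert v Q) = partitionFn T β Q + partitionFnThrough T β Q v := by
  unfold partitionFn partitionFnThrough
  simp only [Finset.sum_filter]
  exact Finset.sum_powerset_insert hv _

lemma partitionFnThrough_le (hT : IsTripleSystem T) (hβ : 0 ≤ β) {Q : Finset V} {v : V}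
    (hv : v ∉ Q) : partitionFnThrough T β Q v ≤ partitionFn T β Q := by
  unfold partitionFn partitionFnThrough
  calc _ ≤ ∑ I ∈ Q.powerset with IsIndep T (insert v I), energyWeight T β I := by
        refine Finset.sum_le_sum fun I hI => ?_
        have hvI : v ∉ I := fun h => hv (Finset.mem_powerset.1 (Finset.mem_filter.1 hI).1 h)
        unfold energyWeight
        rw [energy_insert hT hvI, Real.exp_le_exp]
        nlinarith [mul_nonneg hβ (codegreeSum_nonneg (T := T) v I)]
    _ ≤ _ := by
        refine Finset.sum_le_sum_of_subset_of_nonneg ?_ fun I _ _ => (energyWeight_pos _ _).le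
        exact Finset.monotone_filter_right _ fun I _ h => ((isIndep_insert_iff hT v I).1 h).1

lemma sum_partitionFnThrough_erase (β : ℝ) (Q : Finset V) :
    ∑ v ∈ Q, partitionFnThrough T β (Q.erase v) v
      = ∑ I ∈ Q.powerset with IsIndep T I, (I.card : ℝ) * energyWeight T β I := by
  have h : ∀ v ∈ Q, partitionFnThrough T β (Q.erase v) v
      = ∑ I ∈ Q.powerset with IsIndep T I, if v ∈ I then energyWeight T β I else 0 := by
    intro v hv
    have hn := Finset.notMem_erase v Q
    have h1 := Finset.sum_powerset_insert hn fun I =>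
      if IsIndep T I then (if v ∈ I then energyWeight T β I else 0) else 0
    rw [Finset.insert_erase hv] at h1
    rw [Finset.sum_filter, h1, Finset.sum_eq_zero, zero_add]
    · unfold partitionFnThrough
      rw [Finset.sum_filter]
      simp
    · intro I hI
      have : v ∉ I := fun h => hn (Finset.mem_powerset.1 hI h)
      simp [this]
  rw [Finset.sum_congr rfl h, Finset.sum_comm]
  refine Finset.sum_congr rfl fun I hI => ?_
  rw [← Finset.sum_filter, Finset.sum_const, nsmul_eq_mul, Finset.filter_mem_eq_inter,
    Finset.inter_eq_right.2 (Finset.mem_powerset.1 (Finset.mem_filter.1 hI).1)]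

lemma sum_partitionFnThrough_erase_le (hK : ∀ I, IsIndep T I → I.card ≤ K) (β : ℝ)
    (Q : Finset V) :
    ∑ v ∈ Q, partitionFnThrough T β (Q.erase v) v ≤ K * partitionFn T β Q := by
  rw [sum_partitionFnThrough_erase, partitionFn, Finset.mul_sum]
  refine Finset.sum_le_sum fun I hI => ?_
  exact mul_le_mul_of_nonneg_right (Nat.cast_le.2 (hK I (Finset.mem_filter.1 hI).2))
    (energyWeight_pos _ _).le

lemma bernoulliWeight_erase_le (h0 : 0 ≤ p) (h1 : p ≤ 1) {Q : Finset V} {v : V} (hv : v ∈ Q) :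
    p * bernoulliWeight p Finset.univ (Q.erase v) ≤ bernoulliWeight p Finset.univ Q := by
  unfold bernoulliWeight
  have hc := Finset.card_erase_add_one hv
  have hle := Finset.card_le_card (Finset.subset_univ Q)
  have hsub : (Finset.univ : Finset V).card - (Q.erase v).card =
      ((Finset.univ : Finset V).card - Q.card) + 1 := by
    omega
  rw [hsub, ← hc, pow_succ, pow_succ]
  have h2 : 0 ≤ p ^ (Q.erase v).card *
      (1 - p) ^ ((Finset.univ : Finset V).card - ((Q.erase v).card + 1)) * p :=
    mul_nonneg (mul_nonneg (pow_nonneg h0 _) (pow_nonneg (by linarith) _)) h0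
  nlinarith

/-- The expected number of vertices joining a random independent set is at most `2 * K / p`. -/
lemma sum_bernoulliWeight_mul_partitionFnThrough_le (hT : IsTripleSystem T)
    (hK : ∀ I, IsIndep T I → I.card ≤ K) (hβ : 0 ≤ β) (h0 : 0 < p) (h1 : p ≤ 1) :
    p * ∑ Q ∈ (Finset.univ : Finset V).powerset, bernoulliWeight p Finset.univ Q *
        ∑ v ∈ Finset.univ.filter (· ∉ Q), partitionFnThrough T β Q v / partitionFn T β Q
      ≤ 2 * K := by
  have hswap : ∑ Q ∈ (Finset.univ : Finset V).powerset, bernoulliWeight p Finset.univ Q *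
        ∑ v ∈ Finset.univ.filter (· ∉ Q), partitionFnThrough T β Q v / partitionFn T β Q
      = ∑ Q ∈ (Finset.univ : Finset V).powerset, ∑ v ∈ Q,
          bernoulliWeight p Finset.univ (Q.erase v) *
          (partitionFnThrough T β (Q.erase v) v / partitionFn T β (Q.erase v)) := by
    simp only [Finset.mul_sum]
    rw [Finset.sum_sigma', Finset.sum_sigma']
    refine Finset.sum_nbij' (fun s => ⟨insert s.2 s.1, s.2⟩) (fun s => ⟨s.1.erase s.2, s.2⟩)
      ?_ ?_ ?_ ?_ ?_
    · rintro ⟨Q, v⟩ _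
      simp
    · rintro ⟨Q, v⟩ _
      simp
    · rintro ⟨Q, v⟩ h
      have hv : v ∉ Q := by simpa using h
      simp [Finset.erase_insert hv]
    · rintro ⟨Q, v⟩ h
      have hv : v ∈ Q := by simpa using h
      simp [Finset.insert_erase hv]
    · rintro ⟨Q, v⟩ h
      have hv : v ∉ Q := by simpa using h
      simp [Finset.erase_insert hv]
  rw [hswap, Finset.mul_sum]
  calc _ ≤ ∑ Q ∈ (Finset.univ : Finset V).powerset, bernoulliWeight p Finset.univ Q * (2 * K) := by
        refine Finset.sum_le_sum fun Q _ => ?_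
        have hb := bernoulliWeight_nonneg (U := Finset.univ) (S := Q) h0.le h1
        have hZ := partitionFn_pos (T := T) β Q
        calc _ ≤ ∑ v ∈ Q, bernoulliWeight p Finset.univ Q *
              (2 * (partitionFnThrough T β (Q.erase v) v / partitionFn T β Q)) := by
              rw [Finset.mul_sum]
              refine Finset.sum_le_sum fun v hv => ?_
              rw [← mul_assoc]
              have hZ' := partitionFn_pos (T := T) β (Q.erase v)
              have hN := partitionFnThrough_nonneg (T := T) β (Q.erase v) v
              refine mul_le_mul (bernoulliWeight_erase_le h0.le h1 hv) ?_ (by positivity) hb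
              rw [← mul_div_assoc, div_le_div_iff₀ hZ' hZ]
              have h2 := partitionFn_insert (T := T) β (Finset.notMem_erase v Q)
              have h3 := partitionFnThrough_le hT hβ (Finset.notMem_erase v Q)
              rw [Finset.insert_erase hv] at h2
              nlinarith
          _ = bernoulliWeight p Finset.univ Q *
              (2 * ((∑ v ∈ Q, partitionFnThrough T β (Q.erase v) v) / partitionFn T β Q)) := by
              rw [← Finset.mul_sum, ← Finset.mul_sum, Finset.sum_div]
          _ ≤ _ := by
              gcongr
              rw [div_le_iff₀ hZ]
              exact sum_partitionFnThrough_erase_le hK β Q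
    _ = 2 * K := by rw [← Finset.sum_mul, sum_bernoulliWeight, one_mul]

lemma card_isIndep_le (hK : ∀ I, IsIndep T I → I.card ≤ K) (Q : Finset V) :
    (Q.powerset.filter fun I => IsIndep T I).card ≤ (Fintype.card V + 1) ^ K := by
  calc _ ≤ ((Finset.range (K + 1)).biUnion fun k => Finset.univ.powersetCard k).card := by
        refine Finset.card_le_card fun I hI => ?_
        simp only [Finset.mem_biUnion, Finset.mem_range, Finset.mem_powersetCard_univ,
          exists_eq_right']
        exact Nat.lt_succ_of_le (hK I (Finset.mem_filter.1 hI).2)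
    _ ≤ ∑ k ∈ Finset.range (K + 1), (Finset.univ.powersetCard k : Finset (Finset V)).card :=
        Finset.card_biUnion_le
    _ ≤ ∑ k ∈ Finset.range (K + 1), Fintype.card V ^ k * 1 ^ (K - k) * K.choose k := by
        refine Finset.sum_le_sum fun k hk => ?_
        rw [Finset.card_powersetCard, Finset.card_univ, one_pow, mul_one]
        have h1 : 0 < K.choose k := Nat.choose_pos (Nat.lt_succ_iff.1 (Finset.mem_range.1 hk))
        exact (Nat.choose_le_pow _ _).trans (Nat.le_mul_of_pos_right _ h1)
    _ = _ := (add_pow _ _ _).symm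

/-- Entropy bound for the mean energy. -/
lemma sum_energyWeight_mul_energy_le (hK : ∀ I, IsIndep T I → I.card ≤ K) (Q : Finset V) :
    ∑ I ∈ Q.powerset with IsIndep T I, energyWeight T β I * (β * energy T I)
      ≤ K * Real.log (Fintype.card V + 1) * partitionFn T β Q := by
  set R := K * Real.log (Fintype.card V + 1) with hR
  have hexpR : Real.exp R = ((Fintype.card V + 1 : ℕ) : ℝ) ^ K := by
    rw [hR, mul_comm, Real.exp_mul, Real.exp_log (by positivity), Real.rpow_natCast]
    push_cast; rfl
  have hN : ((Q.powerset.filter fun I => IsIndep T I).card : ℝ) ≤ Real.exp R := by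
    rw [hexpR]
    exact_mod_cast card_isIndep_le hK Q
  have h1 : ∀ I : Finset V,
      Real.exp R * (energyWeight T β I * (1 + β * energy T I - R)) ≤ 1 := by
    intro I
    have h2 := Real.add_one_le_exp (β * energy T I - R)
    have h3 : Real.exp R * (energyWeight T β I * Real.exp (β * energy T I - R)) = 1 := by
      unfold energyWeight
      rw [← Real.exp_add, ← Real.exp_add, Real.exp_eq_one_iff]
      ring
    rw [← h3]
    have := energyWeight_pos (T := T) β I
    gcongr
    linarith
  have h4 : Real.exp R * ∑ I ∈ Q.powerset with IsIndep T I,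
      energyWeight T β I * (1 + β * energy T I - R) ≤ Real.exp R := by
    rw [Finset.mul_sum]
    refine (Finset.sum_le_sum fun I _ => h1 I).trans ?_
    rw [Finset.sum_const, nsmul_eq_mul, mul_one]
    exact hN
  have h5 := (mul_le_iff_le_one_right (Real.exp_pos R)).1 h4
  have h6 : ∑ I ∈ Q.powerset with IsIndep T I, energyWeight T β I * (1 + β * energy T I - R)
      = (1 - R) * partitionFn T β Q
        + ∑ I ∈ Q.powerset with IsIndep T I, energyWeight T β I * (β * energy T I) := by
    rw [partitionFn, Finset.mul_sum, ← Finset.sum_add_distrib]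
    exact Finset.sum_congr rfl fun I _ => by ring
  have := one_le_partitionFn (T := T) β Q
  nlinarith

omit [DecidableEq V] in
lemma sum_card_linkPairs (hT : IsTripleSystem T) (I : Finset V) :
    ∑ v, ((linkPairs T v I).card : ℝ) = energy T I := by
  unfold energy codegreeSum codegree linkPairs
  rw [← Finset.sum_product']
  simp only [Finset.card_filter, Nat.cast_sum]
  rw [Finset.sum_comm]
  refine Finset.sum_congr rfl fun e _ => Finset.sum_congr rfl fun v _ => ?_
  congr 1
  exact if_congr ⟨fun h => hT.rotate h, fun h => hT.rotate (hT.rotate h)⟩ rfl rfl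

omit [DecidableEq V] in
lemma sum_codegreeSum_le (hT : IsTripleSystem T) (hK : ∀ I, IsIndep T I → I.card ≤ K) {D : ℝ}
    (hD0 : 0 ≤ D) (hD : ∀ x, ∑ y, codegree T x y ≤ D) {I : Finset V} (hI : IsIndep T I) :
    ∑ v, codegreeSum T v I ≤ K * D := by
  unfold codegreeSum
  rw [Finset.sum_comm]
  calc _ ≤ ∑ x ∈ I, D := by
        refine Finset.sum_le_sum fun x _ => ?_
        simp only [codegree_comm hT _ x]
        exact hD x
    _ ≤ K * D := by
        rw [Finset.sum_const, nsmul_eq_mul]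
        exact mul_le_mul_of_nonneg_right (Nat.cast_le.2 (hK I hI)) hD0

variable (T) in
/-- The vertex `v ∉ Q` has at most `r` link pairs in `Q`, and no edge inside `Q` contains two
vertices covered by those pairs. -/
def IsSpread (r : ℝ) (Q : Finset V) (v : V) : Prop :=
  v ∉ Q ∧ ((linkPairs T v Q).card : ℝ) ≤ r ∧
    ∀ a ∈ Q, ∀ a' ∈ Q, ∀ b ∈ Q, ∀ b' ∈ Q, ∀ c ∈ Q, T v a a' → T v b b' → ¬T a b c

lemma IsSpread.partitionFnThrough_ge (hT : IsTripleSystem T) {r ℓ : ℝ} {Q : Finset V} {v : V}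
    (h : IsSpread T r Q v) (hβ : 0 ≤ β) (hκ : Real.exp κ ≤ 2) (hr : 0 ≤ r) (hℓ0 : 0 ≤ ℓ)
    (hℓ : ∀ x y, codegree T x y ≤ ℓ) (hβκ : β * ℓ * (r ^ 2 + 2 * r) ≤ κ) (τ : ℝ) :
    Real.exp (-κ - τ) * ∑ I ∈ Q.powerset with IsIndep T I, energyWeight T β I *
        (1 + τ - (2 * β * codegreeSum T v I + 4 * (linkPairs T v I).card))
      ≤ partitionFnThrough T β Q v := by
  obtain ⟨hv, hcard, hQ⟩ := h
  set L := (linkPairs T v Q).image Prod.fst with hL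
  have hLcard : (L.card : ℝ) ≤ r := (Nat.cast_le.2 Finset.card_image_le).trans hcard
  have hmem : ∀ x, x ∈ L ↔ x ∈ Q ∧ ∃ y ∈ Q, T v x y := by
    intro x
    simp only [hL, linkPairs, Finset.mem_image, Finset.mem_filter, Finset.mem_product]
    constructor
    · rintro ⟨⟨x, y⟩, ⟨⟨hx, hy⟩, hxy⟩, rfl⟩
      exact ⟨hx, y, hy, hxy⟩
    · rintro ⟨hx, y, hy, hxy⟩
      exact ⟨(x, y), ⟨⟨hx, hy⟩, hxy⟩, rfl⟩
  refine sum_isIndep_insert_ge hT hv (L := L) (fun x hx => ((hmem x).1 hx).1)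
    (fun x hx y hy hxy => (hmem x).2 ⟨hx, y, hy, hxy⟩) ?_ hβ hκ ?_ τ
  · intro a ha b hb c hc
    obtain ⟨ha, a', ha', haa⟩ := (hmem a).1 ha
    obtain ⟨hb, b', hb', hbb⟩ := (hmem b).1 hb
    exact hQ a ha a' ha' b hb b' hb' c hc haa hbb
  · intro J hJ
    have hJr : (J.card : ℝ) ≤ r := (Nat.cast_le.2 (Finset.card_le_card hJ)).trans hLcard
    have h1 : ∀ x, codegreeSum T x J ≤ r * ℓ := by
      intro x
      refine (Finset.sum_le_card_nsmul _ _ ℓ fun y _ => hℓ x y).trans ?_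
      rw [nsmul_eq_mul]
      exact mul_le_mul_of_nonneg_right hJr hℓ0
    have h2 : energy T J ≤ r * (r * ℓ) := by
      refine (Finset.sum_le_card_nsmul _ _ _ fun x _ => h1 x).trans ?_
      rw [nsmul_eq_mul]
      exact mul_le_mul_of_nonneg_right hJr (by positivity)
    refine le_trans ?_ hβκ
    calc _ ≤ β * (r * (r * ℓ) + 2 * (r * ℓ)) := by
          gcongr
          exact h1 v
      _ = _ := by ring

/-- If most pairs of a random set and a vertex are spread, then large independent sets exist. -/
theorem card_mul_exp_le_of_isSpread (hT : IsTripleSystem T)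
    (hK : ∀ I, IsIndep T I → I.card ≤ K) (hβ : 0 < β) (hκ : Real.exp κ ≤ 2) {r ℓ D : ℝ}
    (hr : 0 ≤ r) (hℓ0 : 0 ≤ ℓ) (hℓ : ∀ x y, codegree T x y ≤ ℓ)
    (hβκ : β * ℓ * (r ^ 2 + 2 * r) ≤ κ) (hD0 : 0 ≤ D) (hD : ∀ x, ∑ y, codegree T x y ≤ D)
    (h0 : 0 < p) (h1 : p ≤ 1)
    (hbad : ∑ Q ∈ (Finset.univ : Finset V).powerset, bernoulliWeight p Finset.univ Q *
      ({v | ¬IsSpread T r Q v} : Set V).ncard ≤ Fintype.card V / 2) (hV : 0 < Fintype.card V) :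
    Fintype.card V * p * Real.exp (-(4 * β * K * D / Fintype.card V
      + 8 * K * Real.log (Fintype.card V + 1) / (β * Fintype.card V))) ≤ 8 * K := by
  classical
  set n : ℝ := (Fintype.card V : ℝ) with hn
  have hn0 : 0 < n := Nat.cast_pos.2 hV
  set R := K * Real.log (n + 1) with hR
  have hR0 : 0 ≤ R := mul_nonneg (Nat.cast_nonneg _) (Real.log_nonneg (by linarith))
  set B := 2 * β * (K * D) + 4 * (R / β) with hB
  have hB0 : 0 ≤ B := by positivity
  set τ := 2 * B / n with hτ
  have hτ0 : 0 ≤ τ := by positivity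
  set g : Finset V → V → ℝ := fun Q v => (∑ I ∈ Q.powerset with IsIndep T I,
    energyWeight T β I * (2 * β * codegreeSum T v I + 4 * (linkPairs T v I).card))
      / partitionFn T β Q with hg
  have hg0 : ∀ Q v, 0 ≤ g Q v := fun Q v => by
    refine div_nonneg (Finset.sum_nonneg fun I _ => ?_) (partitionFn_pos _ _).le
    have h2 := codegreeSum_nonneg (T := T) v I
    have h3 := energyWeight_pos (T := T) β I
    positivity
  have hgsum : ∀ Q, ∑ v, g Q v ≤ B := by
    intro Q
    simp only [hg]
    rw [← Finset.sum_div, div_le_iff₀ (partitionFn_pos _ _), Finset.sum_comm]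
    have h2 := sum_energyWeight_mul_energy_le (T := T) (β := β) hK Q
    rw [← hn, ← hR] at h2
    calc _ = ∑ I ∈ Q.powerset with IsIndep T I, energyWeight T β I *
          (2 * β * ∑ v, codegreeSum T v I + 4 * energy T I) := by
          refine Finset.sum_congr rfl fun I _ => ?_
          rw [← Finset.mul_sum, Finset.sum_add_distrib, ← Finset.mul_sum, ← Finset.mul_sum,
            sum_card_linkPairs hT]
      _ ≤ ∑ I ∈ Q.powerset with IsIndep T I, (energyWeight T β I * (2 * β * (K * D))
          + 4 / β * (energyWeight T β I * (β * energy T I))) := by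
          refine Finset.sum_le_sum fun I hI => ?_
          have h3 := sum_codegreeSum_le hT hK hD0 hD (Finset.mem_filter.1 hI).2
          have h4 := energyWeight_pos (T := T) β I
          have h5 : 4 / β * (energyWeight T β I * (β * energy T I))
              = energyWeight T β I * (4 * energy T I) := by field_simp
          rw [mul_add, h5]
          gcongr
      _ = partitionFn T β Q * (2 * β * (K * D)) + 4 / β *
          ∑ I ∈ Q.powerset with IsIndep T I, energyWeight T β I * (β * energy T I) := by
          rw [Finset.sum_add_distrib, ← Finset.sum_mul, ← Finset.mul_sum, partitionFn]
      _ ≤ partitionFn T β Q * (2 * β * (K * D)) + 4 / β * (R * partitionFn T β Q) := by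
          gcongr
      _ = B * partitionFn T β Q := by rw [hB]; ring
  have hlow : ∀ Q v, IsSpread T r Q v → Real.exp (-κ - τ) * (1 + τ - g Q v)
      ≤ partitionFnThrough T β Q v / partitionFn T β Q := by
    intro Q v h
    have h2 := h.partitionFnThrough_ge hT hβ.le hκ hr hℓ0 hℓ hβκ τ
    have hZ := partitionFn_pos (T := T) β Q
    rw [le_div_iff₀ hZ]
    refine le_trans (le_of_eq ?_) h2
    rw [mul_assoc, sub_mul, hg]
    simp only
    rw [div_mul_cancel₀ _ hZ.ne', partitionFn, Finset.mul_sum, ← Finset.sum_sub_distrib]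
    congr 1
    exact Finset.sum_congr rfl fun I _ => by ring
  have hb : ∀ Q : Finset V, 0 ≤ bernoulliWeight p Finset.univ Q := fun Q =>
    bernoulliWeight_nonneg h0.le h1
  have hupper := sum_bernoulliWeight_mul_partitionFnThrough_le (T := T) hT hK hβ.le h0 h1
  have hkey : Real.exp (-κ - τ) * (n / 2) ≤
      ∑ Q ∈ (Finset.univ : Finset V).powerset, bernoulliWeight p Finset.univ Q *
        ∑ v ∈ Finset.univ.filter (· ∉ Q), partitionFnThrough T β Q v / partitionFn T β Q := by
    have hbadcard : ∀ Q : Finset V, (({v | ¬IsSpread T r Q v} : Set V).ncard : ℝ)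
        = n - (Finset.univ.filter fun v => IsSpread T r Q v).card := by
      intro Q
      rw [Set.ncard_eq_toFinset_card', hn, ← Finset.card_univ,
        ← Finset.card_filter_add_card_filter_not (s := Finset.univ)
          (fun v => IsSpread T r Q v)]
      push_cast
      simp
    calc _ = Real.exp (-κ - τ) * ((1 + τ) * (n - n / 2) - B) := by
          congr 1
          rw [hτ]; field_simp; ring
      _ ≤ Real.exp (-κ - τ) * ((1 + τ) * (n - ∑ Q ∈ (Finset.univ : Finset V).powerset,
            bernoulliWeight p Finset.univ Q * ({v | ¬IsSpread T r Q v} : Set V).ncard) - B) := by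
          gcongr
      _ = ∑ Q ∈ (Finset.univ : Finset V).powerset, bernoulliWeight p Finset.univ Q *
            (Real.exp (-κ - τ) * ((1 + τ) *
              (Finset.univ.filter fun v => IsSpread T r Q v).card - B)) := by
          have h2 := sum_bernoulliWeight p (Finset.univ : Finset V)
          have h3 : n - ∑ Q ∈ (Finset.univ : Finset V).powerset,
              bernoulliWeight p Finset.univ Q * ({v | ¬IsSpread T r Q v} : Set V).ncard
              = ∑ Q ∈ (Finset.univ : Finset V).powerset, bernoulliWeight p Finset.univ Q *
                (Finset.univ.filter fun v => IsSpread T r Q v).card := by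
            simp only [hbadcard, mul_sub]
            rw [Finset.sum_sub_distrib, ← Finset.sum_mul, h2]
            ring
          have h4 : B = ∑ Q ∈ (Finset.univ : Finset V).powerset,
              bernoulliWeight p Finset.univ Q * B := by
            rw [← Finset.sum_mul, h2, one_mul]
          rw [h3]
          conv_lhs => rw [h4]
          rw [Finset.mul_sum, ← Finset.sum_sub_distrib, Finset.mul_sum]
          exact Finset.sum_congr rfl fun Q _ => by ring
      _ ≤ _ := by
          refine Finset.sum_le_sum fun Q _ => mul_le_mul_of_nonneg_left ?_ (hb Q)
          calc _ ≤ Real.exp (-κ - τ) * ∑ v ∈ Finset.univ.filter fun v => IsSpread T r Q v,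
                (1 + τ - g Q v) := by
                refine mul_le_mul_of_nonneg_left ?_ (Real.exp_pos _).le
                rw [Finset.sum_sub_distrib, Finset.sum_const, nsmul_eq_mul]
                have h2 : ∑ v ∈ Finset.univ.filter fun v => IsSpread T r Q v, g Q v ≤ B :=
                  (Finset.sum_le_sum_of_subset_of_nonneg (Finset.filter_subset _ _)
                    fun v _ _ => hg0 Q v).trans (hgsum Q)
                linarith
            _ ≤ ∑ v ∈ Finset.univ.filter fun v => IsSpread T r Q v,
                partitionFnThrough T β Q v / partitionFn T β Q := by
                rw [Finset.mul_sum]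
                exact Finset.sum_le_sum fun v hv => hlow Q v (Finset.mem_filter.1 hv).2
            _ ≤ _ := by
                refine Finset.sum_le_sum_of_subset_of_nonneg
                  (Finset.monotone_filter_right _ fun v _ h => h.1) fun v _ _ => ?_
                exact div_nonneg (partitionFnThrough_nonneg _ _ _) (partitionFn_pos _ _).le
  have hτeq : 4 * β * K * D / n + 8 * K * Real.log (n + 1) / (β * n) = τ := by
    rw [hτ, hB, hR]; field_simp; ring
  rw [hτeq]
  have h2 : Real.exp (-τ) ≤ 2 * Real.exp (-κ - τ) := by
    rw [sub_eq_add_neg, Real.exp_add, Real.exp_neg κ]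
    have h3 : 1 ≤ 2 * (Real.exp κ)⁻¹ := by
      rw [← div_eq_mul_inv, le_div_iff₀ (Real.exp_pos _)]; linarith
    nlinarith [Real.exp_pos (-τ)]
  have h3 := (mul_le_mul_of_nonneg_left hkey h0.le).trans hupper
  calc n * p * Real.exp (-τ) ≤ n * p * (2 * Real.exp (-κ - τ)) := by gcongr
    _ = 4 * (p * (Real.exp (-κ - τ) * (n / 2))) := by ring
    _ ≤ 4 * (2 * K) := by gcongr
    _ = 8 * K := by ring

end PartitionFunction

section RandomSubset

variable {V : Type*} [Fintype V] [DecidableEq V] {T : V → V → V → Prop}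
  [∀ x y z, Decidable (T x y z)] {p ℓ D : ℝ}

lemma sum_bernoulliWeight_mul_card_filter_eq {ι : Type*} (p : ℝ) (X : Finset ι)
    (c : ι → Finset V) {k : ℕ} (hc : ∀ x ∈ X, (c x).card = k) :
    ∑ Q ∈ (Finset.univ : Finset V).powerset, bernoulliWeight p Finset.univ Q *
      ((X.filter fun x => c x ⊆ Q).card : ℝ) = X.card * p ^ k := by
  rw [sum_bernoulliWeight_mul_card_filter p X c fun _ _ => Finset.subset_univ _,
    Finset.sum_congr rfl fun x hx => by rw [hc x hx], Finset.sum_const, nsmul_eq_mul]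

omit [DecidableEq V] in
lemma card_filter_extend_le {ι : Type*} [Fintype ι] (hℓ : ∀ x y, codegree T x y ≤ ℓ)
    (P : ι → Prop) [DecidablePred P] (f g : ι → V) :
    ((Finset.univ.filter fun x : ι × V => P x.1 ∧ T (f x.1) (g x.1) x.2).card : ℝ)
      ≤ (Finset.univ.filter P).card * ℓ := by
  rw [Finset.card_filter, Fintype.sum_prod_type, Finset.card_filter, Nat.cast_sum, Nat.cast_sum,
    Finset.sum_mul]
  refine Finset.sum_le_sum fun i _ => ?_
  by_cases h : P i
  · simpa [h, ← Finset.card_filter, codegree] using hℓ (f i) (g i)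
  · simp [h]

omit [DecidableEq V] in
lemma card_link_le (hD : ∀ x, ∑ y, codegree T x y ≤ D) (v : V) :
    ((Finset.univ.filter fun x : V × V => T v x.1 x.2).card : ℝ) ≤ D := by
  refine le_trans (le_of_eq ?_) (hD v)
  simp only [Finset.card_filter, Fintype.sum_prod_type, codegree]
  push_cast
  rfl

omit [DecidableEq V] in
lemma card_edges_le (hD : ∀ x, ∑ y, codegree T x y ≤ D) :
    ((Finset.univ.filter fun x : V × V × V => T x.1 x.2.1 x.2.2).card : ℝ)
      ≤ Fintype.card V * D := by
  rw [Finset.card_filter, Fintype.sum_prod_type, Nat.cast_sum]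
  refine (Finset.sum_le_card_nsmul _ _ D fun v _ => ?_).trans_eq (by simp)
  rw [← Finset.card_filter]
  exact card_link_le hD v

omit [DecidableEq V] in
lemma card_edge_pairs_le (hD0 : 0 ≤ D) (hD : ∀ x, ∑ y, codegree T x y ≤ D) :
    ((Finset.univ.filter fun x : V × (V × V) × (V × V) =>
      T x.1 x.2.1.1 x.2.1.2 ∧ T x.1 x.2.2.1 x.2.2.2).card : ℝ) ≤ Fintype.card V * D ^ 2 := by
  rw [Finset.card_filter, Fintype.sum_prod_type, Nat.cast_sum]
  refine (Finset.sum_le_card_nsmul _ _ (D ^ 2) fun v _ => ?_).trans_eq (by simp)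
  rw [← Finset.card_filter]
  have h : (Finset.univ.filter fun x : (V × V) × (V × V) => T v x.1.1 x.1.2 ∧ T v x.2.1 x.2.2)
      = (Finset.univ.filter fun x : V × V => T v x.1 x.2) ×ˢ
        Finset.univ.filter fun x : V × V => T v x.1 x.2 := by
    ext x; simp
  rw [h, Finset.card_product, Nat.cast_mul, sq]
  have := card_link_le hD v
  gcongr

lemma card_filter_linkPairs_mul_le {r : ℝ} (Q : Finset V) :
    ((Finset.univ.filter fun v => r < (linkPairs T v Q).card).card : ℝ) * r
      ≤ ((Finset.univ.filter fun x : V × V × V => T x.1 x.2.1 x.2.2).filter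
          fun x => {x.2.1, x.2.2} ⊆ Q).card := by
  calc _ ≤ ∑ v ∈ Finset.univ.filter fun v => r < (linkPairs T v Q).card,
        ((linkPairs T v Q).card : ℝ) := by
        rw [← nsmul_eq_mul]
        exact Finset.card_nsmul_le_sum _ _ _ fun v hv => (Finset.mem_filter.1 hv).2.le
    _ ≤ ∑ v, ((linkPairs T v Q).card : ℝ) :=
        Finset.sum_le_sum_of_subset_of_nonneg (Finset.filter_subset _ _)
          fun _ _ _ => Nat.cast_nonneg _
    _ = _ := by
        rw [Finset.filter_filter, Finset.card_filter, Fintype.sum_prod_type, Nat.cast_sum]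
        refine Finset.sum_congr rfl fun v _ => ?_
        rw [← Finset.card_filter]
        congr 2
        ext x
        simp [linkPairs, Finset.insert_subset_iff, and_comm]

lemma ncard_not_isSpread_le (hT : IsTripleSystem T) (r : ℝ) (Q : Finset V) :
    ({v | ¬IsSpread T r Q v} : Set V).ncard
      ≤ (Finset.univ.filter fun v => {v} ⊆ Q).card
        + (Finset.univ.filter fun v => r < (linkPairs T v Q).card).card
        + ((Finset.univ.filter fun x : (V × V × V) × V => T x.1.1 x.1.2.1 x.1.2.2 ∧
            T x.1.2.1 x.1.2.2 x.2).filter fun x => {x.1.2.1, x.1.2.2, x.2} ⊆ Q).card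
        + (((Finset.univ.filter fun x : (V × V × V) × V => T x.1.1 x.1.2.1 x.1.2.2 ∧
            T x.1.1 x.1.2.2 x.2).filter fun x =>
              ({x.1.2.1, x.1.2.2, x.2} : Finset V).card = 3).filter fun x => {x.1.2.1, x.1.2.2, x.2} ⊆ Q).card
        + (((Finset.univ.filter fun x : (V × (V × V) × (V × V)) × V =>
            (T x.1.1 x.1.2.1.1 x.1.2.1.2 ∧ T x.1.1 x.1.2.2.1 x.1.2.2.2) ∧
              T x.1.2.1.1 x.1.2.2.1 x.2).filter fun x =>
              ({x.1.2.1.1, x.1.2.1.2, x.1.2.2.1, x.1.2.2.2, x.2} : Finset V).card = 5).filter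
                fun x => {x.1.2.1.1, x.1.2.1.2, x.1.2.2.1, x.1.2.2.2, x.2} ⊆ Q).card := by
  set A := Finset.univ.filter fun v => {v} ⊆ Q with hA
  set B := Finset.univ.filter fun v => r < (linkPairs T v Q).card with hB
  set C := (Finset.univ.filter fun x : (V × V × V) × V => T x.1.1 x.1.2.1 x.1.2.2 ∧
    T x.1.2.1 x.1.2.2 x.2).filter fun x => {x.1.2.1, x.1.2.2, x.2} ⊆ Q with hC
  set E := ((Finset.univ.filter fun x : (V × V × V) × V => T x.1.1 x.1.2.1 x.1.2.2 ∧
    T x.1.1 x.1.2.2 x.2).filter fun x => ({x.1.2.1, x.1.2.2, x.2} : Finset V).card = 3).filter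
      fun x => {x.1.2.1, x.1.2.2, x.2} ⊆ Q with hE
  set F := ((Finset.univ.filter fun x : (V × (V × V) × (V × V)) × V =>
    (T x.1.1 x.1.2.1.1 x.1.2.1.2 ∧ T x.1.1 x.1.2.2.1 x.1.2.2.2) ∧
      T x.1.2.1.1 x.1.2.2.1 x.2).filter fun x =>
      ({x.1.2.1.1, x.1.2.1.2, x.1.2.2.1, x.1.2.2.2, x.2} : Finset V).card = 5).filter
        fun x => {x.1.2.1.1, x.1.2.1.2, x.1.2.2.1, x.1.2.2.2, x.2} ⊆ Q with hF
  have hsub : ({v | ¬IsSpread T r Q v} : Set V) ⊆ ((A ∪ B ∪ C.image (fun x => x.1.1)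
      ∪ E.image (fun x => x.1.1) ∪ F.image (fun x => x.1.1) : Finset V) : Set V) := by
    intro v hv
    by_contra hcon
    simp only [Finset.coe_union, Set.mem_union, Finset.mem_coe, not_or] at hcon
    obtain ⟨⟨⟨⟨h1, h2⟩, h3⟩, h4⟩, h5⟩ := hcon
    refine hv ⟨fun h => h1 (by simpa [hA] using h), by simpa [hB] using h2, ?_⟩
    have hC0 : ∀ a ∈ Q, ∀ b ∈ Q, ∀ c ∈ Q, T v a b → ¬T a b c := by
      intro a ha b hb c hc hab habc
      refine h3 (Finset.mem_image.2 ⟨((v, a, b), c), ?_, rfl⟩)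
      simp [hC, hab, habc, Finset.insert_subset_iff, ha, hb, hc]
    intro a ha a' ha' b hb b' hb' c hc haa hbb habc
    have hab := hT.ne habc
    have hbc := hT.ne (hT.rotate habc)
    have hac := (hT.ne (hT.rotate (hT.rotate habc))).symm
    have haa' := hT.ne (hT.rotate haa)
    have hbb' := hT.ne (hT.rotate hbb)
    have hswap : ∀ {x y z}, T x y z → T x z y := fun h => hT.swap (hT.rotate (hT.rotate h))
    have n1 : a' ≠ b := fun h => hC0 a ha b hb c hc (h ▸ haa) habc
    have n2 : b' ≠ a := fun h => hC0 a ha b hb c hc (hswap (h ▸ hbb)) habc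
    have n3 : a' ≠ c := fun h => hC0 a ha c hc b hb (h ▸ haa) (hswap habc)
    have n4 : b' ≠ c := fun h => hC0 b hb c hc a ha (h ▸ hbb) (hT.rotate habc)
    have n5 : a' ≠ b' := by
      intro h
      refine h4 (Finset.mem_image.2 ⟨((v, a, a'), b), ?_, rfl⟩)
      have hcard : ({a, a', b} : Finset V).card = 3 := Finset.card_eq_three.2
        ⟨a, a', b, haa', hab, n1, rfl⟩
      simp only [hE, Finset.mem_filter, Finset.mem_univ, true_and]
      refine ⟨⟨⟨haa, hswap (h ▸ hbb)⟩, hcard⟩, ?_⟩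
      simp [Finset.insert_subset_iff, ha, ha', hb]
    refine h5 (Finset.mem_image.2 ⟨((v, (a, a'), (b, b')), c), ?_, rfl⟩)
    have hcard : ({a, a', b, b', c} : Finset V).card = 5 := by
      rw [Finset.card_insert_of_notMem, Finset.card_insert_of_notMem,
        Finset.card_insert_of_notMem, Finset.card_pair n4]
      · simp [hbb', hbc]
      · simp [n1, n5, n3]
      · simp [haa', hab, n2.symm, hac]
    simp only [hF, Finset.mem_filter, Finset.mem_univ, true_and]
    refine ⟨⟨⟨⟨haa, hbb⟩, habc⟩, hcard⟩, ?_⟩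
    simp [Finset.insert_subset_iff, ha, ha', hb, hb', hc]
  refine (Set.ncard_le_ncard hsub (Finset.finite_toSet _)).trans ?_
  rw [Set.ncard_coe_finset]
  refine (Finset.card_union_le _ _).trans (add_le_add ?_ Finset.card_image_le)
  refine (Finset.card_union_le _ _).trans (add_le_add ?_ Finset.card_image_le)
  refine (Finset.card_union_le _ _).trans (add_le_add ?_ Finset.card_image_le)
  exact Finset.card_union_le _ _

/-- The expected number of vertices that are not spread over a random set. -/
theorem sum_bernoulliWeight_mul_ncard_not_isSpread_le (hT : IsTripleSystem T) {r : ℝ} (hr : 0 < r)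
    (hℓ0 : 0 ≤ ℓ) (hℓ : ∀ x y, codegree T x y ≤ ℓ) (hD0 : 0 ≤ D)
    (hD : ∀ x, ∑ y, codegree T x y ≤ D) (h0 : 0 ≤ p) (h1 : p ≤ 1) :
    ∑ Q ∈ (Finset.univ : Finset V).powerset, bernoulliWeight p Finset.univ Q *
        ({v | ¬IsSpread T r Q v} : Set V).ncard
      ≤ Fintype.card V * (p + p ^ 2 * D / r + 2 * (p ^ 3 * D * ℓ) + p ^ 5 * D ^ 2 * ℓ) := by
  set n : ℝ := (Fintype.card V : ℝ) with hn
  set X1 : Finset V := Finset.univ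
  set X2 := Finset.univ.filter fun x : V × V × V => T x.1 x.2.1 x.2.2 with hX2
  set X3 := Finset.univ.filter fun x : (V × V × V) × V => T x.1.1 x.1.2.1 x.1.2.2 ∧
    T x.1.2.1 x.1.2.2 x.2 with hX3
  set X4 := (Finset.univ.filter fun x : (V × V × V) × V => T x.1.1 x.1.2.1 x.1.2.2 ∧
    T x.1.1 x.1.2.2 x.2).filter fun x => ({x.1.2.1, x.1.2.2, x.2} : Finset V).card = 3 with hX4
  set X5 := (Finset.univ.filter fun x : (V × (V × V) × (V × V)) × V =>
    (T x.1.1 x.1.2.1.1 x.1.2.1.2 ∧ T x.1.1 x.1.2.2.1 x.1.2.2.2) ∧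
      T x.1.2.1.1 x.1.2.2.1 x.2).filter fun x =>
      ({x.1.2.1.1, x.1.2.1.2, x.1.2.2.1, x.1.2.2.2, x.2} : Finset V).card = 5 with hX5
  have c1 : (X1.card : ℝ) ≤ n := by simp [hn, X1]
  have c2 : (X2.card : ℝ) ≤ n * D := card_edges_le hD
  have c3 : (X3.card : ℝ) ≤ n * D * ℓ :=
    (card_filter_extend_le hℓ (fun x : V × V × V => T x.1 x.2.1 x.2.2) (fun x => x.2.1)
      (fun x => x.2.2)).trans (mul_le_mul_of_nonneg_right c2 hℓ0)
  have c4 : (X4.card : ℝ) ≤ n * D * ℓ :=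
    (Nat.cast_le.2 (Finset.card_filter_le _ _)).trans
      ((card_filter_extend_le hℓ (fun x : V × V × V => T x.1 x.2.1 x.2.2) (fun x => x.1)
      (fun x => x.2.2)).trans (mul_le_mul_of_nonneg_right c2 hℓ0))
  have c5 : (X5.card : ℝ) ≤ n * D ^ 2 * ℓ :=
    (Nat.cast_le.2 (Finset.card_filter_le _ _)).trans
      ((card_filter_extend_le hℓ (fun x : V × (V × V) × (V × V) =>
        T x.1 x.2.1.1 x.2.1.2 ∧ T x.1 x.2.2.1 x.2.2.2) (fun x => x.2.1.1)
      (fun x => x.2.2.1)).trans (mul_le_mul_of_nonneg_right (card_edge_pairs_le hD0 hD) hℓ0))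
  have e1 := sum_bernoulliWeight_mul_card_filter_eq p X1 (fun v => {v}) (k := 1) (by simp)
  have e2 := sum_bernoulliWeight_mul_card_filter_eq p X2 (fun x => {x.2.1, x.2.2}) (k := 2)
    (fun x hx => Finset.card_pair (hT.ne (hT.rotate (Finset.mem_filter.1 hx).2)))
  have e3 := sum_bernoulliWeight_mul_card_filter_eq p X3 (fun x => {x.1.2.1, x.1.2.2, x.2})
    (k := 3) (fun x hx => by
      have h := (Finset.mem_filter.1 hx).2.2
      exact Finset.card_eq_three.2 ⟨_, _, _, hT.ne h, (hT.ne (hT.rotate (hT.rotate h))).symm,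
        hT.ne (hT.rotate h), rfl⟩)
  have e4 := sum_bernoulliWeight_mul_card_filter_eq p X4 (fun x => {x.1.2.1, x.1.2.2, x.2})
    (k := 3) (fun x hx => (Finset.mem_filter.1 hx).2)
  have e5 := sum_bernoulliWeight_mul_card_filter_eq p X5
    (fun x => {x.1.2.1.1, x.1.2.1.2, x.1.2.2.1, x.1.2.2.2, x.2})
    (k := 5) (fun x hx => (Finset.mem_filter.1 hx).2)
  calc _ ≤ ∑ Q ∈ (Finset.univ : Finset V).powerset, (
        bernoulliWeight p Finset.univ Q * ((X1.filter fun v => {v} ⊆ Q).card : ℝ)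
        + bernoulliWeight p Finset.univ Q *
            ((X2.filter fun x => {x.2.1, x.2.2} ⊆ Q).card : ℝ) / r
        + bernoulliWeight p Finset.univ Q *
            ((X3.filter fun x => {x.1.2.1, x.1.2.2, x.2} ⊆ Q).card : ℝ)
        + bernoulliWeight p Finset.univ Q *
            ((X4.filter fun x => {x.1.2.1, x.1.2.2, x.2} ⊆ Q).card : ℝ)
        + bernoulliWeight p Finset.univ Q * ((X5.filter fun x =>
            {x.1.2.1.1, x.1.2.1.2, x.1.2.2.1, x.1.2.2.2, x.2} ⊆ Q).card : ℝ)) := by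
        refine Finset.sum_le_sum fun Q _ => ?_
        rw [mul_div_assoc, ← mul_add, ← mul_add, ← mul_add, ← mul_add]
        refine mul_le_mul_of_nonneg_left ?_ (bernoulliWeight_nonneg h0 h1)
        have h2 : (({v | ¬IsSpread T r Q v} : Set V).ncard : ℝ) ≤ _ :=
          Nat.cast_le.2 (ncard_not_isSpread_le hT r Q)
        push_cast at h2
        have h3 := card_filter_linkPairs_mul_le (T := T) (r := r) Q
        rw [← le_div_iff₀ hr] at h3
        linarith
    _ = X1.card * p ^ 1 + X2.card * p ^ 2 / r + X3.card * p ^ 3 + X4.card * p ^ 3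
          + X5.card * p ^ 5 := by
        rw [Finset.sum_add_distrib, Finset.sum_add_distrib, Finset.sum_add_distrib,
          Finset.sum_add_distrib, ← Finset.sum_div, e1, e2, e3, e4, e5]
    _ ≤ n * p ^ 1 + n * D * p ^ 2 / r + n * D * ℓ * p ^ 3 + n * D * ℓ * p ^ 3
          + n * D ^ 2 * ℓ * p ^ 5 := by gcongr
    _ = _ := by ring

end RandomSubset

section IndependenceNumber

lemma expected_nonspread_ratio_le {x s M ℓ p D r : ℝ} (hx : 1000 ≤ x) (hxs : x ^ 10 ≤ s)
    (hℓ0 : 0 ≤ ℓ) (hℓ : ℓ * x ^ 10 ≤ s) (hM0 : 0 < M) (hM : M ≤ x) (hp : p = x / s)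
    (hD : D = M * s ^ 2) (hr : r = 8 * p ^ 2 * D) :
    p + p ^ 2 * D / r + 2 * (p ^ 3 * D * ℓ) + p ^ 5 * D ^ 2 * ℓ ≤ 1 / 2 := by
  have hx0 : 0 < x := by linarith
  have hs0 : 0 < s := lt_of_lt_of_le (by positivity) hxs
  have hp0 : 0 < p := by rw [hp]; positivity
  have hD0 : 0 < D := by rw [hD]; positivity
  have hfrac : ℓ / s ≤ 1 / x ^ 10 := by
    rw [div_le_div_iff₀ hs0 (by positivity), one_mul]; exact hℓ
  have hx1 : 1 / x ≤ 1 / 1000 := one_div_le_one_div_of_le (by norm_num) hx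
  have hp1 : p ≤ 1 / 1000 := by
    calc p = x / s := hp
      _ ≤ x / x ^ 10 := by gcongr
      _ = (1 / x) ^ 9 := by field_simp
      _ ≤ (1 / 1000) ^ 9 := by gcongr
      _ ≤ _ := by norm_num
  have h1 : p ^ 2 * D / r = 1 / 8 := by rw [hr]; field_simp
  have h2 : p ^ 3 * D * ℓ ≤ 1 / 1000 := by
    calc p ^ 3 * D * ℓ = x ^ 3 * M * (ℓ / s) := by rw [hp, hD]; field_simp
      _ ≤ x ^ 3 * x * (1 / x ^ 10) := by gcongr
      _ = (1 / x) ^ 6 := by field_simp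
      _ ≤ (1 / 1000) ^ 6 := by gcongr
      _ ≤ _ := by norm_num
  have h3 : p ^ 5 * D ^ 2 * ℓ ≤ 1 / 1000 := by
    calc p ^ 5 * D ^ 2 * ℓ = x ^ 5 * M ^ 2 * (ℓ / s) := by rw [hp, hD]; field_simp
      _ ≤ x ^ 5 * x ^ 2 * (1 / x ^ 10) := by gcongr
      _ = (1 / x) ^ 3 := by field_simp
      _ ≤ (1 / 1000) ^ 3 := by gcongr
      _ ≤ _ := by norm_num
  rw [h1]
  linarith

lemma tilt_le_log_two {x s M ℓ r δ L k β : ℝ} (hδ : 0 < δ) (hδx : 1000 / δ ≤ x) (hx : 1000 ≤ x)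
    (hs0 : 0 < s) (hℓ0 : 0 ≤ ℓ) (hℓ : ℓ * x ^ 10 ≤ s) (hM1 : 1 ≤ M) (hM : M ≤ x)
    (hr : r = 8 * x ^ 2 * M) (hL0 : 0 < L) (hL : δ * L ≤ x) (hk : δ / 32 * s ≤ k * M)
    (hβ : β = δ / 16 * L / (k * M)) : β * ℓ * (r ^ 2 + 2 * r) ≤ Real.log 2 := by
  have hx0 : 0 < x := by linarith
  have hM0 : 0 < M := by linarith
  have hkM : 0 < k * M := lt_of_lt_of_le (by positivity) hk
  have hβ2 : β ≤ 2 * L / s := by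
    rw [hβ]
    calc δ / 16 * L / (k * M) ≤ δ / 16 * L / (δ / 32 * s) := by gcongr
      _ = 2 * L / s := by field_simp; norm_num
  have hfrac : ℓ / s ≤ 1 / x ^ 10 := by
    rw [div_le_div_iff₀ hs0 (by positivity), one_mul]; exact hℓ
  have hr1 : 1 ≤ r := by
    rw [hr]
    have := one_le_pow₀ (n := 2) (show 1 ≤ x by linarith)
    nlinarith
  have hLx : L ≤ x / δ := by
    rw [le_div_iff₀ hδ, mul_comm]; exact hL
  have hquad : r ^ 2 + 2 * r ≤ 3 * r ^ 2 := by nlinarith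
  calc β * ℓ * (r ^ 2 + 2 * r) ≤ (2 * L / s) * ℓ * (3 * r ^ 2) := by gcongr
    _ = 384 * L * (ℓ / s) * x ^ 4 * M ^ 2 := by rw [hr]; ring
    _ ≤ 384 * (x / δ) * (1 / x ^ 10) * x ^ 4 * x ^ 2 := by gcongr
    _ = 384 / δ * (1 / x) ^ 3 := by field_simp
    _ ≤ 1000 / δ * (1 / x) ^ 3 := by gcongr; norm_num
    _ ≤ x * (1 / x) ^ 3 := by gcongr
    _ = (1 / x) ^ 2 := by field_simp
    _ ≤ (1 / 1000) ^ 2 := by gcongr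
    _ ≤ Real.log 2 := by linarith [Real.log_two_gt_d9]

lemma exponent_le {n M δ k K β : ℝ} (hδ : 0 < δ) (hn : 3 ≤ n) (hM : 0 < M) (hk : 0 < k)
    (hKk : K ≤ k) (hk2 : k ^ 2 * M = (δ / 32) ^ 2 * n * Real.log n)
    (hβ : β = δ / 16 * Real.log n / (k * M)) :
    4 * β * K * (M * n) / n + 8 * K * Real.log (n + 1) / (β * n) ≤ δ * Real.log n / 2 := by
  have hn0 : 0 < n := by linarith
  have hL0 : 0 < Real.log n := Real.log_pos (by linarith)
  have hL1 : 0 ≤ Real.log (n + 1) := Real.log_nonneg (by linarith)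
  have hL : Real.log (n + 1) ≤ 2 * Real.log n := by
    rw [← Real.log_rpow hn0]
    refine Real.log_le_log (by linarith) ?_
    norm_cast
    nlinarith
  generalize Real.log (n + 1) = L' at *
  generalize Real.log n = L at *
  have hβ0 : 0 < β := by rw [hβ]; positivity
  have h1 : 4 * β * K * (M * n) / n ≤ δ * L / 4 := by
    calc 4 * β * K * (M * n) / n = 4 * β * K * M := by field_simp
      _ ≤ 4 * β * k * M := by gcongr
      _ = δ * L / 4 := by rw [hβ]; field_simp; norm_num
  have h3 : 8 * K * L' / (β * n) ≤ δ * L / 4 := by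
    rw [div_le_iff₀ (by positivity)]
    calc 8 * K * L' ≤ 8 * k * (2 * L) := by gcongr
      _ = 16 * L * (k ^ 2 * M) / (k * M) := by field_simp; norm_num
      _ = δ * L / 4 * (β * n) := by rw [hk2, hβ]; field_simp; norm_num
  linarith

variable {V : Type*} [Fintype V] [DecidableEq V] {T : V → V → V → Prop}
  [∀ x y z, Decidable (T x y z)]

set_option maxHeartbeats 800000 in
/-- A triple system on `n` vertices with bounded codegrees and degrees at most `M * n` has an
independent set whose size exceeds the bound `√(n / M)` by a factor of order `√(log n)`. -/
theorem exists_isIndep_card_ge (hT : IsTripleSystem T) {δ M ℓ : ℝ} (hδ : 0 < δ) (hδ1 : δ ≤ 1 / 20)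
    (hV : 1000 / δ ≤ (Fintype.card V : ℝ) ^ δ) (hM1 : 1 ≤ M)
    (hM : M ≤ (Fintype.card V : ℝ) ^ δ) (hℓ0 : 0 ≤ ℓ)
    (hℓ : ℓ ≤ (Fintype.card V : ℝ) ^ (1 / 2 - 10 * δ)) (hcodeg : ∀ x y, codegree T x y ≤ ℓ)
    (hdeg : ∀ x, ∑ y, codegree T x y ≤ M * Fintype.card V) :
    ∃ I, IsIndep T I ∧
      δ / 32 * √(Fintype.card V * Real.log (Fintype.card V) / M) ≤ I.card := by
  by_contra! hcon
  obtain ⟨n, hn⟩ : ∃ n : ℝ, n = Fintype.card V := ⟨_, rfl⟩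
  rw [← hn] at hV hM hℓ hdeg hcon
  obtain ⟨x, hx⟩ : ∃ x, x = n ^ δ := ⟨_, rfl⟩
  rw [← hx] at hV hM
  have hx1000 : 1000 ≤ x := by
    refine le_trans ?_ hV
    rw [le_div_iff₀ hδ]; linarith
  have hn0 : 0 ≤ n := hn ▸ Nat.cast_nonneg _
  have hn1000 : 1000 ≤ n := by
    by_contra! h
    have h1 : x ≤ 1000 ^ δ := hx ▸ Real.rpow_le_rpow hn0 h.le hδ.le
    have h2 : (1000 : ℝ) ^ δ < 1000 ^ (1 : ℝ) :=
      Real.rpow_lt_rpow_of_exponent_lt (by norm_num) (by linarith)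
    rw [Real.rpow_one] at h2
    linarith
  have hnpos : 0 < n := by linarith
  have hx0 : 0 < x := by linarith
  have hexpx : x = Real.exp (δ * Real.log n) := by
    rw [hx, Real.rpow_def_of_pos hnpos, mul_comm δ]
  have hL1 : 1 ≤ Real.log n := by
    rw [Real.le_log_iff_exp_le hnpos]
    linarith [Real.exp_one_lt_d9]
  have hL0 : 0 < Real.log n := by linarith
  have hLx : δ * Real.log n ≤ x := by
    rw [hexpx]
    linarith [Real.add_one_le_exp (δ * Real.log n)]
  obtain ⟨s, hs⟩ : ∃ s, s = √n := ⟨_, rfl⟩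
  have hs2 : s ^ 2 = n := hs ▸ Real.sq_sqrt hn0
  have hs0 : 0 < s := hs ▸ Real.sqrt_pos.2 hnpos
  have hpow : x ^ 10 * n ^ (1 / 2 - 10 * δ) = s := by
    rw [hx, ← Real.rpow_natCast, ← Real.rpow_mul hn0, ← Real.rpow_add hnpos, hs,
      Real.sqrt_eq_rpow]
    congr 1
    push_cast
    ring
  have hℓs : ℓ * x ^ 10 ≤ s := by
    rw [← hpow, mul_comm]
    gcongr
  have hxs : x ^ 10 ≤ s := by
    rw [← hpow]
    refine le_mul_of_one_le_right (by positivity) ?_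
    exact Real.one_le_rpow (by linarith) (by linarith)
  have hM0 : 0 < M := by linarith
  obtain ⟨k, hk⟩ : ∃ k, k = δ / 32 * √(n * Real.log n / M) := ⟨_, rfl⟩
  simp only [← hk] at hcon
  have hk0 : 0 < k := by rw [hk]; positivity
  have hk2 : k ^ 2 * M = (δ / 32) ^ 2 * n * Real.log n := by
    rw [hk, mul_pow, Real.sq_sqrt (by positivity)]
    field_simp
  have hkle : k ≤ δ / 32 * s * √(Real.log n) := by
    rw [hk, mul_assoc, hs, ← Real.sqrt_mul hn0]
    gcongr
    exact div_le_self (by positivity) hM1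
  have hkge : δ / 32 * s ≤ k * M := by
    refine le_of_sq_le_sq ?_ (by positivity)
    calc (δ / 32 * s) ^ 2 = (δ / 32) ^ 2 * n * 1 * 1 := by rw [mul_pow, hs2]; ring
      _ ≤ (δ / 32) ^ 2 * n * Real.log n * M := by gcongr
      _ = (k * M) ^ 2 := by rw [← hk2]; ring
  have hKI : ∀ I, IsIndep T I → I.card ≤ ⌊k⌋₊ := fun I hI => Nat.le_floor (hcon I hI).le
  have hKk : (⌊k⌋₊ : ℝ) ≤ k := Nat.floor_le hk0.le
  generalize ⌊k⌋₊ = K at hKI hKk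
  obtain ⟨p, hp⟩ : ∃ p, p = x / s := ⟨_, rfl⟩
  have hp0 : 0 < p := by rw [hp]; positivity
  have hp1 : p ≤ 1 := by
    rw [hp, div_le_one hs0]
    exact (le_self_pow₀ (by linarith) (by norm_num)).trans hxs
  obtain ⟨r, hr⟩ : ∃ r, r = 8 * p ^ 2 * (M * n) := ⟨_, rfl⟩
  have hr0 : 0 < r := by rw [hr]; positivity
  obtain ⟨β, hβ⟩ : ∃ β, β = δ / 16 * Real.log n / (k * M) := ⟨_, rfl⟩
  have hβ0 : 0 < β := by rw [hβ]; positivity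
  have hbad := sum_bernoulliWeight_mul_ncard_not_isSpread_le hT hr0 hℓ0 hcodeg
    (by positivity) hdeg hp0.le hp1
  have hsmall := expected_nonspread_ratio_le hx1000 hxs hℓ0 hℓs hM0 hM hp (by rw [hs2]) hr
  have hrx : r = 8 * x ^ 2 * M := by rw [hr, hp, ← hs2]; field_simp
  have hβκ := tilt_le_log_two hδ hV hx1000 hs0 hℓ0 hℓs hM1 hM hrx hL0 hLx hkge hβ
  have hbad' := hbad.trans (mul_le_mul_of_nonneg_left hsmall (Nat.cast_nonneg _))
  rw [mul_one_div] at hbad'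
  have hmain := card_mul_exp_le_of_isSpread hT hKI hβ0 (Real.exp_log two_pos).le hr0.le hℓ0
    hcodeg hβκ (by positivity) hdeg hp0 hp1 hbad' (by rw [hn] at hnpos; exact_mod_cast hnpos)
  rw [← hn] at hmain
  have hexp := exponent_le hδ (by linarith) hM0 hk0 hKk hk2 hβ
  obtain ⟨y, hy⟩ : ∃ y, y = Real.exp (δ * Real.log n / 2) := ⟨_, rfl⟩
  have hy0 : 0 < y := hy ▸ Real.exp_pos _
  have hxy : x = y ^ 2 := by
    rw [hexpx, hy, ← Real.exp_nat_mul]; congr 1; push_cast; ring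
  have h1 : s * y ≤ 8 * (δ / 32 * s * √(Real.log n)) := by
    calc s * y = n * p * Real.exp (-(δ * Real.log n / 2)) := by
          rw [Real.exp_neg, ← hy, hp, hxy, ← hs2]; field_simp
      _ ≤ n * p * Real.exp (-(4 * β * K * (M * n) / n
            + 8 * K * Real.log (n + 1) / (β * n))) := by gcongr
      _ ≤ 8 * K := hmain
      _ ≤ 8 * (δ / 32 * s * √(Real.log n)) := by linarith
  have h2 : y ≤ δ / 4 * √(Real.log n) := by
    refine le_of_mul_le_mul_left ?_ hs0
    linarith
  have h3 : y ^ 2 ≤ (δ / 4 * √(Real.log n)) ^ 2 := by gcongr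
  rw [← hxy, mul_pow, Real.sq_sqrt hL0.le] at h3
  have h4 : 1 + δ * Real.log n ≤ x := by
    rw [hexpx, add_comm]
    exact Real.add_one_le_exp _
  nlinarith [mul_pos hδ hL0]

end IndependenceNumber

section PointSets

lemma card_le_mul_of_sum_le {α : Type*} {P : Finset α} {f : α → ℝ} {a : ℝ}
    (hf : ∀ x ∈ P, 0 ≤ f x) (ha : 0 < a) (h : ∑ x ∈ P, f x ≤ a * P.card) :
    (P.card : ℝ) ≤ 2 * (P.filter fun x => f x ≤ 2 * a).card := by
  have h1 : ((P.filter fun x => ¬f x ≤ 2 * a).card : ℝ) * (2 * a) ≤ a * P.card := by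
    refine le_trans ?_ (le_trans (Finset.sum_le_sum_of_subset_of_nonneg
      (Finset.filter_subset (fun x => ¬f x ≤ 2 * a) P) fun x hx _ => hf x hx) h)
    rw [← nsmul_eq_mul]
    exact Finset.card_nsmul_le_sum _ _ _ fun x hx => (not_le.1 (Finset.mem_filter.1 hx).2).le
  have h2 : (P.card : ℝ) = (P.filter fun x => f x ≤ 2 * a).card
      + (P.filter fun x => ¬f x ≤ 2 * a).card := by
    rw [← Nat.cast_add, Finset.card_filter_add_card_filter_not]
  nlinarith

lemma CollinearTriple.isTripleSystem (P : Finset (ℝ × ℝ)) :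
    IsTripleSystem fun x y z : P => CollinearTriple (x : ℝ × ℝ) y z where
  swap := fun ⟨h1, h2, h3, h4⟩ => ⟨h1.symm, h3, h2, by rwa [Set.insert_comm]⟩
  rotate := fun ⟨h1, h2, h3, h4⟩ => ⟨h3, h1.symm, h2.symm, by
    rwa [Set.pair_comm, Set.insert_comm]⟩
  ne := fun h heq => h.1 (congrArg _ heq)

lemma AtMostCollinear.tripleCount_le {P : Finset (ℝ × ℝ)} {ℓ : ℕ} (hP : AtMostCollinear P ℓ)
    (x y : ℝ × ℝ) : tripleCount P x y ≤ ℓ := by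
  classical
  by_cases hxy : x = y
  · simp [tripleCount, CollinearTriple, hxy]
  · refine hP _ (Finset.filter_subset _ _) (collinear_of_forall_det hxy fun z hz => ?_)
    exact (collinear_triple_iff_det hxy).1 (Finset.mem_filter.1 hz).2.2.2.2

lemma codegree_collinearTriple_le {P Q : Finset (ℝ × ℝ)} (hQ : Q ⊆ P) (x y : Q)
    [∀ x y z : Q, Decidable (CollinearTriple (x : ℝ × ℝ) y z)] :
    codegree (fun x y z : Q => CollinearTriple (x : ℝ × ℝ) y z) x y ≤ tripleCount P x y := by
  classical
  rw [codegree, tripleCount, Nat.cast_le, ← Finset.card_map (Function.Embedding.subtype _)]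
  refine Finset.card_le_card fun z hz => ?_
  obtain ⟨w, hw, rfl⟩ := Finset.mem_map.1 hz
  exact Finset.mem_filter.2 ⟨hQ w.2, (Finset.mem_filter.1 hw).2⟩

lemma generalPosition_map_subtype {P : Finset (ℝ × ℝ)} {I : Finset P}
    (hI : IsIndep (fun x y z : P => CollinearTriple (x : ℝ × ℝ) y z) I) :
    GeneralPosition (I.map (Function.Embedding.subtype _)) := by
  intro T hT hcol
  by_contra! h
  obtain ⟨a, b, c, ha, hb, hc, hab, hac, hbc⟩ := Finset.two_lt_card_iff.1 h
  obtain ⟨a, haI, rfl⟩ := Finset.mem_map.1 (hT ha)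
  obtain ⟨b, hbI, rfl⟩ := Finset.mem_map.1 (hT hb)
  obtain ⟨c, hcI, rfl⟩ := Finset.mem_map.1 (hT hc)
  refine hI a haI b hbI c hcI ⟨hab, hac, hbc, hcol.subset ?_⟩
  rintro z (rfl | rfl | rfl)
  exacts [ha, hb, hc]

lemma one_le_log_of_three_le {ℓ : ℕ} (hℓ : 3 ≤ ℓ) : 1 ≤ Real.log ℓ := by
  have h : (3 : ℝ) ≤ ℓ := by exact_mod_cast hℓ
  rw [Real.le_log_iff_exp_le (by linarith)]
  linarith [Real.exp_one_lt_d9]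

/-- The quantitative core of the theorem, for point sets large in terms of the exponent `δ`. -/
lemma AtMostCollinear.exists_generalPosition {P : Finset (ℝ × ℝ)} {ℓ : ℕ}
    (hP : AtMostCollinear P ℓ) (hℓ3 : 3 ≤ ℓ) {δ : ℝ} (hδ : 0 < δ) (hδ1 : δ ≤ 1 / 20)
    (hn : 4 ≤ P.card) (hnδ : 1000 / δ ≤ ((P.card : ℝ) / 2) ^ δ)
    (hnl : 1728 * Real.log P.card ≤ ((P.card : ℝ) / 2) ^ δ)
    (hℓ : ℓ ≤ ((P.card : ℝ) / 2) ^ (1 / 2 - 10 * δ)) :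
    ∃ S ⊆ P, GeneralPosition S ∧
      δ / 2688 * √(P.card * Real.log P.card / Real.log ℓ) ≤ S.card := by
  classical
  obtain ⟨n, hn'⟩ : ∃ n : ℝ, n = P.card := ⟨_, rfl⟩
  rw [← hn'] at hnδ hnl hℓ ⊢
  have hn4 : 4 ≤ n := by rw [hn']; exact_mod_cast hn
  have hL1 := one_le_log_of_three_le hℓ3
  have hexp : 0 ≤ 1 / 2 - 10 * δ := by linarith
  have hℓs : (ℓ : ℝ) ≤ √n := by
    refine hℓ.trans ?_
    rw [Real.sqrt_eq_rpow]
    calc (n / 2) ^ (1 / 2 - 10 * δ) ≤ n ^ (1 / 2 - 10 * δ) := by gcongr; linarith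
      _ ≤ n ^ (1 / 2 : ℝ) := by gcongr <;> linarith
  have hℓ2 : (ℓ : ℝ) ^ 2 ≤ n := (Real.le_sqrt (by positivity) (by linarith)).1 hℓs
  have hLn : Real.log ℓ ≤ Real.log n := by
    refine Real.log_le_log (by positivity) ?_
    have : (3 : ℝ) ≤ ℓ := by exact_mod_cast hℓ3
    nlinarith
  have hsum := sum_tripleCount_le hP (by rw [hn'] at hℓ2; exact_mod_cast hℓ2)
  rw [← hn'] at hsum
  set Q := P.filter fun x => ∑ y ∈ P, (tripleCount P x y : ℝ) ≤ 2 * (432 * n * Real.log ℓ)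
  have hQP : Q ⊆ P := Finset.filter_subset _ _
  have hPQ : n ≤ 2 * Q.card := by
    rw [hn']
    refine card_le_mul_of_sum_le (fun x _ => by positivity) (by positivity) ?_
    rw [← hn']
    nlinarith [sq_nonneg n]
  have hQ2 : n / 2 ≤ Q.card := by linarith
  have hn2 : 0 ≤ n / 2 := by linarith
  have hcard : (Fintype.card Q : ℝ) = Q.card := by rw [Fintype.card_coe]
  have hδQ : (n / 2) ^ δ ≤ (Q.card : ℝ) ^ δ := by gcongr
  obtain ⟨I, hI, hIcard⟩ := exists_isIndep_card_ge (CollinearTriple.isTripleSystem Q) hδ hδ1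
    (M := 1728 * Real.log ℓ) (ℓ := ℓ) (by rw [hcard]; exact hnδ.trans hδQ) (by linarith)
    (by rw [hcard]; linarith) (Nat.cast_nonneg _)
    (by rw [hcard]; exact hℓ.trans (by gcongr))
    (fun x y => (codegree_collinearTriple_le hQP x y).trans
      (by exact_mod_cast hP.tripleCount_le x y))
    (fun x => by
      calc _ ≤ ∑ y : Q, (tripleCount P x y : ℝ) :=
            Finset.sum_le_sum fun y _ => codegree_collinearTriple_le hQP x y
        _ = ∑ y ∈ Q, (tripleCount P x y : ℝ) :=
            Finset.sum_coe_sort Q fun y => (tripleCount P x y : ℝ)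
        _ ≤ ∑ y ∈ P, (tripleCount P x y : ℝ) :=
            Finset.sum_le_sum_of_subset_of_nonneg hQP fun _ _ _ => Nat.cast_nonneg _
        _ ≤ 2 * (432 * n * Real.log ℓ) := (Finset.mem_filter.1 x.2).2
        _ = 1728 * Real.log ℓ * (n / 2) := by ring
        _ ≤ _ := by rw [hcard]; gcongr)
  refine ⟨I.map (Function.Embedding.subtype _), ?_, generalPosition_map_subtype hI, ?_⟩
  · intro z hz
    obtain ⟨w, -, rfl⟩ := Finset.mem_map.1 hz
    exact hQP w.2
  · rw [Finset.card_map]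
    refine le_trans ?_ hIcard
    rw [hcard]
    have hlog : Real.log n / 2 ≤ Real.log Q.card := by
      calc Real.log n / 2 = Real.log √n := (Real.log_sqrt (by linarith)).symm
        _ ≤ Real.log (n / 2) := by
            refine Real.log_le_log (by positivity) ?_
            rw [Real.sqrt_le_left (by linarith)]
            nlinarith
        _ ≤ _ := Real.log_le_log (by linarith) hQ2
    have hlog0 : 0 ≤ Real.log n := Real.log_nonneg (by linarith)
    calc δ / 2688 * √(n * Real.log n / Real.log ℓ)
        = δ / 32 * (√(n * Real.log n / Real.log ℓ) / 84) := by ring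
      _ ≤ δ / 32 * √(Q.card * Real.log Q.card / (1728 * Real.log ℓ)) := by
          gcongr
          refine Real.le_sqrt_of_sq_le ?_
          rw [div_pow, Real.sq_sqrt (by positivity)]
          calc n * Real.log n / Real.log ℓ / 84 ^ 2
              ≤ n * Real.log n / Real.log ℓ / 6912 := by gcongr; norm_num
            _ = n / 2 * (Real.log n / 2) / (1728 * Real.log ℓ) := by field_simp; ring
            _ ≤ _ := by gcongr

lemma eventually_growth {d δ : ℝ} (hd : 0 < d) (hδ : 0 < δ) :
    ∀ᶠ n : ℝ in Filter.atTop, 4 ≤ n ∧ 1 ≤ d * n ∧ 1000 / δ ≤ (n / 2) ^ δ ∧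
      1728 * Real.log n ≤ (n / 2) ^ δ ∧
      (d * n) ^ (1 / 2 - 20 * δ) ≤ (n / 2) ^ (1 / 2 - 10 * δ) := by
  have hhalf : Filter.Tendsto (fun n : ℝ => n / 2) Filter.atTop Filter.atTop :=
    Filter.tendsto_id.atTop_div_const two_pos
  have hpow := (tendsto_rpow_atTop hδ).comp hhalf
  have hpow10 := (tendsto_rpow_atTop (show 0 < 10 * δ by positivity)).comp hhalf
  have hlog := (isLittleO_log_rpow_atTop hδ).bound
    (show 0 < 1 / (1728 * 2 ^ δ : ℝ) by positivity)
  filter_upwards [Filter.eventually_ge_atTop 4, Filter.eventually_ge_atTop (1 / d),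
    hpow.eventually_ge_atTop (1000 / δ), hpow10.eventually_ge_atTop
      ((2 * d) ^ (1 / 2 - 20 * δ)), hlog] with n h4 hdn h1 h10 hl
  have hn0 : 0 < n := by linarith
  refine ⟨h4, ?_, h1, ?_, ?_⟩
  · rwa [div_le_iff₀' hd] at hdn
  · rw [Real.norm_eq_abs, Real.norm_eq_abs, abs_of_nonneg (Real.log_nonneg (by linarith)),
      abs_of_nonneg (by positivity)] at hl
    rw [Real.div_rpow hn0.le zero_le_two]
    calc 1728 * Real.log n ≤ 1728 * (1 / (1728 * 2 ^ δ) * n ^ δ) := by gcongr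
      _ = n ^ δ / 2 ^ δ := by field_simp
  · calc (d * n) ^ (1 / 2 - 20 * δ) = (2 * d) ^ (1 / 2 - 20 * δ) * (n / 2) ^ (1 / 2 - 20 * δ) := by
          rw [← Real.mul_rpow (by positivity) (by positivity)]
          congr 1
          ring
      _ ≤ (n / 2) ^ (10 * δ) * (n / 2) ^ (1 / 2 - 20 * δ) := by
          gcongr
          exact h10
      _ = _ := by
          rw [← Real.rpow_add (by positivity)]
          congr 1
          ring

lemma generalPosition_singleton (p : ℝ × ℝ) : GeneralPosition {p} := fun T hT _ =>
  (Finset.card_le_card hT).trans (by simp)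

end PointSets

/-- For all `ε > 0` and `d > 0` there is `c > 0` such that every set of `n` points in the
plane with at most `ℓ` collinear, where `3 ≤ ℓ ≤ (d·n)^((1−ε)/2)`, contains at least
`c·√(n·log n / log ℓ)` points in general position. -/
theorem general_position_subset_sqrt_n_log_n_over_log_l :
    ∀ ε d : ℝ, 0 < ε → 0 < d →
    ∃ c : ℝ, 0 < c ∧
      ∀ (n ℓ : ℕ) (P : Finset (ℝ × ℝ)),
        3 ≤ ℓ → (ℓ : ℝ) ≤ (d * n) ^ ((1 - ε) / 2) → P.card = n →
        AtMostCollinear P ℓ →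
        ∃ S ⊆ P, GeneralPosition S ∧
          c * Real.sqrt ((n : ℝ) * Real.log n / Real.log ℓ) ≤ S.card := by
  intro ε d hε hd
  obtain ⟨δ, hδ⟩ : ∃ δ, δ = min ε (1 / 2) / 40 := ⟨_, rfl⟩
  have hδ0 : 0 < δ := by rw [hδ]; positivity
  have hδε : 40 * δ ≤ ε := by linarith [min_le_left ε (1 / 2)]
  have hδ1 : 80 * δ ≤ 1 := by linarith [min_le_right ε (1 / 2)]
  obtain ⟨n₀, hn₀⟩ := Filter.eventually_atTop.1 (eventually_growth hd hδ0)
  have hN0 : 0 < |n₀| + 1 := by positivity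
  refine ⟨min (δ / 2688) (1 / (|n₀| + 1)), by positivity, ?_⟩
  rintro n ℓ P hℓ3 hℓ rfl hP
  have hL1 := one_le_log_of_three_le hℓ3
  by_cases hlarge : n₀ ≤ P.card
  · obtain ⟨h4, hdn, h1, h2, h3⟩ := hn₀ _ hlarge
    obtain ⟨S, hSP, hS, hcard⟩ := hP.exists_generalPosition hℓ3 hδ0 (by linarith)
      (by exact_mod_cast h4) h1 h2
      ((hℓ.trans (Real.rpow_le_rpow_of_exponent_le hdn (by linarith))).trans h3)
    refine ⟨S, hSP, hS, le_trans ?_ hcard⟩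
    gcongr
    exact min_le_left _ _
  · rcases P.eq_empty_or_nonempty with rfl | ⟨p, hp⟩
    · exact ⟨∅, subset_rfl, by simp [GeneralPosition], by simp⟩
    · refine ⟨{p}, Finset.singleton_subset_iff.2 hp, generalPosition_singleton p, ?_⟩
      have hn0 : (0 : ℝ) < P.card := by exact_mod_cast Finset.card_pos.2 ⟨p, hp⟩
      have hroot : √(P.card * Real.log P.card / Real.log ℓ) ≤ |n₀| + 1 := by
        rw [Real.sqrt_le_left hN0.le]
        have hlog0 : 0 ≤ Real.log P.card := Real.log_natCast_nonneg _
        have hn1 : (P.card : ℝ) ≤ |n₀| + 1 := by linarith [le_abs_self n₀, not_le.1 hlarge]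
        calc P.card * Real.log P.card / Real.log ℓ ≤ P.card * Real.log P.card :=
              div_le_self (by positivity) hL1
          _ ≤ P.card * P.card := by
              gcongr
              linarith [Real.log_le_sub_one_of_pos hn0]
          _ ≤ _ := by nlinarith
      calc _ ≤ 1 / (|n₀| + 1) * (|n₀| + 1) := by
            gcongr
            exact min_le_right _ _
        _ = (({p} : Finset (ℝ × ℝ)).card : ℝ) := by
            rw [Finset.card_singleton]
            field_simp
            norm_num
end

section
/- There exists an absolute constant c > 0 such that the following holds. Let k ≥ 4 and ℓ ≥ 3 be integers and let P be a set of n points in the plane ℝ² with at most ℓ collinear. Then the number of k-element collinear subsets of P is at most c·(ℓ^(k−3)·n² + ℓ^(k−1)·n). -/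
open scoped Classical

/-- The height at abscissa `t` of the line through the endpoints of the edge `e`. -/
noncomputable def edgeHeight {ι : Type*} (x y : ι → ℝ) (e : ι × ι) (t : ℝ) : ℝ :=
  y e.1 + (y e.2 - y e.1) / (x e.2 - x e.1) * (t - x e.1)

/-- Two distinct edges cross if they share a point lying over the interior of both of their
projections to the first axis. -/
def EdgesCross {ι : Type*} (x y : ι → ℝ) (e f : ι × ι) : Prop :=
  e ≠ f ∧ ∃ t, x e.1 < t ∧ t < x e.2 ∧ x f.1 < t ∧ t < x f.2 ∧
    edgeHeight x y e t = edgeHeight x y f t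

/-- A geometric graph whose edges are directed from left to right and contain no vertex in
their interior. -/
structure IsGeometricGraph {ι : Type*} (x y : ι → ℝ) (S : Finset ι) (E : Finset (ι × ι)) :
    Prop where
  fst_mem : ∀ e ∈ E, e.1 ∈ S
  snd_mem : ∀ e ∈ E, e.2 ∈ S
  lt : ∀ e ∈ E, x e.1 < x e.2
  ne_height : ∀ e ∈ E, ∀ w ∈ S, x e.1 < x w → x w < x e.2 → edgeHeight x y e (x w) ≠ y w

section
variable {ι : Type*} {x y : ι → ℝ}

lemma edgeHeight_fst (e : ι × ι) : edgeHeight x y e (x e.1) = y e.1 := by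
  simp [edgeHeight]

lemma edgeHeight_snd {e : ι × ι} (h : x e.1 < x e.2) : edgeHeight x y e (x e.2) = y e.2 := by
  have : x e.2 - x e.1 ≠ 0 := by linarith
  unfold edgeHeight
  field_simp
  ring

lemma exists_edgeHeight_eq {e f : ι × ι} {s t : ℝ} (hst : s < t)
    (hs : edgeHeight x y e s < edgeHeight x y f s)
    (ht : edgeHeight x y f t < edgeHeight x y e t) :
    ∃ r, s < r ∧ r < t ∧ edgeHeight x y e r = edgeHeight x y f r := by
  have hc : ContinuousOn (fun r => edgeHeight x y e r - edgeHeight x y f r) (Set.Icc s t) := by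
    unfold edgeHeight
    fun_prop
  obtain ⟨r, hr, hr0⟩ := intermediate_value_Ioo hst.le hc
    (show (0 : ℝ) ∈ Set.Ioo _ _ from ⟨by simpa using hs, by simpa using ht⟩)
  exact ⟨r, hr.1, hr.2, sub_eq_zero.1 hr0⟩

lemma false_of_not_edgesCross {e f : ι × ι} (hc : ¬ EdgesCross x y e f) (hne : e ≠ f) {s t : ℝ}
    (hst : s < t) (hes : x e.1 ≤ s) (hfs : x f.1 ≤ s) (het : t ≤ x e.2) (hft : t ≤ x f.2)
    (hs : edgeHeight x y e s < edgeHeight x y f s)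
    (ht : edgeHeight x y f t < edgeHeight x y e t) : False := by
  obtain ⟨r, h1, h2, h3⟩ := exists_edgeHeight_eq hst hs ht
  exact hc ⟨hne, r, by linarith, by linarith, by linarith, by linarith, h3⟩

/-- The slope of an edge. -/
noncomputable def edgeSlope (x y : ι → ℝ) (e : ι × ι) : ℝ := (y e.2 - y e.1) / (x e.2 - x e.1)

lemma edgeHeight_lt_iff {e f : ι × ι} (h : e.1 = f.1) {t : ℝ} (ht : x e.1 < t) :
    edgeHeight x y e t < edgeHeight x y f t ↔ edgeSlope x y e < edgeSlope x y f := by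
  unfold edgeHeight edgeSlope
  rw [h] at ht ⊢
  rw [add_lt_add_iff_left, mul_lt_mul_iff_left₀ (by linarith)]

lemma IsGeometricGraph.eq_of_edgeSlope_eq (hx : Function.Injective x) {S : Finset ι}
    {E : Finset (ι × ι)} (hG : IsGeometricGraph x y S E)
    {e f : ι × ι} (he : e ∈ E) (hf : f ∈ E) (h1 : e.1 = f.1)
    (h : edgeSlope x y e = edgeSlope x y f) : e = f := by
  have hh : ∀ t, edgeHeight x y e t = edgeHeight x y f t := by
    intro t
    unfold edgeHeight
    unfold edgeSlope at h
    rw [h, h1]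
  have le := hG.lt e he
  have lf := hG.lt f hf
  rcases lt_trichotomy (x e.2) (x f.2) with h2 | h2 | h2
  · refine absurd ?_ (hG.ne_height f hf e.2 (hG.snd_mem e he) (h1 ▸ le) h2)
    rw [← hh, edgeHeight_snd le]
  · exact Prod.ext h1 (hx h2)
  · refine absurd ?_ (hG.ne_height e he f.2 (hG.snd_mem f hf) (h1 ▸ lf) h2)
    rw [hh, edgeHeight_snd lf]

/-- If `e`, `e'` are consecutive edges leaving a vertex and the wedge between them contains no
vertex to the left of `w`, then no edge runs inside the wedge just to the left of `w`. -/
lemma IsGeometricGraph.false_of_edge_in_wedge (hx : Function.Injective x) {S : Finset ι}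
    {E : Finset (ι × ι)} (hG : IsGeometricGraph x y S E)
    (hC : ∀ e ∈ E, ∀ f ∈ E, ¬ EdgesCross x y e f)
    {e e' f : ι × ι} (he : e ∈ E) (he' : e' ∈ E) (hf : f ∈ E) (h1 : e.1 = e'.1)
    (hcons : ∀ g ∈ E, g.1 = e.1 → edgeSlope x y e < edgeSlope x y g →
      edgeSlope x y e' ≤ edgeSlope x y g)
    {w : ι} (hw2 : x w ≤ x e.2) (hw3 : x w ≤ x e'.2)
    (hemp : ∀ z ∈ S, x e.1 < x z → x z < x w → edgeHeight x y e (x z) < y z →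
      ¬ y z < edgeHeight x y e' (x z))
    (hf2 : x w ≤ x f.2) {s : ℝ} (hs1 : x e.1 < s) (hs2 : x f.1 < s)
    (hsw : s < x w) (hes : edgeHeight x y e s < edgeHeight x y f s)
    (hfw : edgeHeight x y f (x w) < edgeHeight x y e' (x w)) : False := by
  have hef : e ≠ f := by rintro rfl; exact lt_irrefl _ hes
  have hef' : f ≠ e' := by rintro rfl; exact lt_irrefl _ hfw
  have le := hG.lt e he
  have le' := hG.lt e' he'
  have lf := hG.lt f hf
  rcases lt_trichotomy (x f.1) (x e.1) with h | h | h
  · rcases lt_or_gt_of_ne (hG.ne_height f hf e.1 (hG.fst_mem e he) h (by linarith)) with h2 | h2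
    · refine false_of_not_edgesCross (hC f hf e he) hef.symm hs1 h.le le_rfl (by linarith)
        (by linarith) ?_ hes
      rwa [edgeHeight_fst]
    · refine false_of_not_edgesCross (hC e' he' f hf) hef'.symm (hs1.trans hsw) (by rw [h1])
        h.le hw3 hf2 ?_ hfw
      rwa [h1, edgeHeight_fst, ← h1]
  · have h0 : f.1 = e.1 := hx h
    have h3 := (edgeHeight_lt_iff h0.symm hs1).1 hes
    have h4 := (edgeHeight_lt_iff (h0.trans h1) (hs2.trans hsw)).1 hfw
    exact absurd (hcons f hf h0 h3) (not_le.2 h4)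
  · have h5 : edgeHeight x y e (x f.1) < y f.1 := by
      refine lt_of_le_of_ne (not_lt.1 fun h6 => ?_)
        (hG.ne_height e he f.1 (hG.fst_mem f hf) h (by linarith))
      refine false_of_not_edgesCross (hC f hf e he) hef.symm hs2 le_rfl h.le (by linarith)
        (by linarith) ?_ hes
      rwa [edgeHeight_fst]
    refine hemp f.1 (hG.fst_mem f hf) h (by linarith) h5 ?_
    refine lt_of_le_of_ne (not_lt.1 fun h6 => ?_)
        (hG.ne_height e' he' f.1 (hG.fst_mem f hf) (h1 ▸ h) (by linarith)).symm
    refine false_of_not_edgesCross (hC e' he' f hf) hef'.symm (hs2.trans hsw) (h1 ▸ h.le) le_rfl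
      hw3 hf2 ?_ hfw
    rwa [edgeHeight_fst]

/-- A plane geometric graph on `n` vertices has at most `3 * n` edges. -/
lemma IsGeometricGraph.card_le_of_plane (hx : Function.Injective x) {S : Finset ι}
    {E : Finset (ι × ι)} (hG : IsGeometricGraph x y S E)
    (hC : ∀ e ∈ E, ∀ f ∈ E, ¬ EdgesCross x y e f) : E.card ≤ 3 * S.card := by
  have key : ∀ e ∈ E, (∀ g ∈ E, g.1 = e.1 → edgeSlope x y g ≤ edgeSlope x y e) ∨
      ∃ w ∈ S, x e.1 < x w ∧ x w ≤ x e.2 ∧ (w = e.2 ∨ edgeHeight x y e (x w) < y w) ∧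
        ∀ f ∈ E, x f.1 < x w → x w ≤ x f.2 → edgeHeight x y f (x w) ≤ y w →
          (w = e.2 ∨ edgeHeight x y f (x w) < y w) →
          ∀ s, x e.1 < s → x f.1 < s → s < x w →
            edgeHeight x y f s ≤ edgeHeight x y e s := by
    intro e he
    by_cases htop : ∀ g ∈ E, g.1 = e.1 → edgeSlope x y g ≤ edgeSlope x y e
    · exact Or.inl htop
    right
    have le := hG.lt e he
    push Not at htop
    obtain ⟨e', he'm, hmin⟩ := Finset.exists_min_image
      (E.filter fun g => g.1 = e.1 ∧ edgeSlope x y e < edgeSlope x y g) (edgeSlope x y)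
      (by obtain ⟨g, h⟩ := htop; exact ⟨g, by simpa using h⟩)
    obtain ⟨he', h1, hlt⟩ := Finset.mem_filter.1 he'm
    have le' := hG.lt e' he'
    have hcons : ∀ g ∈ E, g.1 = e.1 → edgeSlope x y e < edgeSlope x y g →
        edgeSlope x y e' ≤ edgeSlope x y g := fun g hg h2 h3 =>
      hmin g (Finset.mem_filter.2 ⟨hg, h2, h3⟩)
    have hne : e.2 ≠ e'.2 := by
      intro h
      have : e = e' := Prod.ext h1.symm h
      rw [this] at hlt
      exact lt_irrefl _ hlt
    have hbelow : ∀ t, x e.1 < t → edgeHeight x y e t < edgeHeight x y e' t := fun t ht =>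
      (edgeHeight_lt_iff h1.symm ht).2 hlt
    obtain ⟨w, hwm, hwmin⟩ := Finset.exists_min_image
      (S.filter fun z => x e.1 < x z ∧ x z ≤ x e.2 ∧ x z ≤ x e'.2 ∧
        edgeHeight x y e (x z) ≤ y z ∧ y z ≤ edgeHeight x y e' (x z)) x (by
        rcases le_total (x e.2) (x e'.2) with h | h
        · refine ⟨e.2, Finset.mem_filter.2 ⟨hG.snd_mem e he, le, le_rfl, h, ?_, ?_⟩⟩
          · rw [edgeHeight_snd le]
          · rw [← edgeHeight_snd (y := y) le]
            exact (hbelow _ le).le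
        · refine ⟨e'.2, Finset.mem_filter.2 ⟨hG.snd_mem e' he', h1 ▸ le', h, le_rfl, ?_, ?_⟩⟩
          · rw [← edgeHeight_snd (y := y) le']
            exact (hbelow _ (h1 ▸ le')).le
          · rw [edgeHeight_snd le'])
    obtain ⟨hwS, hw1, hw2, hw3, hw4, hw5⟩ := Finset.mem_filter.1 hwm
    refine ⟨w, hwS, hw1, hw2, ?_, ?_⟩
    · by_cases h : w = e.2
      · exact Or.inl h
      · exact Or.inr (lt_of_le_of_ne hw4 (hG.ne_height e he w hwS hw1
          (lt_of_le_of_ne hw2 fun h2 => h (hx h2))))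
    · intro f hf hf1 hf2 hf3 hf4 s hs1 hs2 hsw
      refine not_lt.1 fun hes => ?_
      refine hG.false_of_edge_in_wedge hx hC he he' hf h1.symm hcons hw2 hw3 ?_ hf2 hs1 hs2 hsw
        hes ?_
      · intro z hz hz1 hz2 hz3 hz4
        exact absurd (hwmin z (Finset.mem_filter.2 ⟨hz, hz1, by linarith, by linarith,
          hz3.le, hz4.le⟩)) (not_le.2 hz2)
      · rcases hf4 with h | h
        · refine lt_of_le_of_lt hf3 (lt_of_le_of_ne hw5 ?_)
          refine (hG.ne_height e' he' w hwS (h1 ▸ hw1) (lt_of_le_of_ne hw3 fun h2 => ?_)).symm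
          exact hne (h.symm.trans (hx h2))
        · exact h.trans_le hw5
  have hlow : ∀ e ∈ E, ∀ f ∈ E, ∀ w, x e.1 < x w → x w ≤ x e.2 → x f.1 < x w → x w ≤ x f.2 →
      (∀ s, x e.1 < s → x f.1 < s → s < x w → edgeHeight x y f s ≤ edgeHeight x y e s) →
      (∀ s, x f.1 < s → x e.1 < s → s < x w → edgeHeight x y e s ≤ edgeHeight x y f s) →
      e = f := by
    intro e he f hf w h1 h2 h3 h4 h5 h6
    by_contra hne
    obtain ⟨s, hs1, hs2⟩ := exists_between (max_lt h1 h3)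
    have h7 := (le_max_left _ _).trans_lt hs1
    have h8 := (le_max_right _ _).trans_lt hs1
    exact hC e he f hf ⟨hne, s, h7, by linarith, h8, by linarith,
      le_antisymm (h6 s h8 h7 hs2) (h5 s h7 h8 hs2)⟩
  set T := E.filter fun e => ∀ g ∈ E, g.1 = e.1 → edgeSlope x y g ≤ edgeSlope x y e
  have hkey : ∀ e, ∃ w, e ∈ E → e ∉ T → w ∈ S ∧ x e.1 < x w ∧ x w ≤ x e.2 ∧
      (w = e.2 ∨ edgeHeight x y e (x w) < y w) ∧
        ∀ f ∈ E, x f.1 < x w → x w ≤ x f.2 → edgeHeight x y f (x w) ≤ y w →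
          (w = e.2 ∨ edgeHeight x y f (x w) < y w) →
          ∀ s, x e.1 < s → x f.1 < s → s < x w →
            edgeHeight x y f s ≤ edgeHeight x y e s := by
    intro e
    by_cases h : e ∈ E ∧ e ∉ T
    · rcases key e h.1 with h2 | ⟨w, h2⟩
      · exact absurd (Finset.mem_filter.2 ⟨h.1, h2⟩) h.2
      · exact ⟨w, fun _ _ => h2⟩
    · exact ⟨e.1, fun h1 h2 => absurd ⟨h1, h2⟩ h⟩
  choose c hc using hkey
  have hcT : T.card ≤ S.card := by
    refine Finset.card_le_card_of_injOn Prod.fst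
      (fun e he => hG.fst_mem e (Finset.mem_filter.1 he).1) ?_
    intro e he f hf hef
    obtain ⟨he1, he2⟩ := Finset.mem_filter.1 he
    obtain ⟨hf1, hf2⟩ := Finset.mem_filter.1 hf
    exact hG.eq_of_edgeSlope_eq hx he1 hf1 hef
      (le_antisymm (hf2 e he1 hef) (he2 f hf1 hef.symm))
  have hcA : ((E \ T).filter fun e => c e = e.2).card ≤ S.card := by
    refine Finset.card_le_card_of_injOn c ?_ ?_
    · intro e he
      obtain ⟨he1, he2⟩ := Finset.mem_filter.1 he
      obtain ⟨he3, he4⟩ := Finset.mem_sdiff.1 he1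
      exact (hc e he3 he4).1
    · intro e he f hf hef
      obtain ⟨he1, he2⟩ := Finset.mem_filter.1 he
      obtain ⟨he3, he4⟩ := Finset.mem_sdiff.1 he1
      obtain ⟨hf1, hf2⟩ := Finset.mem_filter.1 hf
      obtain ⟨hf3, hf4⟩ := Finset.mem_sdiff.1 hf1
      obtain ⟨-, a1, a2, a3, a4⟩ := hc e he3 he4
      obtain ⟨-, b1, b2, b3, b4⟩ := hc f hf3 hf4
      have ye : edgeHeight x y e (x (c e)) = y (c e) := by
        rw [he2, edgeHeight_snd (hG.lt e he3)]
      have yf : edgeHeight x y f (x (c f)) = y (c f) := by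
        rw [hf2, edgeHeight_snd (hG.lt f hf3)]
      rw [← hef] at b1 b2 b4 yf hf2
      exact hlow e he3 f hf3 (c e) a1 a2 b1 b2 (a4 f hf3 b1 b2 yf.le (Or.inl he2))
        (b4 e he3 a1 a2 ye.le (Or.inl hf2))
  have hcB : ((E \ T).filter fun e => ¬ c e = e.2).card ≤ S.card := by
    refine Finset.card_le_card_of_injOn c ?_ ?_
    · intro e he
      obtain ⟨he1, he2⟩ := Finset.mem_filter.1 he
      obtain ⟨he3, he4⟩ := Finset.mem_sdiff.1 he1
      exact (hc e he3 he4).1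
    · intro e he f hf hef
      obtain ⟨he1, he2⟩ := Finset.mem_filter.1 he
      obtain ⟨he3, he4⟩ := Finset.mem_sdiff.1 he1
      obtain ⟨hf1, hf2⟩ := Finset.mem_filter.1 hf
      obtain ⟨hf3, hf4⟩ := Finset.mem_sdiff.1 hf1
      obtain ⟨-, a1, a2, a3, a4⟩ := hc e he3 he4
      obtain ⟨-, b1, b2, b3, b4⟩ := hc f hf3 hf4
      have ye := a3.resolve_left he2
      have yf := b3.resolve_left hf2
      rw [← hef] at b1 b2 b4 yf hf2
      exact hlow e he3 f hf3 (c e) a1 a2 b1 b2 (a4 f hf3 b1 b2 yf.le (Or.inr yf))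
        (b4 e he3 a1 a2 ye.le (Or.inr ye))
  have h1 := Finset.card_filter_add_card_filter_not (s := E \ T) (fun e => c e = e.2)
  have hTE : T ⊆ E := Finset.filter_subset _ _
  have h2 := Finset.card_sdiff_add_card_eq_card hTE
  omega

lemma IsGeometricGraph.eq_of_forall_edgeHeight_eq (hx : Function.Injective x) {S : Finset ι}
    {E : Finset (ι × ι)} (hG : IsGeometricGraph x y S E) {e f : ι × ι} (he : e ∈ E) (hf : f ∈ E)
    (h : ∀ t, edgeHeight x y e t = edgeHeight x y f t) {t : ℝ} (h1 : x e.1 < t) (h2 : t < x e.2)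
    (h3 : x f.1 < t) (h4 : t < x f.2) : e = f := by
  have le := hG.lt e he
  have lf := hG.lt f hf
  refine Prod.ext (hx ?_) (hx ?_)
  · rcases lt_trichotomy (x e.1) (x f.1) with h5 | h5 | h5
    · refine absurd ?_ (hG.ne_height e he f.1 (hG.fst_mem f hf) h5 (by linarith))
      rw [h, edgeHeight_fst]
    · exact h5
    · refine absurd ?_ (hG.ne_height f hf e.1 (hG.fst_mem e he) h5 (by linarith))
      rw [← h, edgeHeight_fst]
  · rcases lt_trichotomy (x e.2) (x f.2) with h5 | h5 | h5
    · refine absurd ?_ (hG.ne_height f hf e.2 (hG.snd_mem e he) (by linarith) h5)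
      rw [← h, edgeHeight_snd le]
    · exact h5
    · refine absurd ?_ (hG.ne_height e he f.2 (hG.snd_mem f hf) (by linarith) h5)
      rw [h, edgeHeight_snd lf]

lemma edgeHeight_eq_of_eq_of_eq {e f : ι × ι} {s t : ℝ} (hst : s ≠ t)
    (hs : edgeHeight x y e s = edgeHeight x y f s)
    (ht : edgeHeight x y e t = edgeHeight x y f t) (r : ℝ) :
    edgeHeight x y e r = edgeHeight x y f r := by
  have key : ∀ g : ι × ι, edgeHeight x y g r =
      edgeHeight x y g s + (edgeHeight x y g t - edgeHeight x y g s) / (t - s) * (r - s) := by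
    intro g
    have : t - s ≠ 0 := sub_ne_zero.2 hst.symm
    unfold edgeHeight
    generalize (y g.2 - y g.1) / (x g.2 - x g.1) = a
    field_simp
    ring
  rw [key e, key f, hs, ht]

lemma IsGeometricGraph.card_endpoints_of_edgesCross (hx : Function.Injective x) {S : Finset ι}
    {E : Finset (ι × ι)} (hG : IsGeometricGraph x y S E) {e f : ι × ι} (he : e ∈ E) (hf : f ∈ E)
    (h : EdgesCross x y e f) : ({e.1, e.2, f.1, f.2} : Finset ι).card = 4 := by
  have le := hG.lt e he
  have lf := hG.lt f hf
  obtain ⟨hne, t, h1, h2, h3, h4, h5⟩ := h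
  have ha : e.1 ≠ f.1 := by
    intro h
    refine hne (hG.eq_of_forall_edgeHeight_eq hx he hf
      (edgeHeight_eq_of_eq_of_eq h1.ne ?_ h5) h1 h2 h3 h4)
    rw [edgeHeight_fst, h, edgeHeight_fst]
  have hb : e.2 ≠ f.2 := by
    intro h
    refine hne (hG.eq_of_forall_edgeHeight_eq hx he hf
      (edgeHeight_eq_of_eq_of_eq h2.ne h5 ?_) h1 h2 h3 h4)
    rw [edgeHeight_snd le, h, edgeHeight_snd lf]
  have hc : e.1 ≠ e.2 := fun h => by rw [h] at le; exact lt_irrefl _ le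
  have hd : f.1 ≠ f.2 := fun h => by rw [h] at lf; exact lt_irrefl _ lf
  have hi : e.1 ≠ f.2 := fun h => by rw [h] at h1; linarith
  have hj : e.2 ≠ f.1 := fun h => by rw [h] at h2; linarith
  rw [Finset.card_insert_of_notMem, Finset.card_insert_of_notMem, Finset.card_pair hd] <;>
    simp [ha, hb, hc, hi, hj]

/-- The ordered pairs of crossing edges. -/
noncomputable def crossingPairs (x y : ι → ℝ) (E : Finset (ι × ι)) :
    Finset ((ι × ι) × (ι × ι)) :=
  (E ×ˢ E).filter fun p => EdgesCross x y p.1 p.2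

lemma IsGeometricGraph.mono {S : Finset ι} {E F : Finset (ι × ι)}
    (hG : IsGeometricGraph x y S E) (hF : F ⊆ E) : IsGeometricGraph x y S F :=
  ⟨fun e he => hG.1 e (hF he), fun e he => hG.2 e (hF he), fun e he => hG.3 e (hF he),
    fun e he => hG.4 e (hF he)⟩

lemma IsGeometricGraph.card_le_crossingPairs_add (hx : Function.Injective x) {S : Finset ι}
    {E : Finset (ι × ι)} (hG : IsGeometricGraph x y S E) :
    E.card ≤ (crossingPairs x y E).card + 3 * S.card := by
  have h1 := (hG.mono (Finset.sdiff_subset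
    (t := (crossingPairs x y E).image Prod.fst))).card_le_of_plane hx (by
      intro e he f hf hef
      obtain ⟨he1, he2⟩ := Finset.mem_sdiff.1 he
      obtain ⟨hf1, hf2⟩ := Finset.mem_sdiff.1 hf
      exact he2 (Finset.mem_image.2 ⟨(e, f), Finset.mem_filter.2
        ⟨Finset.mem_product.2 ⟨he1, hf1⟩, hef⟩, rfl⟩))
  have h2 := Finset.le_card_sdiff ((crossingPairs x y E).image Prod.fst) E
  have h3 : ((crossingPairs x y E).image Prod.fst).card ≤ _ := Finset.card_image_le
  omega

lemma card_functions_eq_zero_on [Fintype ι] (m : ℕ) (T : Finset ι) :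
    (Finset.univ.filter fun f : ι → Fin (m + 1) => ∀ i ∈ T, f i = 0).card * (m + 1) ^ T.card =
      (m + 1) ^ Fintype.card ι := by
  have h : (Finset.univ.filter fun f : ι → Fin (m + 1) => ∀ i ∈ T, f i = 0) =
      Fintype.piFinset fun i => if i ∈ T then {0} else Finset.univ := by
    ext f
    simp only [Finset.mem_filter, Finset.mem_univ, true_and, Fintype.mem_piFinset]
    refine forall_congr' fun i => ?_
    split_ifs with hi <;> simp [hi]
  have h2 : ∀ i, (if i ∈ T then ({0} : Finset (Fin (m + 1))) else Finset.univ).card =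
      if i ∈ T then 1 else m + 1 := by
    intro i
    split_ifs <;> simp
  rw [h, Fintype.card_piFinset]
  simp_rw [h2]
  rw [Finset.prod_ite, Finset.prod_const_one, one_mul, Finset.prod_const, ← pow_add]
  congr 1
  have := Finset.card_filter_add_card_filter_not (s := Finset.univ) (fun i => i ∈ T)
  rw [Finset.card_univ] at this
  rw [← this, add_comm]
  simp

lemma sum_card_filter_eq_zero_on [Fintype ι] {α : Type*} (m t : ℕ) (A : Finset α)
    (T : α → Finset ι) (hT : ∀ a ∈ A, (T a).card = t) :
    (∑ f : ι → Fin (m + 1), (A.filter fun a => ∀ i ∈ T a, f i = 0).card) * (m + 1) ^ t =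
      A.card * (m + 1) ^ Fintype.card ι := by
  simp_rw [Finset.card_filter]
  rw [Finset.sum_comm, Finset.sum_mul, Finset.card_eq_sum_ones, Finset.sum_mul]
  refine Finset.sum_congr rfl fun a ha => ?_
  rw [← Finset.card_filter, ← hT a ha, card_functions_eq_zero_on, one_mul]

/-- The crossing inequality with a sampling parameter `q = m + 1`. -/
lemma IsGeometricGraph.card_mul_sq_le [Fintype ι] (hx : Function.Injective x)
    {E : Finset (ι × ι)} (hG : IsGeometricGraph x y Finset.univ E) (m : ℕ) :
    E.card * (m + 1) ^ 2 ≤ (crossingPairs x y E).card + 3 * Fintype.card ι * (m + 1) ^ 3 := by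
  have hE := sum_card_filter_eq_zero_on m 2 E (fun e => {e.1, e.2}) (fun e he =>
    Finset.card_pair fun h => (hG.lt e he).ne (congrArg x h))
  have hX := sum_card_filter_eq_zero_on m 4 (crossingPairs x y E)
    (fun p => {p.1.1, p.1.2, p.2.1, p.2.2}) (fun p hp => by
      obtain ⟨h1, h2⟩ := Finset.mem_filter.1 hp
      obtain ⟨h3, h4⟩ := Finset.mem_product.1 h1
      exact hG.card_endpoints_of_edgesCross hx h3 h4 h2)
  have hV := sum_card_filter_eq_zero_on m 1 (Finset.univ : Finset ι) (fun v => {v})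
    (fun v _ => Finset.card_singleton v)
  rw [Finset.card_univ] at hV
  have hsum := Finset.sum_le_sum (s := (Finset.univ : Finset (ι → Fin (m + 1))))
    (f := fun f => (E.filter fun a => ∀ i ∈ ({a.1, a.2} : Finset ι), f i = 0).card)
    (g := fun f => ((crossingPairs x y E).filter fun p =>
      ∀ i ∈ ({p.1.1, p.1.2, p.2.1, p.2.2} : Finset ι), f i = 0).card +
      3 * (Finset.univ.filter fun v => ∀ i ∈ ({v} : Finset ι), f i = 0).card) (by
    intro f _
    have hGf : IsGeometricGraph x y (Finset.univ.filter fun v => ∀ i ∈ ({v} : Finset ι), f i = 0)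
        (E.filter fun a => ∀ i ∈ ({a.1, a.2} : Finset ι), f i = 0) := by
      refine ⟨?_, ?_, ?_, ?_⟩
      · intro e he
        simp at he ⊢
        exact he.2.1
      · intro e he
        simp at he ⊢
        exact he.2.2
      · intro e he
        exact hG.lt e (Finset.mem_filter.1 he).1
      · intro e he w _
        exact hG.ne_height e (Finset.mem_filter.1 he).1 w (Finset.mem_univ w)
    refine (hGf.card_le_crossingPairs_add hx).trans (Nat.add_le_add_right
      (Finset.card_le_card ?_) _)
    intro p hp
    simp only [crossingPairs, Finset.mem_filter, Finset.mem_product, Finset.mem_insert,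
      Finset.mem_singleton, forall_eq_or_imp, forall_eq] at hp ⊢
    tauto)
  rw [Finset.sum_add_distrib, ← Finset.mul_sum] at hsum
  refine le_of_mul_le_mul_right (a := (m + 1) ^ Fintype.card ι) ?_ (by positivity)
  calc _ = E.card * (m + 1) ^ Fintype.card ι * (m + 1) ^ 2 := by ring
    _ = _ * (m + 1) ^ 4 := by rw [← hE]; ring
    _ ≤ _ := Nat.mul_le_mul_right _ hsum
    _ = _ := by rw [add_mul, hX]; linear_combination 3 * (m + 1) ^ 3 * hV

/-- The points with index in `ι` on the line of slope `l.1` and intercept `l.2`. -/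
noncomputable def linePoints [Fintype ι] (x y : ι → ℝ) (l : ℝ × ℝ) : Finset ι :=
  Finset.univ.filter fun i => y i = l.1 * x i + l.2

/-- The pairs of consecutive points on the line of slope `l.1` and intercept `l.2`. -/
noncomputable def lineEdges [Fintype ι] (x y : ι → ℝ) (l : ℝ × ℝ) : Finset (ι × ι) :=
  Finset.univ.filter fun e => e.1 ∈ linePoints x y l ∧ e.2 ∈ linePoints x y l ∧ x e.1 < x e.2 ∧
    ∀ w ∈ linePoints x y l, x e.1 < x w → x e.2 ≤ x w

section
variable [Fintype ι]

lemma mem_linePoints {l : ℝ × ℝ} {i : ι} : i ∈ linePoints x y l ↔ y i = l.1 * x i + l.2 := by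
  simp [linePoints]

lemma mem_lineEdges {l : ℝ × ℝ} {e : ι × ι} : e ∈ lineEdges x y l ↔
    e.1 ∈ linePoints x y l ∧ e.2 ∈ linePoints x y l ∧ x e.1 < x e.2 ∧
    ∀ w ∈ linePoints x y l, x e.1 < x w → x e.2 ≤ x w := by
  simp [lineEdges]

lemma edgeHeight_of_mem_lineEdges {l : ℝ × ℝ} {e : ι × ι} (he : e ∈ lineEdges x y l) (t : ℝ) :
    edgeHeight x y e t = l.1 * t + l.2 := by
  obtain ⟨h1, h2, h3, -⟩ := mem_lineEdges.1 he
  rw [mem_linePoints] at h1 h2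
  have : x e.2 - x e.1 ≠ 0 := by linarith
  unfold edgeHeight
  rw [h1, h2]
  field_simp
  ring

lemma line_eq_of_eq_of_eq {l m : ℝ × ℝ} {s t : ℝ} (hst : s ≠ t)
    (hs : l.1 * s + l.2 = m.1 * s + m.2) (ht : l.1 * t + l.2 = m.1 * t + m.2) : l = m := by
  have h1 : l.1 = m.1 := by
    have : (l.1 - m.1) * (s - t) = 0 := by linear_combination hs - ht
    exact sub_eq_zero.1 ((mul_eq_zero.1 this).resolve_right (sub_ne_zero.2 hst))
  refine Prod.ext h1 ?_
  rw [h1] at hs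
  exact add_left_cancel hs

lemma card_linePoints_le (hx : Function.Injective x) (l : ℝ × ℝ) :
    (linePoints x y l).card ≤ (lineEdges x y l).card + 1 := by
  rcases (linePoints x y l).eq_empty_or_nonempty with h | h
  · simp [h]
  obtain ⟨z, hz, hmax⟩ := Finset.exists_max_image _ x h
  have hsub : (linePoints x y l).erase z ⊆ (lineEdges x y l).image Prod.fst := by
    intro u hu
    obtain ⟨huz, hu⟩ := Finset.mem_erase.1 hu
    have hlt : x u < x z := lt_of_le_of_ne (hmax u hu) fun h => huz (hx h)
    obtain ⟨v, hv, hmin⟩ := Finset.exists_min_image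
      ((linePoints x y l).filter fun v => x u < x v) x ⟨z, Finset.mem_filter.2 ⟨hz, hlt⟩⟩
    obtain ⟨hv1, hv2⟩ := Finset.mem_filter.1 hv
    exact Finset.mem_image.2 ⟨(u, v), mem_lineEdges.2 ⟨hu, hv1, hv2, fun w hw huw =>
      hmin w (Finset.mem_filter.2 ⟨hw, huw⟩)⟩, rfl⟩
  have h1 := (Finset.card_le_card hsub).trans Finset.card_image_le
  rw [Finset.card_erase_of_mem hz] at h1
  omega

lemma isGeometricGraph_biUnion_lineEdges (L : Finset (ℝ × ℝ)) :
    IsGeometricGraph x y Finset.univ (L.biUnion (lineEdges x y)) := by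
  refine ⟨fun e _ => Finset.mem_univ _, fun e _ => Finset.mem_univ _, ?_, ?_⟩
  · intro e he
    obtain ⟨l, -, hl⟩ := Finset.mem_biUnion.1 he
    exact (mem_lineEdges.1 hl).2.2.1
  · intro e he w _ h1 h2 h3
    obtain ⟨l, -, hl⟩ := Finset.mem_biUnion.1 he
    rw [edgeHeight_of_mem_lineEdges hl] at h3
    exact absurd ((mem_lineEdges.1 hl).2.2.2 w (mem_linePoints.2 h3.symm) h1) (not_le.2 h2)

lemma card_crossingPairs_le (hx : Function.Injective x) (L : Finset (ℝ × ℝ)) :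
    (crossingPairs x y (L.biUnion (lineEdges x y))).card ≤ L.card ^ 2 := by
  have hG := isGeometricGraph_biUnion_lineEdges (x := x) (y := y) L
  have hex : ∀ e, ∃ l, e ∈ L.biUnion (lineEdges x y) → l ∈ L ∧ e ∈ lineEdges x y l := by
    intro e
    by_cases h : e ∈ L.biUnion (lineEdges x y)
    · obtain ⟨l, hl⟩ := Finset.mem_biUnion.1 h
      exact ⟨l, fun _ => hl⟩
    · exact ⟨0, fun h' => absurd h' h⟩
  choose g hg using hex
  rw [sq, ← Finset.card_product]
  refine Finset.card_le_card_of_injOn (fun p => (g p.1, g p.2)) ?_ ?_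
  · intro p hp
    obtain ⟨h1, -⟩ := Finset.mem_filter.1 hp
    obtain ⟨h1, h2⟩ := Finset.mem_product.1 h1
    exact Finset.mem_product.2 ⟨(hg _ h1).1, (hg _ h2).1⟩
  · rintro ⟨e, f⟩ hp ⟨e', f'⟩ hp' heq
    obtain ⟨h1, hne, t, a1, a2, a3, a4, a5⟩ := Finset.mem_filter.1 hp
    obtain ⟨h1', -, t', b1, b2, b3, b4, b5⟩ := Finset.mem_filter.1 hp'
    obtain ⟨he, hf⟩ := Finset.mem_product.1 h1
    obtain ⟨he', hf'⟩ := Finset.mem_product.1 h1'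
    obtain ⟨h2, h3⟩ := Prod.mk.inj heq
    dsimp only at *
    have hhe := edgeHeight_of_mem_lineEdges (hg e he).2
    have hhf := edgeHeight_of_mem_lineEdges (hg f hf).2
    have hhe' := edgeHeight_of_mem_lineEdges (hg e' he').2
    have hhf' := edgeHeight_of_mem_lineEdges (hg f' hf').2
    rw [← h2] at hhe'
    rw [← h3] at hhf'
    have htt : t = t' := by
      by_contra htt
      rw [hhe, hhf] at a5
      rw [hhe', hhf'] at b5
      have hl := line_eq_of_eq_of_eq htt a5 b5
      refine hne (hG.eq_of_forall_edgeHeight_eq hx he hf (fun s => ?_) a1 a2 a3 a4)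
      rw [hhe, hhf, hl]
    subst htt
    refine Prod.ext ?_ ?_
    · exact hG.eq_of_forall_edgeHeight_eq hx he he' (fun s => by rw [hhe, hhe']) a1 a2 b1 b2
    · exact hG.eq_of_forall_edgeHeight_eq hx hf hf' (fun s => by rw [hhf, hhf']) a3 a4 b3 b4

lemma card_mul_le_card_biUnion_lineEdges (hx : Function.Injective x) (L : Finset (ℝ × ℝ)) (j : ℕ)
    (hL : ∀ l ∈ L, j + 1 ≤ (linePoints x y l).card) :
    L.card * j ≤ (L.biUnion (lineEdges x y)).card := by
  rw [Finset.card_biUnion, ← smul_eq_mul]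
  · refine Finset.card_nsmul_le_sum _ _ _ fun l hl => ?_
    have h1 := hL l hl
    have h2 := card_linePoints_le (y := y) hx l
    omega
  · intro l _ m _ hlm
    refine Finset.disjoint_left.2 fun e he hf => hlm ?_
    refine line_eq_of_eq_of_eq (s := 0) (t := 1) (by norm_num) ?_ ?_ <;>
      rw [← edgeHeight_of_mem_lineEdges he, ← edgeHeight_of_mem_lineEdges hf]

/-- The Szemerédi–Trotter bound on the number of lines containing at least `j + 1` points. -/
theorem card_mul_cube_le_of_rich_lines (hx : Function.Injective x) (L : Finset (ℝ × ℝ)) (j : ℕ)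
    (hL : ∀ l ∈ L, j + 1 ≤ (linePoints x y l).card) :
    L.card * j ^ 3 ≤ 288 * Fintype.card ι ^ 2 + 6 * Fintype.card ι * j ^ 2 := by
  have hE := card_mul_le_card_biUnion_lineEdges hx L j hL
  have hX := card_crossingPairs_le (y := y) hx L
  have hS := (isGeometricGraph_biUnion_lineEdges (y := y) L).card_mul_sq_le hx
  set E := (L.biUnion (lineEdges x y)).card
  set N := L.card
  set n := Fintype.card ι
  rcases lt_or_ge E (6 * n) with h | h
  · calc N * j ^ 3 = N * j * j ^ 2 := by ring
      _ ≤ 6 * n * j ^ 2 := Nat.mul_le_mul_right _ (by omega)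
      _ ≤ _ := Nat.le_add_left _ _
  rcases Nat.eq_zero_or_pos n with hn | hn
  · have : E ≤ 0 := by
      have : IsEmpty ι := Fintype.card_eq_zero_iff.1 hn
      exact (Finset.card_eq_zero.2 (Finset.eq_empty_of_isEmpty _)).le
    have h2 : N * j = 0 := by omega
    calc N * j ^ 3 = N * j * j ^ 2 := by ring
      _ ≤ _ := by rw [h2, zero_mul]; exact Nat.zero_le _
  rcases Nat.eq_zero_or_pos N with hN | hN
  · rw [hN, zero_mul]
    exact Nat.zero_le _
  have hq : 1 ≤ E / (6 * n) := (Nat.one_le_div_iff (by omega)).2 h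
  obtain ⟨m, hm⟩ := Nat.exists_eq_add_of_le' hq
  have h1 : (m + 1) * (6 * n) ≤ E := hm ▸ Nat.div_mul_le_self _ _
  have h2 : E ≤ 12 * n * (m + 1) := by
    have : E < 6 * n * (E / (6 * n) + 1) := Nat.lt_mul_div_succ _ (by omega)
    rw [hm] at this
    nlinarith
  have h3 : E * (m + 1) ^ 2 ≤ 2 * N ^ 2 := by
    have := hS m
    have h4 := Nat.mul_le_mul_right ((m + 1) ^ 2) h1
    nlinarith
  have h4 : N ^ 2 * (N * j ^ 3) ≤ N ^ 2 * (288 * n ^ 2) := by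
    calc N ^ 2 * (N * j ^ 3) = (N * j) ^ 3 := by ring
      _ ≤ E ^ 3 := Nat.pow_le_pow_left hE 3
      _ = E * E ^ 2 := by ring
      _ ≤ E * (12 * n * (m + 1)) ^ 2 := Nat.mul_le_mul_left _ (Nat.pow_le_pow_left h2 2)
      _ = 144 * n ^ 2 * (E * (m + 1) ^ 2) := by ring
      _ ≤ 144 * n ^ 2 * (2 * N ^ 2) := Nat.mul_le_mul_left _ h3
      _ = _ := by ring
  exact (Nat.le_of_mul_le_mul_left h4 (by positivity)).trans (Nat.le_add_right _ _)

lemma choose_succ_eq_sum_range_choose (m k : ℕ) :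
    m.choose (k + 1) = ∑ j ∈ Finset.range m, j.choose k := by
  induction m with
  | zero => simp
  | succ m ih => rw [Finset.sum_range_succ, Nat.choose_succ_succ, ih, add_comm]

lemma sum_choose_card_linePoints_le (hx : Function.Injective x) (L : Finset (ℝ × ℝ)) (d ℓ : ℕ)
    (hL : ∀ l ∈ L, (linePoints x y l).card ≤ ℓ) :
    ∑ l ∈ L, (linePoints x y l).card.choose (d + 4) ≤
      288 * (ℓ ^ (d + 1) * Fintype.card ι ^ 2 + ℓ ^ (d + 3) * Fintype.card ι) := by
  calc ∑ l ∈ L, (linePoints x y l).card.choose (d + 4)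
      = ∑ l ∈ L, ∑ j ∈ Finset.range ℓ,
          if j + 1 ≤ (linePoints x y l).card then j.choose (d + 3) else 0 := by
        refine Finset.sum_congr rfl fun l hl => ?_
        rw [choose_succ_eq_sum_range_choose, ← Finset.sum_filter]
        refine Finset.sum_congr ?_ fun _ _ => rfl
        ext j
        have := hL l hl
        simp only [Finset.mem_range, Finset.mem_filter]
        omega
    _ = ∑ j ∈ Finset.range ℓ,
          (L.filter fun l => j + 1 ≤ (linePoints x y l).card).card * j.choose (d + 3) := by
        rw [Finset.sum_comm]
        refine Finset.sum_congr rfl fun j _ => ?_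
        rw [← Finset.sum_filter, Finset.sum_const, smul_eq_mul]
    _ ≤ ∑ j ∈ Finset.range ℓ,
          ℓ ^ d * (288 * Fintype.card ι ^ 2 + 6 * Fintype.card ι * ℓ ^ 2) := by
        refine Finset.sum_le_sum fun j hj => ?_
        have hj := (Finset.mem_range.1 hj).le
        have h := card_mul_cube_le_of_rich_lines hx
          (L.filter fun l => j + 1 ≤ (linePoints x y l).card) j
          fun l hl => (Finset.mem_filter.1 hl).2
        generalize (L.filter fun l => j + 1 ≤ (linePoints x y l).card).card = N at h ⊢
        calc N * j.choose (d + 3) ≤ N * j ^ (d + 3) :=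
              Nat.mul_le_mul_left _ (Nat.choose_le_pow _ _)
          _ = j ^ d * (N * j ^ 3) := by ring
          _ ≤ j ^ d * (288 * Fintype.card ι ^ 2 + 6 * Fintype.card ι * j ^ 2) :=
              Nat.mul_le_mul_left _ h
          _ ≤ _ := by gcongr
    _ = 288 * (ℓ ^ (d + 1) * Fintype.card ι ^ 2) + 6 * (ℓ ^ (d + 3) * Fintype.card ι) := by
        rw [Finset.sum_const, Finset.card_range, smul_eq_mul]
        ring
    _ ≤ _ := by
        generalize ℓ ^ (d + 3) * Fintype.card ι = a
        omega

end

end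

lemma exists_shear_injective (P : Finset (ℝ × ℝ)) :
    ∃ t : ℝ, Function.Injective fun p : P => p.1.1 + t * p.1.2 := by
  obtain ⟨t, ht⟩ := Infinite.exists_notMem_finset
    ((P ×ˢ P).image fun p => (p.2.1 - p.1.1) / (p.1.2 - p.2.2))
  refine ⟨t, fun p q hpq => ?_⟩
  dsimp only at hpq
  by_cases h : p.1.2 = q.1.2
  · rw [h] at hpq
    exact Subtype.ext (Prod.ext (add_right_cancel hpq) h)
  · refine absurd (Finset.mem_image.2 ⟨(p.1, q.1), Finset.mem_product.2 ⟨p.2, q.2⟩, ?_⟩) ht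
    rw [div_eq_iff (sub_ne_zero.2 h)]
    linear_combination -hpq

lemma collinear_map_linePoints {P : Finset (ℝ × ℝ)} (t : ℝ) (l : ℝ × ℝ) :
    Collinear ℝ (((linePoints (fun p : P => p.1.1 + t * p.1.2) (fun p : P => p.1.2) l).map
      (Function.Embedding.subtype _) : Finset (ℝ × ℝ)) : Set (ℝ × ℝ)) := by
  rw [collinear_iff_exists_forall_eq_smul_vadd]
  refine ⟨(-(t * l.2), l.2), (1 - t * l.1, l.1), fun p hp => ⟨p.1 + t * p.2, ?_⟩⟩
  obtain ⟨q, hq, rfl⟩ := Finset.mem_map.1 (Finset.mem_coe.1 hp)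
  have h := mem_linePoints.1 hq
  dsimp only [Function.Embedding.subtype_apply] at h ⊢
  refine Prod.ext ?_ ?_
  · simp only [vadd_eq_add, Prod.fst_add, Prod.smul_fst, smul_eq_mul]
    linear_combination -t * h
  · simp only [vadd_eq_add, Prod.snd_add, Prod.smul_snd, smul_eq_mul]
    linear_combination h

lemma exists_line_of_collinear {P T : Finset (ℝ × ℝ)} {t : ℝ}
    (ht : Function.Injective fun p : P => p.1.1 + t * p.1.2) (hTP : T ⊆ P) (hT : 1 < T.card)
    (hc : Collinear ℝ (T : Set (ℝ × ℝ))) :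
    ∃ p ∈ P ×ˢ P, T ⊆ (linePoints (fun p : P => p.1.1 + t * p.1.2) (fun p : P => p.1.2)
      ((p.2.2 - p.1.2) / (p.2.1 + t * p.2.2 - (p.1.1 + t * p.1.2)),
        p.1.2 - (p.2.2 - p.1.2) / (p.2.1 + t * p.2.2 - (p.1.1 + t * p.1.2)) *
          (p.1.1 + t * p.1.2))).map (Function.Embedding.subtype _) := by
  obtain ⟨p, hp, q, hq, hpq⟩ := Finset.one_lt_card.1 hT
  refine ⟨(p, q), Finset.mem_product.2 ⟨hTP hp, hTP hq⟩, fun z hz => ?_⟩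
  refine Finset.mem_map.2 ⟨⟨z, hTP hz⟩, mem_linePoints.2 ?_, rfl⟩
  have hne : q.1 + t * q.2 - (p.1 + t * p.2) ≠ 0 := fun h => hpq
    (congrArg Subtype.val (ht (a₁ := ⟨p, hTP hp⟩) (a₂ := ⟨q, hTP hq⟩) (sub_eq_zero.1 h).symm))
  obtain ⟨v, hv⟩ := (collinear_iff_of_mem (Finset.mem_coe.2 hp)).1 hc
  obtain ⟨r, rfl⟩ := hv q hq
  obtain ⟨s, rfl⟩ := hv z hz
  simp only [vadd_eq_add, Prod.fst_add, Prod.snd_add, Prod.smul_fst, Prod.smul_snd,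
    smul_eq_mul] at hne ⊢
  have hne' : r * (v.1 + t * v.2) ≠ 0 := fun h => hne (by linear_combination h)
  have hv : v.1 + t * v.2 ≠ 0 := right_ne_zero_of_mul hne'
  have hslope : (r * v.2 + p.2 - p.2) / (r * v.1 + p.1 + t * (r * v.2 + p.2) - (p.1 + t * p.2)) =
      v.2 / (v.1 + t * v.2) := by
    rw [div_eq_div_iff hne hv]
    ring
  rw [hslope]
  linear_combination -s * div_mul_cancel₀ v.2 hv

lemma card_collinear_powersetCard_le {d ℓ : ℕ} {P : Finset (ℝ × ℝ)} (hP : AtMostCollinear P ℓ) :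
    ((P.powersetCard (d + 4)).filter
      fun T : Finset (ℝ × ℝ) => Collinear ℝ (T : Set (ℝ × ℝ))).card ≤
      288 * (ℓ ^ (d + 1) * P.card ^ 2 + ℓ ^ (d + 3) * P.card) := by
  obtain ⟨t, ht⟩ := exists_shear_injective P
  set x : P → ℝ := fun p => p.1.1 + t * p.1.2
  set y : P → ℝ := fun p => p.1.2
  set L : Finset (ℝ × ℝ) := (P ×ˢ P).image fun p =>
    ((p.2.2 - p.1.2) / (p.2.1 + t * p.2.2 - (p.1.1 + t * p.1.2)),
      p.1.2 - (p.2.2 - p.1.2) / (p.2.1 + t * p.2.2 - (p.1.1 + t * p.1.2)) *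
        (p.1.1 + t * p.1.2))
  have hsub : ((P.powersetCard (d + 4)).filter
      fun T : Finset (ℝ × ℝ) => Collinear ℝ (T : Set (ℝ × ℝ))) ⊆
      L.biUnion fun l => ((linePoints x y l).map
        (Function.Embedding.subtype _)).powersetCard (d + 4) := by
    intro T hT
    obtain ⟨hT1, hT2⟩ := Finset.mem_filter.1 hT
    obtain ⟨hT3, hT4⟩ := Finset.mem_powersetCard.1 hT1
    obtain ⟨p, hp, hTp⟩ := exists_line_of_collinear ht hT3 (by omega) hT2
    exact Finset.mem_biUnion.2 ⟨_, Finset.mem_image.2 ⟨p, hp, rfl⟩,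
      Finset.mem_powersetCard.2 ⟨hTp, hT4⟩⟩
  have hcard := (Finset.card_le_card hsub).trans Finset.card_biUnion_le
  simp only [Finset.card_powersetCard, Finset.card_map] at hcard
  have hbound := hcard.trans (sum_choose_card_linePoints_le ht L d ℓ fun l _ => by
    have h := hP _ (fun z hz => by
      obtain ⟨q, -, rfl⟩ := Finset.mem_map.1 hz
      exact q.2) (collinear_map_linePoints (P := P) t l)
    rwa [Finset.card_map] at h)
  rwa [Fintype.card_coe] at hbound

/-- There is an absolute constant `c > 0` such that for `k ≥ 4`, every set of `n` points
in the plane with at most `ℓ` collinear (`ℓ ≥ 3`) has at most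
`c·(ℓ^(k−3)·n² + ℓ^(k−1)·n)` collinear `k`-element subsets. -/
theorem number_of_collinear_k_tuples :
    ∃ c : ℝ, 0 < c ∧
      ∀ (k ℓ n : ℕ) (P : Finset (ℝ × ℝ)),
        4 ≤ k → 3 ≤ ℓ → P.card = n → AtMostCollinear P ℓ →
        (((P.powersetCard k).filter
            (fun T => Collinear ℝ (T : Set (ℝ × ℝ)))).card : ℝ)
          ≤ c * ((ℓ : ℝ) ^ (k - 3) * (n : ℝ) ^ 2 + (ℓ : ℝ) ^ (k - 1) * n) := by
  refine ⟨288, by norm_num, fun k ℓ n P hk _ hn hP => ?_⟩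
  obtain ⟨d, rfl⟩ := Nat.exists_eq_add_of_le' hk
  have hbound := card_collinear_powersetCard_le (d := d) hP
  rw [hn] at hbound
  refine le_trans (Nat.cast_le.2 ?_) (by exact_mod_cast hbound)
  refine le_trans (Finset.card_le_card (t := ((P.powersetCard (d + 4)).filter
    fun T : Finset (ℝ × ℝ) => Collinear ℝ (T : Set (ℝ × ℝ))).image
      fun T : Finset (ℝ × ℝ) => (T : Set (ℝ × ℝ))) ?_) Finset.card_image_le
  intro T hT
  obtain ⟨hT1, hT2⟩ := Finset.mem_filter.1 hT
  obtain ⟨U, hU, hTU⟩ := Finset.mem_sup.1 hT1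
  obtain rfl := Finset.mem_singleton.1 hTU
  exact Finset.mem_image.2 ⟨U, Finset.mem_filter.2 ⟨hU, hT2⟩, rfl⟩
end
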